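/- arXiv:1710.04510 — 2 statements merged into one kernel-verified Lean document; each statement's English description precedes it below -/
import Mathlib

section
/- Let U_s be an admissible shear flow and let γ ≥ 0. Assume that ξ(γ) = 0. Then for all sufficiently small η > 0, the winding number of the closed curve Φ_inv ∘ C_η around γ equals ξ₋(γ) − ξ₊(γ). In particular, if ξ₋(γ) − ξ₊(γ) > 0, then there exists μ ∈ ℂ with Im μ > η such that Φ_inv(μ) = γ. -/
open MeasureTheory Filter Set

noncomputable section

/-- The source term `F(y) = 1 - U(y) + y U'(y)` of the eigenmode ODE. -/
def srcF (U : ℝ → ℝ) (y : ℝ) : ℝ := 1 - U y + y * deriv U y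

/-- The displacement thickness `Δ_s = ∫₀^∞ (1 - U)`. -/
def deltaS (U : ℝ → ℝ) : ℝ := ∫ y in Ioi (0:ℝ), (1 - U y)

/-- An admissible shear flow: smooth, monotone, `U(0) = 0`, `U → 1`,
`U''(0) ≠ 0`, finitely many inflexion points, and the decay conditions of the paper. -/
structure AdmissibleShearFlow (U : ℝ → ℝ) : Prop where
  smooth : ContDiff ℝ (⊤ : ℕ∞) U
  mem_Ico : ∀ y, 0 ≤ y → U y ∈ Ico (0:ℝ) 1
  zero_val : U 0 = 0
  deriv_pos : ∀ y, 0 ≤ y → 0 < deriv U y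
  tendsto_one : Tendsto U atTop (nhds 1)
  snd_deriv_zero_ne : iteratedDeriv 2 U 0 ≠ 0
  finite_inflexions : {y : ℝ | 0 < y ∧ iteratedDeriv 2 U y = 0}.Finite
  integrable_defect : IntegrableOn (fun y => 1 - U y) (Ioi (0:ℝ))
  derivs_bounded : ∀ j : ℕ, 1 ≤ j → j ≤ 3 →
    ∃ M : ℝ, ∀ y, 0 ≤ y → |iteratedDeriv j U y| ≤ M
  decay_ratio₁ : Tendsto (fun y => (1 - U y) ^ 2 / deriv U y) atTop (nhds 0)
  decay_ratio₂ : Tendsto (fun y => y * (1 - U y)) atTop (nhds 0)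
  decay_ratio₃ : IntegrableOn
    (fun y => (1 - U y) ^ 2 * iteratedDeriv 2 U y / (deriv U y) ^ 2) (Ioi (0:ℝ))
  kappa_decay : ∃ κ : ℝ, 0 < κ ∧ κ < 1/2 ∧ ∃ yκ > (0:ℝ), ∃ cκ > (0:ℝ),
    ∀ y, yκ ≤ y →
      (1 - U y) ^ ((2:ℝ) - κ) * iteratedDeriv 2 U y ≤ -cκ * (deriv U y) ^ 3

/-- `φ` is a smooth solution of the eigenmode problem
`(μ - U_s)φ' + U_s'φ - (i/k)φ''' = F`, `φ(0) = 0`, `φ'(0) = 1`, `φ' → 0`, `φ → L`. -/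
def IsEigSolution (U : ℝ → ℝ) (μ : ℂ) (k : ℝ) (L : ℂ) (φ : ℝ → ℂ) : Prop :=
  ContDiff ℝ (⊤ : ℕ∞) φ ∧
  (∀ y, 0 ≤ y →
    (μ - (U y : ℂ)) * deriv φ y + ((deriv U y : ℝ) : ℂ) * φ y
      - Complex.I / (k : ℂ) * iteratedDeriv 3 φ y = (srcF U y : ℂ)) ∧
  φ 0 = 0 ∧ deriv φ 0 = 1 ∧
  Tendsto (deriv φ) atTop (nhds 0) ∧
  Tendsto φ atTop (nhds L)

/-- Same problem without the prescribed limit at infinity. -/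
def IsBLSolution (U : ℝ → ℝ) (μ : ℂ) (k : ℝ) (φ : ℝ → ℂ) : Prop :=
  ContDiff ℝ (⊤ : ℕ∞) φ ∧
  (∀ y, 0 ≤ y →
    (μ - (U y : ℂ)) * deriv φ y + ((deriv U y : ℝ) : ℂ) * φ y
      - Complex.I / (k : ℂ) * iteratedDeriv 3 φ y = (srcF U y : ℂ)) ∧
  φ 0 = 0 ∧ deriv φ 0 = 1 ∧ Tendsto (deriv φ) atTop (nhds 0)

/-- Cauchy principal value `PV ∫₀¹ h(u)/(u - a) du`. -/
def pvIntegral (h : ℝ → ℝ) (a : ℝ) : ℝ :=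
  limUnder (nhdsWithin (0:ℝ) (Ioi 0))
    (fun ε => ∫ u in Ioo (0:ℝ) 1 \ Ioo (a - ε) (a + ε), h u / (u - a))

/-- Inverse of the shear flow on `[0, ∞)`. -/
def shearInv (U : ℝ → ℝ) (u : ℝ) : ℝ := Function.invFunOn U (Ici 0) u

/-- `g(u) = (1-u)² U''(U⁻¹(u)) / (U'(U⁻¹(u)))³`. -/
def gfun (U : ℝ → ℝ) (u : ℝ) : ℝ :=
  (1 - u) ^ 2 * iteratedDeriv 2 U (shearInv U u) / (deriv U (shearInv U u)) ^ 3

/-- `G(a) = 1/(a U'(0)) + PV ∫₀¹ g(u)/(u-a) du + iπ g(a)`. -/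
def Gfun (U : ℝ → ℝ) (a : ℝ) : ℂ :=
  ((1 / (a * deriv U 0) + pvIntegral (gfun U) a : ℝ) : ℂ)
    + Complex.I * ((Real.pi * gfun U a : ℝ) : ℂ)

/-- Crossing abscissa `χ(y) = Re G(U(y))`. -/
def chiAbscissa (U : ℝ → ℝ) (y : ℝ) : ℝ := (Gfun U (U y)).re

/-- `ξ(γ)`: number of zeros of `U''` in `(0,∞)` with `χ(yᵢ) = γ`. -/
def xiEq (U : ℝ → ℝ) (γ : ℝ) : ℕ :=
  {y : ℝ | 0 < y ∧ iteratedDeriv 2 U y = 0 ∧ chiAbscissa U y = γ}.ncard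

/-- `ξ₊(γ)`: zeros of `U''` with `χ(yᵢ) < γ`, `U'' < 0` on the left and `U'' > 0`
on the right. -/
def xiPlus (U : ℝ → ℝ) (γ : ℝ) : ℕ :=
  {y : ℝ | 0 < y ∧ iteratedDeriv 2 U y = 0 ∧ chiAbscissa U y < γ ∧
    ∃ δ > (0:ℝ), (∀ z ∈ Ioo (y - δ) y, iteratedDeriv 2 U z < 0) ∧
      (∀ z ∈ Ioo y (y + δ), 0 < iteratedDeriv 2 U z)}.ncard

/-- `ξ₋(γ)`: zeros of `U''` with `χ(yᵢ) < γ`, `U'' > 0` on the left and `U'' < 0`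
on the right. -/
def xiMinus (U : ℝ → ℝ) (γ : ℝ) : ℕ :=
  {y : ℝ | 0 < y ∧ iteratedDeriv 2 U y = 0 ∧ chiAbscissa U y < γ ∧
    ∃ δ > (0:ℝ), (∀ z ∈ Ioo (y - δ) y, 0 < iteratedDeriv 2 U z) ∧
      (∀ z ∈ Ioo y (y + δ), iteratedDeriv 2 U z < 0)}.ncard

/-- `Φ_inv(μ) = (μ - 1) ∫₀^∞ F(y)/(μ - U(y))² dy`. -/
def PhiInv (U : ℝ → ℝ) (μ : ℂ) : ℂ :=
  (μ - 1) * ∫ y in Ioi (0:ℝ), (srcF U y : ℂ) / (μ - (U y : ℂ)) ^ 2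

/-- A weight function `ω ≥ 1` with `C_ω < ∞`. -/
structure WeightFn (ω : ℝ → ℝ) : Prop where
  pos : ∀ y, 0 ≤ y → 0 < ω y
  contDiff : ContDiff ℝ 1 ω
  one_le : ∀ y, 0 ≤ y → 1 ≤ ω y
  integrable_inv : IntegrableOn (fun y => 1 / ω y) (Ioi (0:ℝ))
  deriv_ratio_bdd : ∃ M : ℝ, ∀ y, 0 ≤ y → |deriv ω y / ω y| ≤ M
  log_ratio_bdd : ∃ M : ℝ, ∀ y, 0 ≤ y → Real.log (ω y) / (1 + y) ≤ M

/-- Weighted decay conditions: `(1-U_s) ∈ L²(ω)` and `(1+y)U_s^{(j)} ∈ L²(ω)`, `j = 1,2,3`. -/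
def WeightedDecay (U ω : ℝ → ℝ) : Prop :=
  IntegrableOn (fun y => (1 - U y) ^ 2 * ω y) (Ioi (0:ℝ)) ∧
  ∀ j : ℕ, 1 ≤ j → j ≤ 3 →
    IntegrableOn (fun y => ((1 + y) * iteratedDeriv j U y) ^ 2 * ω y) (Ioi (0:ℝ))

/-- Membership in the weighted space `L²(ω)`. -/
def MemL2w (ω : ℝ → ℝ) (f : ℝ → ℂ) : Prop :=
  IntegrableOn (fun y => ‖f y‖ ^ 2 * ω y) (Ioi (0:ℝ))

/-- The `L²(ω)` norm. -/
def wNorm (ω : ℝ → ℝ) (f : ℝ → ℂ) : ℝ :=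
  Real.sqrt (∫ y in Ioi (0:ℝ), ‖f y‖ ^ 2 * ω y)

/-- `φ` solves the homogeneous-boundary-conditions resolvent problem with forcing `f`. -/
def SolvesHom (U : ℝ → ℝ) (μ : ℂ) (k : ℝ) (f φ : ℝ → ℂ) : Prop :=
  ContDiff ℝ 2 φ ∧
  (∀ᵐ y ∂(volume.restrict (Ioi (0:ℝ))),
    (μ - (U y : ℂ)) * deriv φ y + ((deriv U y : ℝ) : ℂ) * φ y
      - Complex.I / (k : ℂ) * iteratedDeriv 3 φ y = f y) ∧
  φ 0 = 0 ∧ deriv φ 0 = 0 ∧ Tendsto (deriv φ) atTop (nhds 0)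

/-- Parameterization on `[0,1]` of the contour `C_η`: the segment from `iη` to `1 + iη`
followed by the upper half-circle of radius `1/2` centered at `1/2 + iη`. -/
def Ceta (η : ℝ) (t : ℝ) : ℂ :=
  if t ≤ 1/2 then ((2*t : ℝ) : ℂ) + (η : ℂ) * Complex.I
  else (1/2 : ℂ) + (η : ℂ) * Complex.I
    + (1/2 : ℂ) * Complex.exp (((Real.pi * (2*t - 1) : ℝ)) * Complex.I)

/-- Winding number `(1/2πi) ∮ dz/(z - p)` of a closed curve parameterized on `[0,1]`. -/
def windingNumber (c : ℝ → ℂ) (p : ℂ) : ℂ :=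
  (((2 * Real.pi : ℝ) : ℂ) * Complex.I)⁻¹ * ∫ t in (0:ℝ)..1, deriv c t / (c t - p)

/-- `q_μ(x) = |μ - x|⁴ - (2μ - 1 - x)(μ̄ - x)²`. -/
def qmu (μ : ℂ) (x : ℝ) : ℂ :=
  ((‖μ - (x:ℂ)‖ ^ 4 : ℝ) : ℂ) - (2*μ - 1 - (x:ℂ)) * ((starRingEnd ℂ) μ - (x:ℂ))^2

/-- `f(α) = -2iΔ_s/α + 1/√α`, principal square root (positive real part for `Re α > 0`). -/
def fIBL (Δ : ℝ) (α : ℂ) : ℂ := (-2 * Complex.I * (Δ:ℂ)) / α + 1 / (α ^ (1/2 : ℂ))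

section PartA

lemma wn_hasDerivAt {U : ℝ → ℝ} (hU : AdmissibleShearFlow U) (y : ℝ) :
    HasDerivAt U (deriv U y) y :=
  ((hU.smooth.differentiable (by simp)) y).hasDerivAt

lemma wn_iter2 (U : ℝ → ℝ) : iteratedDeriv 2 U = deriv (deriv U) := by
  rw [iteratedDeriv_succ, iteratedDeriv_one]

lemma wn_hasDerivAt2 {U : ℝ → ℝ} (hU : AdmissibleShearFlow U) (y : ℝ) :
    HasDerivAt (deriv U) (iteratedDeriv 2 U y) y := by
  rw [wn_iter2]
  have h : Differentiable ℝ (deriv U) := by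
    have := hU.smooth.differentiable_iteratedDeriv 1 (by exact_mod_cast ENat.natCast_lt_top 1)
    rwa [iteratedDeriv_one] at this
  exact (h y).hasDerivAt

lemma wn_cont_d {U : ℝ → ℝ} (hU : AdmissibleShearFlow U) : Continuous (deriv U) :=
  continuous_iff_continuousAt.2 fun y => (wn_hasDerivAt2 hU y).continuousAt

lemma wn_cont {U : ℝ → ℝ} (hU : AdmissibleShearFlow U) : Continuous U :=
  hU.smooth.continuous

lemma wn_diff_d2 {U : ℝ → ℝ} (hU : AdmissibleShearFlow U) :
    Differentiable ℝ (iteratedDeriv 2 U) :=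
  hU.smooth.differentiable_iteratedDeriv 2 (by
    exact WithTop.coe_lt_coe.2 (ENat.natCast_lt_top 2))

lemma wn_cont_d2 {U : ℝ → ℝ} (hU : AdmissibleShearFlow U) : Continuous (iteratedDeriv 2 U) :=
  (wn_diff_d2 hU).continuous

lemma wn_strictMono {U : ℝ → ℝ} (hU : AdmissibleShearFlow U) : StrictMonoOn U (Ici 0) := by
  apply strictMonoOn_of_deriv_pos (convex_Ici 0) (wn_cont hU).continuousOn
  intro x hx
  rw [interior_Ici] at hx
  exact hU.deriv_pos x (le_of_lt hx)

lemma wn_yU_int {U : ℝ → ℝ} (hU : AdmissibleShearFlow U) :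
    IntegrableOn (fun y => y * deriv U y) (Ioi (0:ℝ)) := by
  have hc : Continuous (fun y => 1 - U y) := continuous_const.sub (wn_cont hU)
  apply integrableOn_Ioi_deriv_of_nonneg' (g := fun y => (∫ x in (0:ℝ)..y, (1 - U x)) - y * (1 - U y))
    (l := (∫ x in Ioi (0:ℝ), (1 - U x)) - 0)
  · intro x _
    have h1 := intervalIntegral.integral_hasDerivAt_right (hc.intervalIntegrable 0 x)
      (hc.stronglyMeasurableAtFilter _ _) hc.continuousAt
    have h2 := (hasDerivAt_id x).mul ((wn_hasDerivAt hU x).const_sub 1)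
    refine (h1.sub h2).congr_deriv ?_
    simp
  · intro x hx
    exact mul_nonneg (le_of_lt hx) (hU.deriv_pos x (le_of_lt hx)).le
  · exact (intervalIntegral_tendsto_integral_Ioi 0 hU.integrable_defect tendsto_id).sub
      hU.decay_ratio₂

lemma wn_sub_ne {μ : ℂ} (hμ : 0 < μ.im) (x : ℝ) : μ - (x : ℂ) ≠ 0 := by
  intro h
  have := congrArg Complex.im h
  simp at this
  exact hμ.ne' this

lemma wn_sub_norm {μ : ℂ} (x : ℝ) : μ.im ≤ ‖μ - (x : ℂ)‖ := by
  have := Complex.abs_im_le_norm (μ - (x:ℂ))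
  simp at this
  exact (le_abs_self _).trans this

/-- the basic fraction -/
noncomputable def wnW (U : ℝ → ℝ) (μ : ℂ) (y : ℝ) : ℂ := ((1 - U y : ℝ) : ℂ) / (μ - (U y : ℂ))

lemma wnW_cont {U : ℝ → ℝ} (hU : AdmissibleShearFlow U) {μ : ℂ} (hμ : 0 < μ.im) :
    Continuous (wnW U μ) := by
  unfold wnW
  apply Continuous.div
  · exact Complex.continuous_ofReal.comp (continuous_const.sub (wn_cont hU))
  · exact continuous_const.sub (Complex.continuous_ofReal.comp (wn_cont hU))
  · intro y; exact wn_sub_ne hμ _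

lemma wnW_norm {U : ℝ → ℝ} (hU : AdmissibleShearFlow U) {μ : ℂ} (hμ : 0 < μ.im) {y : ℝ}
    (hy : 0 ≤ y) : ‖wnW U μ y‖ ≤ μ.im⁻¹ * (1 - U y) := by
  unfold wnW
  rw [norm_div, Complex.norm_real, Real.norm_eq_abs,
    abs_of_nonneg (by linarith [(hU.mem_Ico y hy).2]), div_eq_inv_mul]
  apply mul_le_mul_of_nonneg_right _ (by linarith [(hU.mem_Ico y hy).2])
  exact inv_anti₀ hμ (wn_sub_norm _)

lemma wnW_int {U : ℝ → ℝ} (hU : AdmissibleShearFlow U) {μ : ℂ} (hμ : 0 < μ.im) :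
    IntegrableOn (fun y => 2 * wnW U μ y - wnW U μ y ^ 2) (Ioi (0:ℝ)) := by
  have hb : IntegrableOn (fun y => (2 + μ.im⁻¹) * (μ.im⁻¹ * (1 - U y))) (Ioi (0:ℝ)) :=
    (hU.integrable_defect.const_mul _).const_mul _
  refine Integrable.mono' hb ?_ ?_
  · have := wnW_cont hU hμ
    exact ((continuous_const.mul this).sub (this.pow 2)).aestronglyMeasurable
  · refine (ae_restrict_iff' measurableSet_Ioi).2 (Eventually.of_forall fun y hy => ?_)
    have h1 := wnW_norm hU hμ (le_of_lt hy)
    have h0 := hU.mem_Ico y (le_of_lt hy)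
    have h2 : ‖wnW U μ y‖ ≤ μ.im⁻¹ := h1.trans (by
      have : 0 < μ.im⁻¹ := inv_pos.2 hμ
      nlinarith [h0.1])
    have h3 : 2 * wnW U μ y - wnW U μ y ^ 2 = (2 - wnW U μ y) * wnW U μ y := by ring
    rw [h3, norm_mul]
    apply mul_le_mul _ h1 (norm_nonneg _) (by positivity)
    refine (norm_sub_le _ _).trans ?_
    simp only [Complex.norm_ofNat]
    linarith

lemma wn_ofReal {f : ℝ → ℝ} {f' x : ℝ} (h : HasDerivAt f f' x) :
    HasDerivAt (fun y => (f y : ℂ)) (f' : ℂ) x := h.ofReal_comp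

lemma wn_Phi_eq_w {U : ℝ → ℝ} (hU : AdmissibleShearFlow U) {μ : ℂ} (hμ : 0 < μ.im) :
    PhiInv U μ = ∫ y in Ioi (0:ℝ), (2 * wnW U μ y - wnW U μ y ^ 2) := by
  -- integrability of the original integrand
  have hFint : IntegrableOn (fun y => (srcF U y : ℂ) / (μ - (U y : ℂ)) ^ 2) (Ioi (0:ℝ)) := by
    have hF : IntegrableOn (srcF U) (Ioi (0:ℝ)) := hU.integrable_defect.add (wn_yU_int hU)
    have hb : IntegrableOn (fun y => (μ.im⁻¹) ^ 2 * ‖srcF U y‖) (Ioi (0:ℝ)) :=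
      hF.norm.const_mul _
    refine Integrable.mono' hb ?_ ?_
    · have : Continuous (fun y => (srcF U y : ℂ) / (μ - (U y : ℂ)) ^ 2) := by
        apply Continuous.div
        · apply Complex.continuous_ofReal.comp
          exact (continuous_const.sub (wn_cont hU)).add (continuous_id.mul (wn_cont_d hU))
        · exact (continuous_const.sub (Complex.continuous_ofReal.comp (wn_cont hU))).pow 2
        · intro y; exact pow_ne_zero _ (wn_sub_ne hμ _)
      exact this.aestronglyMeasurable
    · refine Eventually.of_forall fun y => ?_
      rw [norm_div, Complex.norm_real, norm_pow, div_eq_inv_mul, ← inv_pow]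
      gcongr
      exact wn_sub_norm _
  have hder : ∀ y ∈ Ici (0:ℝ), HasDerivAt (fun y : ℝ => -((y:ℂ) * wnW U μ y))
      ((μ - 1) * ((srcF U y : ℂ) / (μ - (U y : ℂ)) ^ 2)
        - (2 * wnW U μ y - wnW U μ y ^ 2)) y := by
    intro y _
    have hne := wn_sub_ne hμ (U y)
    have h1 := wn_ofReal ((wn_hasDerivAt hU y).const_sub 1)
    have h2 := (wn_ofReal (wn_hasDerivAt hU y)).const_sub μ
    have h3 := ((wn_ofReal (hasDerivAt_id y)).mul (h1.div h2 hne)).neg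
    refine h3.congr_deriv ?_
    simp only [wnW, srcF, id, Pi.div_apply]
    push_cast
    field_simp
    ring
  have hlim : Tendsto (fun y : ℝ => -((y:ℂ) * wnW U μ y)) atTop (nhds 0) := by
    have h0 : Tendsto (fun y => μ.im⁻¹ * (y * (1 - U y))) atTop (nhds 0) := by
      simpa using hU.decay_ratio₂.const_mul (μ.im⁻¹)
    apply squeeze_zero_norm' _ h0
    filter_upwards [eventually_ge_atTop (0:ℝ)] with y hy
    rw [norm_neg, norm_mul, Complex.norm_real, Real.norm_eq_abs, abs_of_nonneg hy]
    have := wnW_norm hU hμ hy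
    calc y * ‖wnW U μ y‖ ≤ y * (μ.im⁻¹ * (1 - U y)) := by gcongr
      _ = _ := by ring
  have hI := integral_Ioi_of_hasDerivAt_of_tendsto' hder
    ((hFint.const_mul (μ - 1)).sub (wnW_int hU hμ)) hlim
  rw [integral_sub (hFint.const_mul (μ - 1)) (wnW_int hU hμ), integral_const_mul] at hI
  simp at hI
  unfold PhiInv
  exact sub_eq_zero.1 hI

lemma wn_image {U : ℝ → ℝ} (hU : AdmissibleShearFlow U) : U '' Ioi 0 = Ioo 0 1 := by
  ext u
  constructor
  · rintro ⟨y, hy, rfl⟩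
    refine ⟨?_, (hU.mem_Ico y (le_of_lt hy)).2⟩
    have := wn_strictMono hU (self_mem_Ici) (mem_Ici.2 (le_of_lt hy)) hy
    rwa [hU.zero_val] at this
  · rintro ⟨h0, h1⟩
    obtain ⟨Y, hY0, hY⟩ := ((eventually_ge_atTop (0:ℝ)).and
      (hU.tendsto_one.eventually (lt_mem_nhds h1))).exists
    obtain ⟨y, hy, hyu⟩ := intermediate_value_Icc hY0 (wn_cont hU).continuousOn
      (show u ∈ Icc (U 0) (U Y) from ⟨by rw [hU.zero_val]; exact h0.le, hY.le⟩)
    refine ⟨y, ?_, hyu⟩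
    rcases eq_or_lt_of_le hy.1 with h | h
    · subst h; rw [hU.zero_val] at hyu; linarith
    · exact h

lemma wn_inv_U {U : ℝ → ℝ} (hU : AdmissibleShearFlow U) {y : ℝ} (hy : 0 ≤ y) :
    shearInv U (U y) = y := by
  unfold shearInv
  exact (wn_strictMono hU).injOn.leftInvOn_invFunOn hy

lemma wn_exists {U : ℝ → ℝ} (hU : AdmissibleShearFlow U) {u : ℝ} (h : u ∈ Ioo (0:ℝ) 1) :
    ∃ y, 0 < y ∧ U y = u := by
  rw [← wn_image hU] at h
  exact h

lemma wn_g_U {U : ℝ → ℝ} (hU : AdmissibleShearFlow U) {y : ℝ} (hy : 0 ≤ y) :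
    gfun U (U y) = (1 - U y) ^ 2 * iteratedDeriv 2 U y / (deriv U y) ^ 3 := by
  unfold gfun; rw [wn_inv_U hU hy]

lemma wn_g_int {U : ℝ → ℝ} (hU : AdmissibleShearFlow U) :
    IntegrableOn (gfun U) (Ioo (0:ℝ) 1) := by
  rw [← wn_image hU, integrableOn_image_iff_integrableOn_abs_deriv_smul measurableSet_Ioi
    (fun x _ => (wn_hasDerivAt hU x).hasDerivWithinAt)
    ((wn_strictMono hU).injOn.mono Ioi_subset_Ici_self)]
  refine hU.decay_ratio₃.congr_fun (fun y hy => ?_) measurableSet_Ioi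
  have hp := hU.deriv_pos y (le_of_lt hy)
  simp only
  rw [wn_g_U hU (le_of_lt hy), abs_of_pos hp, smul_eq_mul]
  field_simp

lemma wn_Phi_eq_g {U : ℝ → ℝ} (hU : AdmissibleShearFlow U) {μ : ℂ} (hμ : 0 < μ.im) :
    PhiInv U μ = 1 / (μ * ((deriv U 0 : ℝ) : ℂ)) + ∫ u in Ioo (0:ℝ) 1, (gfun U u : ℂ) / ((u : ℂ) - μ) := by
  rw [wn_Phi_eq_w hU hμ]
  set R : ℝ → ℝ := fun y => (1 - U y) ^ 2 * iteratedDeriv 2 U y / (deriv U y) ^ 2 with hR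
  have hcv : ∫ u in Ioo (0:ℝ) 1, (gfun U u : ℂ) / ((u : ℂ) - μ)
      = ∫ y in Ioi (0:ℝ), -((R y : ℂ) / (μ - (U y : ℂ))) := by
    rw [← wn_image hU, integral_image_eq_integral_abs_deriv_smul measurableSet_Ioi
      (fun x _ => (wn_hasDerivAt hU x).hasDerivWithinAt)
      ((wn_strictMono hU).injOn.mono Ioi_subset_Ici_self)]
    refine setIntegral_congr_fun measurableSet_Ioi (fun y hy => ?_)
    have hp := hU.deriv_pos y (le_of_lt hy)
    have hp' : ((deriv U y : ℝ) : ℂ) ≠ 0 := by exact_mod_cast hp.ne'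
    have hne := wn_sub_ne hμ (U y)
    have hne' : (U y : ℂ) - μ ≠ 0 := by rw [← neg_sub]; exact neg_ne_zero.2 hne
    simp only [hR]
    rw [wn_g_U hU (le_of_lt hy), abs_of_pos hp, Complex.real_smul]
    push_cast
    rw [← neg_sub (U y : ℂ) μ]
    field_simp
  have hRint : IntegrableOn (fun y => (R y : ℂ) / (μ - (U y : ℂ))) (Ioi (0:ℝ)) := by
    have hb : IntegrableOn (fun y => (μ.im⁻¹) * ‖R y‖) (Ioi (0:ℝ)) :=
      hU.decay_ratio₃.norm.const_mul _
    refine Integrable.mono' hb ?_ ?_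
    · simp only [div_eq_mul_inv]
      refine AEStronglyMeasurable.mul (hU.decay_ratio₃.ofReal (𝕜 := ℂ)).aestronglyMeasurable ?_
      have : Continuous fun y => (μ - (U y : ℂ))⁻¹ :=
        (continuous_const.sub (Complex.continuous_ofReal.comp (wn_cont hU))).inv₀
          (fun y => wn_sub_ne hμ _)
      exact this.aestronglyMeasurable
    · refine Eventually.of_forall fun y => ?_
      rw [norm_div, Complex.norm_real, div_eq_inv_mul]
      gcongr
      exact wn_sub_norm _
  have hder : ∀ y ∈ Ici (0:ℝ), HasDerivAt
      (fun y : ℝ => -(((1 - U y : ℝ) : ℂ) ^ 2 / (((deriv U y : ℝ) : ℂ) * (μ - (U y : ℂ)))))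
      ((2 * wnW U μ y - wnW U μ y ^ 2) + (R y : ℂ) / (μ - (U y : ℂ))) y := by
    intro y hy
    have hp' : ((deriv U y : ℝ) : ℂ) ≠ 0 := by exact_mod_cast (hU.deriv_pos y hy).ne'
    have hne := wn_sub_ne hμ (U y)
    have h1 := (wn_ofReal ((wn_hasDerivAt hU y).const_sub 1)).pow 2
    have h2 := (wn_ofReal (wn_hasDerivAt hU y)).const_sub μ
    have h3 := (h1.div ((wn_ofReal (wn_hasDerivAt2 hU y)).mul h2) (mul_ne_zero hp' hne)).neg
    refine h3.congr_deriv ?_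
    simp only [wnW, hR, Pi.pow_apply, Pi.mul_apply]
    push_cast
    field_simp
    ring
  have hlim : Tendsto (fun y : ℝ => -(((1 - U y : ℝ) : ℂ) ^ 2 / (((deriv U y : ℝ) : ℂ) * (μ - (U y : ℂ)))))
      atTop (nhds 0) := by
    have h0 : Tendsto (fun y => μ.im⁻¹ * ((1 - U y) ^ 2 / deriv U y)) atTop (nhds 0) := by
      simpa using hU.decay_ratio₁.const_mul (μ.im⁻¹)
    apply squeeze_zero_norm' _ h0
    filter_upwards [eventually_ge_atTop (0:ℝ)] with y hy
    have hp := hU.deriv_pos y hy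
    rw [norm_neg, norm_div, norm_mul, norm_pow, Complex.norm_real, Complex.norm_real, Real.norm_eq_abs,
      Real.norm_eq_abs, sq_abs, abs_of_pos hp, ← div_div, div_eq_inv_mul _ ‖_‖]
    gcongr
    exact wn_sub_norm _
  have hI := integral_Ioi_of_hasDerivAt_of_tendsto' hder ((wnW_int hU hμ).add hRint) hlim
  rw [integral_add (wnW_int hU hμ) hRint] at hI
  rw [hcv, integral_neg]
  rw [hU.zero_val] at hI
  simp at hI
  rw [eq_sub_of_add_eq hI]
  rw [one_div, mul_inv]
  ring

lemma wn_im_neg {U : ℝ → ℝ} (hU : AdmissibleShearFlow U) {μ : ℂ} (hμ : 0 < μ.im)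
    (h1 : μ.re ≤ 1) (hout : 0 < μ.re ^ 2 - μ.re + μ.im ^ 2) : (PhiInv U μ).im < 0 := by
  rw [wn_Phi_eq_w hU hμ]
  have e : (∫ y in Ioi (0:ℝ), (2 * wnW U μ y - wnW U μ y ^ 2)).im
      = ∫ y in Ioi (0:ℝ), (2 * wnW U μ y - wnW U μ y ^ 2).im := by
    simpa using (integral_im (𝕜 := ℂ) (wnW_int hU hμ)).symm
  rw [e]
  have hneg : ∀ y ∈ Ioi (0:ℝ), 0 < -(2 * wnW U μ y - wnW U μ y ^ 2).im := by
    intro y hy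
    have h0 := hU.mem_Ico y (le_of_lt hy)
    have hne := wn_sub_ne hμ (U y)
    have hw : 2 * wnW U μ y - wnW U μ y ^ 2 = 1 - ((μ - 1) / (μ - (U y:ℂ))) ^ 2 := by
      unfold wnW; push_cast; field_simp; ring
    have hN : 0 < Complex.normSq (μ - (U y:ℂ)) := Complex.normSq_pos.2 hne
    have hre : ((μ - 1) / (μ - (U y:ℂ))).re
        = (μ.re ^ 2 - μ.re + μ.im ^ 2 + U y * (1 - μ.re)) / Complex.normSq (μ - (U y:ℂ)) := by
      rw [Complex.div_re]; simp; field_simp; ring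
    have him : ((μ - 1) / (μ - (U y:ℂ))).im
        = (μ.im * (1 - U y)) / Complex.normSq (μ - (U y:ℂ)) := by
      rw [Complex.div_im]; simp; field_simp; ring
    have hre' : 0 < ((μ - 1) / (μ - (U y:ℂ))).re := by
      rw [hre]
      exact div_pos (add_pos_of_pos_of_nonneg hout (mul_nonneg h0.1 (by linarith))) hN
    have him' : 0 < ((μ - 1) / (μ - (U y:ℂ))).im := by
      rw [him]
      exact div_pos (mul_pos hμ (by linarith [h0.2])) hN
    rw [hw, pow_two]
    simp only [Complex.sub_im, Complex.one_im, Complex.mul_im]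
    have := mul_pos hre' him'
    nlinarith
  have hIntg : IntegrableOn (fun y => -(2 * wnW U μ y - wnW U μ y ^ 2).im) (Ioi (0:ℝ)) :=
    (wnW_int hU hμ).im.neg
  have hpos : 0 < ∫ y in Ioi (0:ℝ), -(2 * wnW U μ y - wnW U μ y ^ 2).im := by
    rw [setIntegral_pos_iff_support_of_nonneg_ae]
    · have : Function.support (fun y => -(2 * wnW U μ y - wnW U μ y ^ 2).im) ∩ Ioi (0:ℝ) = Ioi 0 :=
        inter_eq_right.2 fun y hy => (hneg y hy).ne'
      rw [this]; simp
    · exact (ae_restrict_iff' measurableSet_Ioi).2 (Eventually.of_forall fun y hy => (hneg y hy).le)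
    · exact hIntg
  rw [integral_neg] at hpos
  linarith

lemma wn_sub_ne' {μ : ℂ} (hμ : 0 < μ.im) (x : ℝ) : (x : ℂ) - μ ≠ 0 := by
  rw [← neg_sub]; exact neg_ne_zero.2 (wn_sub_ne hμ x)

lemma wn_sub_norm' {μ : ℂ} (x : ℝ) : μ.im ≤ ‖(x : ℂ) - μ‖ := by
  rw [norm_sub_rev]; exact wn_sub_norm x

lemma wn_kernel_meas {μ : ℂ} (hμ : 0 < μ.im) (n : ℕ) :
    Continuous (fun u : ℝ => (((u : ℂ) - μ) ^ n)⁻¹) :=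
  ((Complex.continuous_ofReal.sub continuous_const).pow n).inv₀
    (fun u => pow_ne_zero _ (wn_sub_ne' hμ u))

lemma wn_ker_int {g : ℝ → ℝ} {S : Set ℝ} (hg : IntegrableOn g S) {μ : ℂ} (hμ : 0 < μ.im) :
    IntegrableOn (fun u => (g u : ℂ) / ((u : ℂ) - μ)) S := by
  have hb : IntegrableOn (fun y => (μ.im⁻¹) * ‖g y‖) S := hg.norm.const_mul _
  refine Integrable.mono' hb ?_ ?_
  · simp only [div_eq_mul_inv]
    refine AEStronglyMeasurable.mul (hg.ofReal (𝕜 := ℂ)).aestronglyMeasurable ?_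
    have := wn_kernel_meas hμ 1
    simp only [pow_one] at this
    exact this.aestronglyMeasurable
  · refine Eventually.of_forall fun y => ?_
    rw [norm_div, Complex.norm_real, div_eq_inv_mul]
    gcongr
    exact wn_sub_norm' _

lemma wn_cauchy_diff {g : ℝ → ℝ} {S : Set ℝ} (hg : IntegrableOn g S) {μ : ℂ} (hμ : 0 < μ.im) :
    DifferentiableAt ℂ (fun μ => ∫ u in S, (g u : ℂ) / ((u : ℂ) - μ)) μ := by
  have hs : {z : ℂ | μ.im / 2 < z.im} ∈ nhds μ :=
    (isOpen_lt continuous_const Complex.continuous_im).mem_nhds (by simp; linarith)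
  have hs0 : ∀ z ∈ {z : ℂ | μ.im / 2 < z.im}, 0 < z.im := fun z hz => by
    have : μ.im / 2 < z.im := hz
    linarith
  refine (hasDerivAt_integral_of_dominated_loc_of_deriv_le (μ := volume.restrict S)
    (F := fun μ u => (g u : ℂ) / ((u : ℂ) - μ))
    (F' := fun μ u => (g u : ℂ) * (((u : ℂ) - μ) ^ 2)⁻¹)
    (bound := fun u => ‖g u‖ * (((μ.im / 2) ^ 2)⁻¹)) hs ?_ ?_ ?_ ?_ ?_ ?_).2.differentiableAt
  · filter_upwards [hs] with z hz
    exact (wn_ker_int hg (hs0 z hz)).aestronglyMeasurable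
  · exact wn_ker_int hg hμ
  · exact AEStronglyMeasurable.mul (hg.ofReal (𝕜 := ℂ)).aestronglyMeasurable
      (wn_kernel_meas hμ 2).aestronglyMeasurable
  · refine Eventually.of_forall fun u z hz => ?_
    have hz' : μ.im / 2 < z.im := hz
    rw [norm_mul, Complex.norm_real, norm_inv, norm_pow]
    gcongr
    exact hz'.le.trans (wn_sub_norm' _)
  · exact hg.norm.mul_const _
  · refine Eventually.of_forall fun u z hz => ?_
    have hne := wn_sub_ne' (hs0 z hz) u
    have h := (((hasDerivAt_id z).const_sub (u:ℂ)).inv hne).const_mul (g u : ℂ)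
    simp only [div_eq_mul_inv]
    refine h.congr_deriv ?_
    simp [id]

lemma wn_Phi_diff {U : ℝ → ℝ} (hU : AdmissibleShearFlow U) {μ : ℂ} (hμ : 0 < μ.im) :
    DifferentiableAt ℂ (PhiInv U) μ := by
  have hs : {z : ℂ | 0 < z.im} ∈ nhds μ :=
    (isOpen_lt continuous_const Complex.continuous_im).mem_nhds hμ
  have hd0 : ((deriv U 0 : ℝ) : ℂ) ≠ 0 := by exact_mod_cast (hU.deriv_pos 0 le_rfl).ne'
  have hμ0 : μ ≠ 0 := by rintro rfl; simp at hμ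
  have h1 : DifferentiableAt ℂ (fun μ : ℂ => 1 / (μ * ((deriv U 0 : ℝ) : ℂ))) μ :=
    (differentiableAt_const _).div (differentiableAt_id.mul_const _) (mul_ne_zero hμ0 hd0)
  refine (h1.add (wn_cauchy_diff (wn_g_int hU) hμ)).congr_of_eventuallyEq ?_
  filter_upwards [hs] with z hz
  exact wn_Phi_eq_g hU hz

end PartA

section PartB

lemma wn_surj_Icc {U : ℝ → ℝ} (hU : AdmissibleShearFlow U) {b : ℝ} (hb0 : 0 < b) (hb : b < 1) :
    ∃ Y, 0 < Y ∧ ∀ u ∈ Icc 0 b, ∃ y ∈ Icc 0 Y, U y = u := by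
  obtain ⟨Y, hY, hYb⟩ := wn_exists hU ⟨hb0, hb⟩
  refine ⟨Y, hY, fun u hu => ?_⟩
  have := intermediate_value_Icc hY.le (wn_cont hU).continuousOn
    (show u ∈ Icc (U 0) (U Y) by rw [hU.zero_val, hYb]; exact hu)
  exact this

lemma wn_lip {U : ℝ → ℝ} (hU : AdmissibleShearFlow U) {b : ℝ} (hb0 : 0 < b) (hb : b < 1) :
    ∃ L : ℝ, 0 ≤ L ∧ ∀ u ∈ Icc 0 b, ∀ v ∈ Icc 0 b, |gfun U u - gfun U v| ≤ L * |u - v| := by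
  obtain ⟨Y, hY, hsurj⟩ := wn_surj_Icc hU hb0 hb
  set h : ℝ → ℝ := fun y => (1 - U y) ^ 2 * iteratedDeriv 2 U y / (deriv U y) ^ 3 with hh
  have hcd : ContDiffOn ℝ 1 h (Icc 0 Y) := by
    have c1 : ContDiff ℝ 1 U := hU.smooth.of_le (by exact_mod_cast le_top)
    have c2 : ContDiff ℝ 1 (deriv U) :=
      (hU.smooth.iterate_deriv 1).of_le (by exact_mod_cast le_top)
    have c3 : ContDiff ℝ 1 (iteratedDeriv 2 U) := by
      rw [iteratedDeriv_eq_iterate]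
      exact (hU.smooth.iterate_deriv 2).of_le (by exact_mod_cast le_top)
    refine ContDiffOn.div ?_ (c2.pow 3).contDiffOn ?_
    · exact (((contDiff_const.sub c1).pow 2).mul c3).contDiffOn
    · intro y hy
      exact pow_ne_zero _ (hU.deriv_pos y hy.1).ne'
  obtain ⟨K, hK⟩ := (hcd.locallyLipschitzOn (convex_Icc 0 Y)).exists_lipschitzOnWith_of_compact
    isCompact_Icc
  obtain ⟨y0, hy0, hmin⟩ := isCompact_Icc.exists_isMinOn (nonempty_Icc.2 hY.le)
    (wn_cont_d hU).continuousOn (f := deriv U)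
  set m := deriv U y0 with hm
  have hmpos : 0 < m := hU.deriv_pos y0 hy0.1
  have hlow1 : ∀ x ∈ Icc 0 Y, ∀ y ∈ Icc 0 Y, x ≤ y → m * (y - x) ≤ U y - U x := by
    apply (convex_Icc 0 Y).mul_sub_le_image_sub_of_le_deriv (wn_cont hU).continuousOn
    · exact fun y _ => (wn_hasDerivAt hU y).differentiableAt.differentiableWithinAt
    · intro x hx
      exact hmin (interior_subset hx)
  have hlow : ∀ x ∈ Icc 0 Y, ∀ y ∈ Icc 0 Y, m * |x - y| ≤ |U x - U y| := by
    intro x hx y hy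
    rcases le_total x y with hxy | hxy
    · rw [abs_sub_comm, abs_of_nonneg (by linarith : 0 ≤ y - x), abs_sub_comm (U x)]
      exact (hlow1 x hx y hy hxy).trans (le_abs_self _)
    · rw [abs_of_nonneg (by linarith : 0 ≤ x - y)]
      exact (hlow1 y hy x hx hxy).trans (le_abs_self _)
  refine ⟨K / m, by positivity, ?_⟩
  intro u hu v hv
  obtain ⟨x, hx, rfl⟩ := hsurj u hu
  obtain ⟨y, hy, rfl⟩ := hsurj v hv
  rw [wn_g_U hU hx.1, wn_g_U hU hy.1]
  have h1 := hK.dist_le_mul x hx y hy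
  rw [Real.dist_eq, Real.dist_eq] at h1
  refine h1.trans ?_
  have h2 := hlow x hx y hy
  rw [div_mul_eq_mul_div, le_div_iff₀ hmpos, mul_assoc]
  gcongr
  linarith

/-- modified Cauchy kernel -/
noncomputable def wnK (U : ℝ → ℝ) (p q : ℝ) (μ : ℂ) (u : ℝ) : ℂ :=
  ((gfun U u - (Ioo p q).indicator (fun _ => gfun U μ.re) u : ℝ) : ℂ) / ((u : ℂ) - μ)

lemma wn_re_le (μ : ℂ) (u : ℝ) : |u - μ.re| ≤ ‖(u : ℂ) - μ‖ := by
  have := Complex.abs_re_le_norm ((u:ℂ) - μ)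
  simpa using this

lemma wnK_bound {U : ℝ → ℝ} {p q b L d : ℝ} (hp : 0 ≤ p) (hqb : q ≤ b)
    (hL0 : 0 ≤ L)
    (hL : ∀ u ∈ Icc 0 b, ∀ v ∈ Icc 0 b, |gfun U u - gfun U v| ≤ L * |u - v|) (hd : 0 < d)
    {μ : ℂ} (hre : μ.re ∈ Icc p q)
    (hdist : ∀ u ∈ Ioo (0:ℝ) 1, u ∉ Ioo p q → d ≤ |u - μ.re|) {u : ℝ} (hu : u ∈ Ioo (0:ℝ) 1) :
    ‖wnK U p q μ u‖ ≤ L + |gfun U u| / d := by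
  unfold wnK
  rw [norm_div, Complex.norm_real, Real.norm_eq_abs]
  have h1 := wn_re_le μ u
  by_cases h : u ∈ Ioo p q
  · rw [indicator_of_mem h]
    have h2 := hL u ⟨hp.trans h.1.le, h.2.le.trans hqb⟩ μ.re ⟨hp.trans hre.1, hre.2.trans hqb⟩
    have h3 : |gfun U u - gfun U μ.re| / ‖(u:ℂ) - μ‖ ≤ L := by
      apply div_le_of_le_mul₀ (norm_nonneg _) hL0
      exact h2.trans (by gcongr)
    have : 0 ≤ |gfun U u| / d := by positivity
    linarith
  · rw [indicator_of_notMem h, sub_zero]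
    have h2 := hdist u hu h
    have : |gfun U u| / ‖(u:ℂ) - μ‖ ≤ |gfun U u| / d := by
      gcongr
      linarith
    linarith

lemma wn_log_int {μ : ℂ} (hμ : 0 < μ.im) (p q : ℝ) :
    ∫ u in p..q, ((u : ℂ) - μ)⁻¹ = Complex.log ((q:ℂ) - μ) - Complex.log ((p:ℂ) - μ) := by
  have := wn_kernel_meas hμ 1
  simp only [pow_one] at this
  refine intervalIntegral.integral_eq_sub_of_hasDerivAt (f := fun u : ℝ => Complex.log ((u:ℂ) - μ))
    (fun u _ => ?_) (this.intervalIntegrable _ _)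
  have h1 := (wn_ofReal (hasDerivAt_id u)).sub_const μ
  have h2 := h1.clog_real (by
    rw [Complex.mem_slitPlane_iff]; right; simp; exact hμ.ne')
  refine h2.congr_deriv ?_
  simp [id]

lemma wnK_meas {U : ℝ → ℝ} (hU : AdmissibleShearFlow U) (p q : ℝ) {μ : ℂ} (hμ : 0 < μ.im) :
    IntegrableOn (wnK U p q μ) (Ioo 0 1) := by
  unfold wnK
  apply wn_ker_int _ hμ
  refine Integrable.sub (wn_g_int hU) ?_
  refine Integrable.indicator ?_ measurableSet_Ioo
  exact integrableOn_const (by simp)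

lemma wnK_decomp {U : ℝ → ℝ} (hU : AdmissibleShearFlow U) {p q : ℝ} (hp : 0 ≤ p) (hpq : p ≤ q)
    (hq : q ≤ 1) {μ : ℂ} (hμ : 0 < μ.im) :
    ∫ u in Ioo (0:ℝ) 1, (gfun U u : ℂ) / ((u : ℂ) - μ) =
      (∫ u in Ioo (0:ℝ) 1, wnK U p q μ u)
      + (gfun U μ.re : ℂ) * (Complex.log ((q:ℂ) - μ) - Complex.log ((p:ℂ) - μ)) := by
  have h1 : ∀ u : ℝ, (gfun U u : ℂ) / ((u : ℂ) - μ) = wnK U p q μ u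
      + (Ioo p q).indicator (fun u : ℝ => (gfun U μ.re : ℂ) * ((u : ℂ) - μ)⁻¹) u := by
    intro u
    unfold wnK
    by_cases h : u ∈ Ioo p q
    · rw [indicator_of_mem h, indicator_of_mem h]; push_cast; ring
    · rw [indicator_of_notMem h, indicator_of_notMem h]; simp
  simp_rw [h1]
  have hc := wn_kernel_meas hμ 1
  simp only [pow_one] at hc
  rw [integral_add (wnK_meas hU p q hμ), setIntegral_indicator measurableSet_Ioo,
    inter_eq_right.2 (Ioo_subset_Ioo hp hq), ← wn_log_int hμ, integral_const_mul,
    intervalIntegral.integral_of_le hpq, integral_Ioc_eq_integral_Ioo]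
  · refine Integrable.indicator ?_ measurableSet_Ioo
    exact (((continuous_const.mul hc).integrableOn_Icc (a := 0) (b := 1)).mono_set
      Ioo_subset_Icc_self)

lemma wn_upper_tendsto (a : ℝ) :
    Tendsto (fun z : ℂ => z.re) (nhdsWithin (a:ℂ) {z | 0 < z.im}) (nhds a) := by
  have : Tendsto (fun z : ℂ => z.re) (nhds (a:ℂ)) (nhds a) := by
    simpa using Complex.continuous_re.tendsto (a:ℂ)
  exact this.mono_left nhdsWithin_le_nhds

lemma wn_interior {U : ℝ → ℝ} (hU : AdmissibleShearFlow U) {a : ℝ} (ha : a ∈ Ioo (0:ℝ) 1) :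
    ∃ ℓ : ℝ, Tendsto (PhiInv U) (nhdsWithin (a:ℂ) {z | 0 < z.im})
        (nhds ((ℓ : ℂ) + ((Real.pi * gfun U a : ℝ) : ℂ) * Complex.I)) ∧
      (gfun U a = 0 → ℓ = 1 / (a * deriv U 0) + pvIntegral (gfun U) a) := by
  obtain ⟨ha0, ha1⟩ := ha
  obtain ⟨p, hp0, hpa⟩ := exists_between ha0
  obtain ⟨q, haq, hq1⟩ := exists_between ha1
  obtain ⟨L, hL0, hL⟩ := wn_lip hU (ha0.trans haq) hq1
  set d : ℝ := min (a - p) (q - a) / 2 with hd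
  have hdpos : 0 < d := by
    have : 0 < min (a - p) (q - a) := lt_min (by linarith) (by linarith)
    positivity
  have hd1 : 2 * d ≤ a - p := by rw [hd]; linarith [min_le_left (a - p) (q - a)]
  have hd2 : 2 * d ≤ q - a := by rw [hd]; linarith [min_le_right (a - p) (q - a)]
  have hgood : ∀ x : ℝ, |x - a| < d → x ∈ Icc p q ∧
      ∀ u ∈ Ioo (0:ℝ) 1, u ∉ Ioo p q → d ≤ |u - x| := by
    intro x hx
    rw [abs_lt] at hx
    refine ⟨⟨by linarith, by linarith⟩, fun u _ hu => ?_⟩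
    rcases le_or_gt u p with h | h
    · rw [abs_sub_comm]; exact le_trans (by linarith) (le_abs_self _)
    · have : q ≤ u := by
        by_contra h'
        exact hu ⟨h, not_le.1 h'⟩
      exact le_trans (by linarith) (le_abs_self _)
  have hbound_int : IntegrableOn (fun u => L + |gfun U u| / d) (Ioo (0:ℝ) 1) :=
    (integrableOn_const (by simp)).add ((wn_g_int hU).abs.div_const d)
  have hre := wn_upper_tendsto a
  have hev : ∀ᶠ z : ℂ in nhdsWithin (a:ℂ) {z | 0 < z.im}, |z.re - a| < d := by
    have := hre.eventually (Metric.ball_mem_nhds a hdpos)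
    filter_upwards [this] with z hz
    have hz' : dist z.re a < d := hz
    rwa [Real.dist_eq] at hz'
  have hup : ∀ᶠ z : ℂ in nhdsWithin (a:ℂ) {z | 0 < z.im}, 0 < z.im := self_mem_nhdsWithin
  have hgc : Tendsto (fun z : ℂ => gfun U z.re) (nhdsWithin (a:ℂ) {z | 0 < z.im})
      (nhds (gfun U a)) := by
    rw [tendsto_iff_norm_sub_tendsto_zero]
    have h0 : Tendsto (fun z : ℂ => L * |z.re - a|) (nhdsWithin (a:ℂ) {z | 0 < z.im}) (nhds 0) := by
      have := ((hre.sub_const a).abs).const_mul L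
      simpa using this
    refine squeeze_zero' (Eventually.of_forall fun _ => norm_nonneg _) ?_ h0
    filter_upwards [hev] with z hz
    have := (hgood _ hz).1
    exact hL _ ⟨hp0.le.trans this.1, this.2⟩ _ ⟨ha0.le, haq.le⟩
  -- limit of the integral part
  have hnhds : Tendsto (fun z : ℂ => z) (nhdsWithin (a:ℂ) {z | 0 < z.im}) (nhds (a:ℂ)) :=
    tendsto_id.mono_left nhdsWithin_le_nhds
  have hlimK : Tendsto (fun z => ∫ u in Ioo (0:ℝ) 1, wnK U p q z u)
      (nhdsWithin (a:ℂ) {z | 0 < z.im}) (nhds (∫ u in Ioo (0:ℝ) 1,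
        (((gfun U u - (Ioo p q).indicator (fun _ => gfun U a) u) / (u - a) : ℝ) : ℂ))) := by
    apply tendsto_integral_filter_of_dominated_convergence (fun u => L + |gfun U u| / d)
    · filter_upwards [hup] with z hz
      exact (wnK_meas hU p q hz).aestronglyMeasurable
    · filter_upwards [hup, hev] with z hz hz2
      refine (ae_restrict_iff' measurableSet_Ioo).2 (Eventually.of_forall fun u hu => ?_)
      obtain ⟨h1, h2⟩ := hgood _ hz2
      exact wnK_bound hp0.le le_rfl hL0 hL hdpos h1 h2 hu
    · exact hbound_int
    · have hne : ∀ᵐ u ∂(volume.restrict (Ioo (0:ℝ) 1)), u ≠ a :=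
        ae_restrict_of_ae (Measure.ae_ne volume a)
      filter_upwards [hne] with u hu
      unfold wnK
      have hne' : (u:ℂ) - (a:ℂ) ≠ 0 := by
        rw [sub_ne_zero]; exact_mod_cast hu
      rw [Complex.ofReal_div, Complex.ofReal_sub u a]
      refine Tendsto.div ?_ (tendsto_const_nhds.sub hnhds) hne'
      refine (Complex.continuous_ofReal.tendsto _).comp ?_
      refine tendsto_const_nhds.sub ?_
      by_cases h : u ∈ Ioo p q
      · simp only [indicator_of_mem h]; exact hgc
      · simp only [indicator_of_notMem h]; exact tendsto_const_nhds
  rw [integral_complex_ofReal] at hlimK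
  -- logs
  have hlog1 : Tendsto (fun z : ℂ => Complex.log ((q:ℂ) - z)) (nhdsWithin (a:ℂ) {z | 0 < z.im})
      (nhds ((Real.log (q - a) : ℝ) : ℂ)) := by
    have : (Real.log (q - a) : ℂ) = Complex.log ((q:ℂ) - (a:ℂ)) := by
      rw [Complex.ofReal_log (by linarith)]; simp
    rw [this]
    refine Tendsto.clog (tendsto_const_nhds.sub hnhds) ?_
    rw [Complex.mem_slitPlane_iff]; left; simp; exact haq
  have hlog2 : Tendsto (fun z : ℂ => Complex.log ((p:ℂ) - z)) (nhdsWithin (a:ℂ) {z | 0 < z.im})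
      (nhds (((Real.log (a - p) : ℝ) : ℂ) - Real.pi * Complex.I)) := by
    have h1 := Complex.tendsto_log_nhdsWithin_im_neg_of_re_neg_of_im_zero
      (z := (p:ℂ) - (a:ℂ)) (by simp; exact hpa) (by simp)
    have h2 : ‖(p:ℂ) - (a:ℂ)‖ = a - p := by
      rw [← Complex.ofReal_sub, Complex.norm_real, Real.norm_eq_abs, abs_sub_comm,
        abs_of_nonneg (by linarith)]
    rw [h2] at h1
    refine h1.comp (tendsto_nhdsWithin_iff.2 ⟨tendsto_const_nhds.sub hnhds, ?_⟩)
    filter_upwards [hup] with z hz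
    simpa using hz
  have hd0 : ((deriv U 0 : ℝ) : ℂ) ≠ 0 := by exact_mod_cast (hU.deriv_pos 0 le_rfl).ne'
  have ha0' : (a : ℂ) ≠ 0 := by exact_mod_cast ha0.ne'
  have hfirst : Tendsto (fun z : ℂ => 1 / (z * ((deriv U 0 : ℝ) : ℂ)))
      (nhdsWithin (a:ℂ) {z | 0 < z.im}) (nhds (1 / ((a:ℂ) * ((deriv U 0 : ℝ) : ℂ)))) :=
    tendsto_const_nhds.div (hnhds.mul_const _) (mul_ne_zero ha0' hd0)
  have htot := hfirst.add (hlimK.add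
    (((Complex.continuous_ofReal.tendsto _).comp hgc).mul (hlog1.sub hlog2)))
  refine ⟨1 / (a * deriv U 0) + ((∫ u in Ioo (0:ℝ) 1,
    ((gfun U u - (Ioo p q).indicator (fun _ => gfun U a) u) / (u - a)))
    + gfun U a * (Real.log (q - a) - Real.log (a - p))), ?_, ?_⟩
  · refine (htot.congr' ?_).trans_eq ?_
    · filter_upwards [hup] with z hz
      rw [wn_Phi_eq_g hU hz, wnK_decomp hU hp0.le (hpa.trans haq).le hq1.le hz]
      rfl
    · congr 1
      push_cast
      ring
  · intro hga
    rw [hga]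
    have hz : ∀ u, (Ioo p q).indicator (fun _ => (0:ℝ)) u = 0 := fun u => by simp
    simp only [hz, sub_zero, zero_mul, add_zero]
    congr 1
    unfold pvIntegral
    refine (Tendsto.limUnder_eq ?_).symm
    have hb : ∀ u ∈ Ioo (0:ℝ) 1, ‖gfun U u / (u - a)‖ ≤ L + |gfun U u| / d := by
      intro u hu
      have h1 := wnK_bound (U := U) (μ := (a:ℂ)) hp0.le le_rfl hL0 hL hdpos
        (by simpa using (hgood a (by simpa using hdpos)).1)
        (by simpa using (hgood a (by simpa using hdpos)).2) hu
      unfold wnK at h1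
      simp only [Complex.ofReal_re, hga, hz, sub_zero] at h1
      rw [← Complex.ofReal_sub, ← Complex.ofReal_div, Complex.norm_real] at h1
      exact h1
    have hm : AEStronglyMeasurable (fun u => gfun U u / (u - a)) (volume.restrict (Ioo (0:ℝ) 1)) := by
      simp only [div_eq_mul_inv]
      refine (wn_g_int hU).aestronglyMeasurable.mul ?_
      exact (measurable_id.sub_const a).inv.aestronglyMeasurable
    have hset : ∀ ε : ℝ, ∫ u in Ioo (0:ℝ) 1 \ Ioo (a - ε) (a + ε), gfun U u / (u - a)
        = ∫ u in Ioo (0:ℝ) 1, (Ioo (a - ε) (a + ε))ᶜ.indicator (fun u => gfun U u / (u - a)) u := by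
      intro ε
      rw [setIntegral_indicator measurableSet_Ioo.compl, sdiff_eq]
    simp_rw [hset]
    apply tendsto_integral_filter_of_dominated_convergence (fun u => L + |gfun U u| / d)
    · exact Eventually.of_forall fun ε => hm.indicator measurableSet_Ioo.compl
    · refine Eventually.of_forall fun ε => ?_
      refine (ae_restrict_iff' measurableSet_Ioo).2 (Eventually.of_forall fun u hu => ?_)
      exact (norm_indicator_le_norm_self _ _).trans (hb u hu)
    · exact hbound_int
    · have hne : ∀ᵐ u ∂(volume.restrict (Ioo (0:ℝ) 1)), u ≠ a :=
        ae_restrict_of_ae (Measure.ae_ne volume a)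
      filter_upwards [hne] with u hu
      refine tendsto_const_nhds.congr' ?_
      have hpos : 0 < |u - a| := abs_pos.2 (sub_ne_zero.2 hu)
      have : ∀ᶠ ε : ℝ in nhdsWithin 0 (Ioi 0), ε < |u - a| :=
        nhdsWithin_le_nhds (Iio_mem_nhds hpos)
      filter_upwards [this] with ε hε
      rw [indicator_of_mem]
      intro hmem
      have : |u - a| < ε := by rw [abs_lt]; constructor <;> linarith [hmem.1, hmem.2]
      linarith

end PartB

section PartB2

lemma wn_norm_log_le (z : ℂ) : ‖Complex.log z‖ ≤ |Real.log ‖z‖| + Real.pi := by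
  have h := Complex.norm_le_abs_re_add_abs_im (Complex.log z)
  rw [Complex.log_re, Complex.log_im] at h
  linarith [Complex.abs_arg_le_pi z]

lemma wn_near_zero {U : ℝ → ℝ} (hU : AdmissibleShearFlow U) (γ : ℝ) :
    ∃ δ > (0:ℝ), ∀ μ : ℂ, 0 < μ.im → 0 ≤ μ.re → ‖μ‖ < δ →
      PhiInv U μ - (γ:ℂ) ∈ Complex.slitPlane := by
  obtain ⟨L, hL0, hL⟩ := wn_lip hU (b := 1/2) (by norm_num) (by norm_num)
  set M : ℝ := ∫ u in Ioo (0:ℝ) 1, (L + |gfun U u| / (1/4)) with hM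
  have hbound_int : IntegrableOn (fun u => L + |gfun U u| / (1/4)) (Ioo (0:ℝ) 1) :=
    (integrableOn_const (by simp)).add ((wn_g_int hU).abs.div_const _)
  set G : ℝ := |gfun U 0| + L with hG
  have hG0 : 0 ≤ G := by positivity
  set D : ℝ := deriv U 0 with hD
  have hDpos : 0 < D := hU.deriv_pos 0 le_rfl
  set h : ℝ → ℝ := fun r => D * (r * M + G * (r * (Real.log 4 + Real.pi) + (|r * Real.log r| + r * Real.pi))
    + r * |γ|) with hh
  have hc : Continuous h := by
    have := Real.continuous_mul_log.abs
    fun_prop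
  have h0 : h 0 = 0 := by simp [hh]
  have hev : ∀ᶠ r in nhds (0:ℝ), h r < 1 := by
    have := hc.tendsto 0
    rw [h0] at this
    exact this.eventually (gt_mem_nhds one_pos)
  obtain ⟨δ, hδ, hδh⟩ := Metric.eventually_nhds_iff.1 hev
  refine ⟨min δ (1/4), by positivity, fun μ him hre hμ => ?_⟩
  have hμδ : ‖μ‖ < δ := hμ.trans_le (min_le_left _ _)
  have hμ4 : ‖μ‖ < 1/4 := hμ.trans_le (min_le_right _ _)
  have hh1 : h ‖μ‖ < 1 := hδh (by simpa using hμδ)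
  have hre4 : μ.re < 1/4 := ((le_abs_self _).trans (Complex.abs_re_le_norm μ)).trans_lt hμ4
  -- the Cauchy integral
  have hdec := wnK_decomp hU (p := 0) (q := 1/2) le_rfl (by norm_num) (by norm_num) him
  set C : ℂ := ∫ u in Ioo (0:ℝ) 1, (gfun U u : ℂ) / ((u : ℂ) - μ) with hCdef
  have hK : ‖∫ u in Ioo (0:ℝ) 1, wnK U 0 (1/2) μ u‖ ≤ M := by
    refine norm_integral_le_of_norm_le hbound_int ?_
    refine (ae_restrict_iff' measurableSet_Ioo).2 (Eventually.of_forall fun u hu => ?_)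
    refine wnK_bound le_rfl le_rfl hL0 hL (by norm_num) ⟨hre, by linarith⟩ ?_ hu
    intro u hu hu'
    have : 1/2 ≤ u := by
      by_contra h'
      exact hu' ⟨hu.1, not_le.1 h'⟩
    exact le_trans (by linarith) (le_abs_self _)
  have hg : |gfun U μ.re| ≤ G := by
    have := hL μ.re ⟨hre, by linarith⟩ 0 ⟨le_rfl, by norm_num⟩
    have h2 : L * |μ.re - 0| ≤ L := by
      rw [sub_zero, abs_of_nonneg hre]; nlinarith
    have h3 := abs_sub_abs_le_abs_sub (gfun U μ.re) (gfun U 0)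
    rw [hG]; linarith
  have hl1 : ‖Complex.log (((1/2:ℝ):ℂ) - μ)‖ ≤ Real.log 4 + Real.pi := by
    refine (wn_norm_log_le _).trans ?_
    gcongr
    have e : ‖((1/2:ℝ):ℂ)‖ = 1/2 := by
      rw [Complex.norm_real]; norm_num
    have u1 : ‖((1/2:ℝ):ℂ) - μ‖ ≤ 1 := by
      refine (norm_sub_le _ _).trans ?_
      rw [e]; linarith
    have u2 : 1/4 ≤ ‖((1/2:ℝ):ℂ) - μ‖ := by
      refine le_trans ?_ (norm_sub_norm_le _ _)
      rw [e]; linarith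
    rw [abs_of_nonpos (Real.log_nonpos (norm_nonneg _) u1)]
    have := Real.log_le_log (by norm_num) u2
    rw [one_div, Real.log_inv] at this
    linarith
  have hl2 : ‖Complex.log (((0:ℝ):ℂ) - μ)‖ ≤ |Real.log ‖μ‖| + Real.pi := by
    refine (wn_norm_log_le _).trans ?_
    simp
  have hC : ‖μ‖ * ‖C‖ ≤ ‖μ‖ * M + G * (‖μ‖ * (Real.log 4 + Real.pi) +
      (|‖μ‖ * Real.log ‖μ‖| + ‖μ‖ * Real.pi)) := by
    have h1 : ‖C‖ ≤ M + G * ((Real.log 4 + Real.pi) + (|Real.log ‖μ‖| + Real.pi)) := by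
      rw [hdec]
      refine (norm_add_le _ _).trans (add_le_add hK ?_)
      rw [norm_mul, Complex.norm_real, Real.norm_eq_abs]
      refine mul_le_mul hg ((norm_sub_le _ _).trans (add_le_add hl1 hl2)) (norm_nonneg _) hG0
    calc ‖μ‖ * ‖C‖ ≤ ‖μ‖ * (M + G * ((Real.log 4 + Real.pi) + (|Real.log ‖μ‖| + Real.pi))) := by
          gcongr
      _ = _ := by rw [abs_mul, abs_norm]; ring
  -- conclusion
  by_contra hns
  rw [Complex.mem_slitPlane_iff, not_or, not_lt, not_not] at hns
  obtain ⟨hr, hi⟩ := hns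
  set x : ℝ := (PhiInv U μ - (γ:ℂ)).re with hx
  have hz : PhiInv U μ - (γ:ℂ) = (x:ℂ) := by
    apply Complex.ext <;> simp [hx]
    simpa using hi
  have hμ0 : μ ≠ 0 := by
    intro h'; rw [h'] at him; simp at him
  have hD0 : (D:ℂ) ≠ 0 := by exact_mod_cast hDpos.ne'
  rw [wn_Phi_eq_g hU him] at hz
  have hz2 : μ * (D:ℂ) * (C - γ) = (x * D : ℝ) * μ - 1 := by
    have : C - γ = x - 1 / (μ * (D:ℂ)) := by rw [← hz]; ring
    rw [this]
    field_simp
    push_cast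
    ring
  have hn : ‖μ * (D:ℂ) * (C - γ)‖ < 1 := by
    refine lt_of_le_of_lt ?_ hh1
    rw [norm_mul, norm_mul, Complex.norm_real, Real.norm_eq_abs, abs_of_pos hDpos]
    have : ‖C - (γ:ℂ)‖ ≤ ‖C‖ + |γ| := by
      refine (norm_sub_le _ _).trans ?_
      rw [Complex.norm_real, Real.norm_eq_abs]
    calc ‖μ‖ * D * ‖C - (γ:ℂ)‖ ≤ ‖μ‖ * D * (‖C‖ + |γ|) := by gcongr
      _ = D * (‖μ‖ * ‖C‖ + ‖μ‖ * |γ|) := by ring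
      _ ≤ h ‖μ‖ := mul_le_mul_of_nonneg_left (add_le_add_left hC _) hDpos.le
  have hre' := (Complex.abs_re_le_norm (μ * (D:ℂ) * (C - γ))).trans_lt hn
  rw [hz2, abs_lt] at hre'
  have e : (((x * D : ℝ):ℂ) * μ - 1).re = x * D * μ.re - 1 := by
    rw [Complex.sub_re, Complex.re_ofReal_mul]; simp
  rw [e] at hre'
  have : x * D * μ.re ≤ 0 := mul_nonpos_of_nonpos_of_nonneg (mul_nonpos_of_nonpos_of_nonneg hr hDpos.le) hre
  linarith [hre'.1]

lemma wn_g_near_one {U : ℝ → ℝ} (hU : AdmissibleShearFlow U) :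
    ∃ κ : ℝ, 0 < κ ∧ κ < 1/2 ∧ ∃ b ∈ Ioo (0:ℝ) 1, ∃ c > (0:ℝ), ∀ u ∈ Ico b 1,
      gfun U u ≤ -c * (1 - u) ^ κ := by
  obtain ⟨κ, hκ, hκ2, y0, hy0, c, hc, h⟩ := hU.kappa_decay
  refine ⟨κ, hκ, hκ2, U y0, ?_, c, hc, fun u hu => ?_⟩
  · rw [← wn_image hU]; exact ⟨y0, hy0, rfl⟩
  · have hu0 : 0 < u := by
      have : U y0 ∈ Ioo (0:ℝ) 1 := by rw [← wn_image hU]; exact ⟨y0, hy0, rfl⟩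
      exact this.1.trans_le hu.1
    obtain ⟨y, hy, rfl⟩ := wn_exists hU ⟨hu0, hu.2⟩
    have hyy : y0 ≤ y := ((wn_strictMono hU).le_iff_le hy0.le hy.le).1 hu.1
    have h1 := h y hyy
    rw [wn_g_U hU hy.le]
    have hd := hU.deriv_pos y hy.le
    have hp : 0 < 1 - U y := by linarith [hu.2]
    rw [div_le_iff₀ (by positivity)]
    have e : (1 - U y) ^ 2 = (1 - U y) ^ κ * (1 - U y) ^ (2 - κ) := by
      rw [← Real.rpow_add hp, ← Real.rpow_natCast]; norm_num
    rw [e]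
    have := mul_le_mul_of_nonneg_left h1 (Real.rpow_nonneg hp.le κ)
    linarith

lemma wn_near_one {U : ℝ → ℝ} (hU : AdmissibleShearFlow U) :
    ∃ δ > (0:ℝ), ∀ μ : ℂ, 0 < μ.im → μ.re ≤ 1 → ‖μ - 1‖ < δ → (PhiInv U μ).im < 0 := by
  obtain ⟨κ, hκ, hκ2, b, hb, c, hc, hg⟩ := wn_g_near_one hU
  set d : ℝ := (1 - b) / 2 with hd
  have hdpos : 0 < d := by rw [hd]; linarith [hb.2]
  set N : ℝ := ∫ u in Ioo (0:ℝ) 1, |gfun U u| / d ^ 2 with hN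
  have hev := (tendsto_rpow_neg_nhdsGT_zero (y := κ - 1) (by linarith)).eventually_gt_atTop (N * 9 / c)
  obtain ⟨δ, hδ, hδh⟩ := mem_nhdsGT_iff_exists_Ioo_subset.1 hev
  refine ⟨min δ (d / 2), by have := mem_Ioi.1 hδ; positivity, fun μ him hre hμ => ?_⟩
  set r : ℝ := ‖μ - 1‖ with hr
  have hr0 : 0 < r := by
    rw [hr, norm_pos_iff, sub_ne_zero]
    intro h'; rw [h'] at him; simp at him
  have hrδ : r < δ := hμ.trans_le (min_le_left _ _)
  have hrd : r < d / 2 := hμ.trans_le (min_le_right _ _)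
  have hbig : N * 9 / c < r ^ (κ - 1) := hδh ⟨hr0, hrδ⟩
  rw [wn_Phi_eq_g hU him]
  have hd0 := hU.deriv_pos 0 le_rfl
  have e1 : (1 / (μ * ((deriv U 0 : ℝ) : ℂ))).im < 0 := by
    rw [one_div, Complex.inv_im, Complex.im_mul_ofReal]
    have : 0 < Complex.normSq (μ * ((deriv U 0 : ℝ) : ℂ)) := by
      rw [Complex.normSq_pos]
      refine mul_ne_zero ?_ (by exact_mod_cast hd0.ne')
      intro h'; rw [h'] at him; simp at him
    apply div_neg_of_neg_of_pos _ this
    nlinarith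
  have hIntg := wn_ker_int (wn_g_int hU) him
  have e2 : (∫ u in Ioo (0:ℝ) 1, (gfun U u : ℂ) / ((u:ℂ) - μ)).im
      = ∫ u in Ioo (0:ℝ) 1, μ.im * (gfun U u / Complex.normSq ((u:ℂ) - μ)) := by
    have := integral_im hIntg
    refine Eq.trans this.symm ?_
    refine integral_congr_ae (Eventually.of_forall fun u => ?_)
    simp only
    rw [div_eq_mul_inv]
    change ((gfun U u : ℂ) * ((u:ℂ) - μ)⁻¹).im = _
    rw [Complex.im_ofReal_mul, Complex.inv_im]
    simp
    ring
  have hi2 : IntegrableOn (fun u => μ.im * (gfun U u / Complex.normSq ((u:ℂ) - μ))) (Ioo (0:ℝ) 1) := by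
    have := hIntg.im
    refine this.congr (Eventually.of_forall fun u => ?_)
    change ((gfun U u : ℂ) / ((u:ℂ) - μ)).im = _
    rw [div_eq_mul_inv, Complex.im_ofReal_mul, Complex.inv_im]
    simp
    ring
  have hi3 : IntegrableOn (fun u => gfun U u / Complex.normSq ((u:ℂ) - μ)) (Ioo (0:ℝ) 1) := by
    have := hi2.const_mul (μ.im)⁻¹
    refine this.congr (Eventually.of_forall fun u => ?_)
    field_simp
  rw [Complex.add_im, e2, integral_const_mul]
  have key : ∫ u in Ioo (0:ℝ) 1, gfun U u / Complex.normSq ((u:ℂ) - μ) ≤ 0 := by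
    have hi4 : IntegrableOn (fun u => |gfun U u| / d ^ 2 -
        (Ioo (1 - 2 * r) (1 - r)).indicator (fun _ => c * r ^ κ / (9 * r ^ 2)) u) (Ioo (0:ℝ) 1) := by
      refine Integrable.sub ((wn_g_int hU).abs.div_const _) ?_
      refine Integrable.indicator ?_ measurableSet_Ioo
      exact integrableOn_const (by simp)
    refine (setIntegral_mono_on hi3 hi4 measurableSet_Ioo ?_).trans ?_
    · intro u hu
      have hnn := Complex.normSq_nonneg ((u:ℂ) - μ)
      have hA : 0 ≤ |gfun U u| / d ^ 2 := by positivity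
      rcases lt_or_ge u b with hub | hub
      · rw [indicator_of_notMem (by rintro ⟨h1, _⟩; linarith), sub_zero]
        have hn : d ^ 2 ≤ Complex.normSq ((u:ℂ) - μ) := by
          rw [Complex.normSq_eq_norm_sq]
          have : d ≤ ‖(u:ℂ) - μ‖ := by
            have h1 : ‖(u:ℂ) - 1‖ = 1 - u := by
              rw [← Complex.ofReal_one, ← Complex.ofReal_sub, Complex.norm_real, Real.norm_eq_abs,
                abs_sub_comm, abs_of_nonneg (by linarith [hu.2])]
            have h2 : ‖(u:ℂ) - 1‖ ≤ ‖(u:ℂ) - μ‖ + r := by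
              rw [hr]; exact norm_sub_le_norm_sub_add_norm_sub _ _ _
            rw [h1] at h2
            linarith
          gcongr
        calc gfun U u / Complex.normSq ((u:ℂ) - μ) ≤ |gfun U u| / Complex.normSq ((u:ℂ) - μ) := by
              gcongr; exact le_abs_self _
          _ ≤ _ := by gcongr
      · have hgu := hg u ⟨hub, hu.2⟩
        have hpow : 0 ≤ (1 - u) ^ κ := Real.rpow_nonneg (by linarith [hu.2]) κ
        by_cases hmem : u ∈ Ioo (1 - 2 * r) (1 - r)
        · rw [indicator_of_mem hmem]
          have h1 : ‖(u:ℂ) - μ‖ ≤ 3 * r := by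
            have h1 : ‖(u:ℂ) - 1‖ = 1 - u := by
              rw [← Complex.ofReal_one, ← Complex.ofReal_sub, Complex.norm_real, Real.norm_eq_abs,
                abs_sub_comm, abs_of_nonneg (by linarith [hu.2])]
            have h2 : ‖(u:ℂ) - μ‖ ≤ ‖(u:ℂ) - 1‖ + r := by
              rw [hr, norm_sub_rev μ 1]
              exact norm_sub_le_norm_sub_add_norm_sub _ _ _
            rw [h1] at h2
            linarith [hmem.1]
          have h2 : Complex.normSq ((u:ℂ) - μ) ≤ 9 * r ^ 2 := by
            rw [Complex.normSq_eq_norm_sq]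
            nlinarith [norm_nonneg ((u:ℂ) - μ)]
          have h3 : 0 < Complex.normSq ((u:ℂ) - μ) := Complex.normSq_pos.2 (wn_sub_ne' him u)
          have h4 : r ^ κ ≤ (1 - u) ^ κ :=
            Real.rpow_le_rpow hr0.le (by linarith [hmem.2]) hκ.le
          have h5 : c * r ^ κ / (9 * r ^ 2) ≤ -gfun U u / Complex.normSq ((u:ℂ) - μ) := by
            apply div_le_div₀ _ _ h3 h2
            · nlinarith
            · nlinarith
          rw [neg_div] at h5
          linarith
        · rw [indicator_of_notMem hmem, sub_zero]
          refine le_trans (div_nonpos_of_nonpos_of_nonneg ?_ hnn) hA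
          nlinarith
    · rw [integral_sub ((wn_g_int hU).abs.div_const _), setIntegral_indicator measurableSet_Ioo,
        inter_eq_right.2 (Ioo_subset_Ioo (by linarith [hb.1]) (by linarith))]
      · rw [setIntegral_const, measureReal_def, Real.volume_Ioo, ENNReal.toReal_ofReal (by linarith),
          smul_eq_mul]
        have e : (1 - r - (1 - 2 * r)) * (c * r ^ κ / (9 * r ^ 2)) = c / 9 * r ^ (κ - 1) := by
          rw [Real.rpow_sub_one hr0.ne']
          field_simp
          ring
        rw [e]
        rw [div_lt_iff₀ hc] at hbig
        change N - _ ≤ 0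
        linarith
      · refine Integrable.indicator ?_ measurableSet_Ioo
        exact integrableOn_const (by simp)
  nlinarith

end PartB2

section PartC1

/-- the log-derivative integral of `K` over `[s,t]` is the difference of logs plus `2πin` -/
def wnP (K K' : ℝ → ℂ) (s t : ℝ) (n : ℤ) : Prop :=
  (∀ x ∈ Icc s t, K x ≠ 0) ∧
    ∫ x in s..t, K' x / K x = Complex.log (K t) - Complex.log (K s) + 2 * Real.pi * Complex.I * (n : ℂ)

lemma wnP_int {K K' : ℝ → ℂ} (hK : Continuous K) (hK' : Continuous K') {s t : ℝ} (hst : s ≤ t)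
    (h0 : ∀ x ∈ Icc s t, K x ≠ 0) : IntervalIntegrable (fun x => K' x / K x) volume s t := by
  apply ContinuousOn.intervalIntegrable
  rw [uIcc_of_le hst]
  exact hK'.continuousOn.div hK.continuousOn h0

lemma wnP_add {K K' : ℝ → ℂ} (hK : Continuous K) (hK' : Continuous K') {s t r : ℝ} {n m : ℤ}
    (hst : s ≤ t) (htr : t ≤ r) (h1 : wnP K K' s t n) (h2 : wnP K K' t r m) :
    wnP K K' s r (n + m) := by
  refine ⟨fun x hx => ?_, ?_⟩
  · rcases le_total x t with h | h
    · exact h1.1 x ⟨hx.1, h⟩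
    · exact h2.1 x ⟨h, hx.2⟩
  · rw [← intervalIntegral.integral_add_adjacent_intervals (wnP_int hK hK' hst h1.1)
      (wnP_int hK hK' htr h2.1), h1.2, h2.2]
    push_cast
    ring

lemma wnP_slit {K K' : ℝ → ℂ} (hd : ∀ x, HasDerivAt K (K' x) x) (hK' : Continuous K') {s t : ℝ}
    (hst : s ≤ t) (h : ∀ x ∈ Icc s t, K x ∈ Complex.slitPlane) : wnP K K' s t 0 := by
  have hK : Continuous K := continuous_iff_continuousAt.2 fun x => (hd x).continuousAt
  have h0 : ∀ x ∈ Icc s t, K x ≠ 0 := fun x hx => Complex.slitPlane_ne_zero (h x hx)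
  refine ⟨h0, ?_⟩
  rw [intervalIntegral.integral_eq_sub_of_hasDerivAt (f := fun x => Complex.log (K x))
    (fun x hx => ?_) (wnP_int hK hK' hst h0)]
  · simp
  · rw [uIcc_of_le hst] at hx
    exact (hd x).clog_real (h x hx)

/-- sign of the imaginary part -/
noncomputable def wnσ (z : ℂ) : ℤ := if 0 < z.im then 1 else -1

lemma wn_log_neg {z : ℂ} (hz : z.im ≠ 0) :
    Complex.log (-z) = Complex.log z - Real.pi * Complex.I * (wnσ z : ℂ) := by
  unfold wnσ
  unfold Complex.log
  rw [norm_neg]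
  rcases lt_or_gt_of_ne hz with h | h
  · rw [if_neg (not_lt.2 h.le), Complex.arg_neg_eq_arg_add_pi_of_im_neg h]
    push_cast; ring
  · rw [if_pos h, Complex.arg_neg_eq_arg_sub_pi_of_im_pos h]
    push_cast; ring

lemma wnP_neg {K K' : ℝ → ℂ} (hd : ∀ x, HasDerivAt K (K' x) x) (hK' : Continuous K') {s t : ℝ}
    (hst : s ≤ t) (h : ∀ x ∈ Icc s t, (K x).re < 0) {n : ℤ} (hs : (K s).im ≠ 0)
    (ht : (K t).im ≠ 0) (hn : 2 * n = wnσ (K s) - wnσ (K t)) : wnP K K' s t n := by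
  have hK : Continuous K := continuous_iff_continuousAt.2 fun x => (hd x).continuousAt
  have h0 : ∀ x ∈ Icc s t, K x ≠ 0 := fun x hx h' => by
    have := h x hx
    rw [h'] at this; simp at this
  refine ⟨h0, ?_⟩
  rw [intervalIntegral.integral_eq_sub_of_hasDerivAt (f := fun x => Complex.log (-K x))
    (fun x hx => ?_) (wnP_int hK hK' hst h0)]
  · rw [wn_log_neg hs, wn_log_neg ht]
    have : (2:ℂ) * (n:ℂ) = (wnσ (K s) : ℂ) - (wnσ (K t) : ℂ) := by exact_mod_cast hn
    linear_combination (-(Real.pi : ℂ) * Complex.I) * this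
  · rw [uIcc_of_le hst] at hx
    have := ((hd x).neg).clog_real (by
      rw [Complex.mem_slitPlane_iff]; left; simpa using h x hx)
    simpa [neg_div_neg_eq] using this

lemma wnP_global {K K' : ℝ → ℝ → ℂ} (hd : ∀ η, 0 < η → ∀ x, HasDerivAt (K η) (K' η x) x)
    (hK' : ∀ η, 0 < η → Continuous (K' η)) (Z : Finset ℝ) (n : ℝ → ℤ)
    (H1 : ∀ x ∈ Icc (0:ℝ) (1/2), x ∉ Z → ∀ᶠ p : ℝ × ℝ in nhds (0, x), 0 < p.1 →
      p.2 ∈ Icc (0:ℝ) (1/2) → K p.1 p.2 ∈ Complex.slitPlane)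
    (H2 : ∀ z ∈ Z, ∃ δ > (0:ℝ), ∀ δ' ∈ Ioo 0 δ, ∀ᶠ η in nhdsWithin (0:ℝ) (Ioi 0),
      wnP (K η) (K' η) (z - δ') (z + δ') (n z)) :
    ∀ (k : ℕ) (s t : ℝ), (Z.filter (fun z => s < z ∧ z < t)).card = k → 0 ≤ s → s ≤ t → t ≤ 1/2 →
      s ∉ Z → t ∉ Z → ∀ᶠ η in nhdsWithin (0:ℝ) (Ioi 0),
      wnP (K η) (K' η) s t (∑ z ∈ Z.filter (fun z => s < z ∧ z < t), n z) := by
  intro k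
  induction k using Nat.strong_induction_on with
  | _ k ih =>
  intro s t hk hs hst ht hsZ htZ
  have hself : ∀ᶠ η in nhdsWithin (0:ℝ) (Ioi 0), 0 < η := self_mem_nhdsWithin
  rcases (Z.filter (fun z => s < z ∧ z < t)).eq_empty_or_nonempty with he | ⟨z, hz⟩
  · rw [he, Finset.sum_empty]
    have hcomp : ∀ᶠ η in nhds (0:ℝ), ∀ x ∈ Icc s t, 0 < η → x ∈ Icc (0:ℝ) (1/2) →
        K η x ∈ Complex.slitPlane := by
      refine isCompact_Icc.eventually_forall_of_forall_eventually fun x hx => ?_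
      have hxZ : x ∉ Z := by
        intro hxZ
        have hx1 : s ≠ x := fun h => hsZ (h ▸ hxZ)
        have hx2 : x ≠ t := fun h => htZ (h ▸ hxZ)
        have : x ∈ Z.filter (fun z => s < z ∧ z < t) :=
          Finset.mem_filter.2 ⟨hxZ, lt_of_le_of_ne hx.1 hx1, lt_of_le_of_ne hx.2 hx2⟩
        rw [he] at this
        simp at this
      exact H1 x ⟨hs.trans hx.1, hx.2.trans ht⟩ hxZ
    filter_upwards [hself, nhdsWithin_le_nhds hcomp] with η hη h
    exact wnP_slit (hd η hη) (hK' η hη) hst fun x hx =>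
      h x hx hη ⟨hs.trans hx.1, hx.2.trans ht⟩
  · obtain ⟨hzZ, hsz, hzt⟩ := Finset.mem_filter.1 hz
    obtain ⟨δ, hδ, hδP⟩ := H2 z hzZ
    have hcl : IsClosed (((Z.erase z : Finset ℝ)) : Set ℝ) := (Z.erase z).finite_toSet.isClosed
    have hnb : (((Z.erase z : Finset ℝ)) : Set ℝ)ᶜ ∈ nhds z :=
      hcl.isOpen_compl.mem_nhds (by simp)
    obtain ⟨ε, hε, hεZ⟩ := Metric.mem_nhds_iff.1 hnb
    obtain ⟨d, hd0, hdm⟩ := exists_between (show 0 < min (min δ ε) (min (z - s) (t - z)) from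
      lt_min (lt_min hδ hε) (lt_min (by linarith) (by linarith)))
    have d1 : d < δ := hdm.trans_le ((min_le_left _ _).trans (min_le_left _ _))
    have d2 : d < ε := hdm.trans_le ((min_le_left _ _).trans (min_le_right _ _))
    have d3 : d < z - s := hdm.trans_le ((min_le_right _ _).trans (min_le_left _ _))
    have d4 : d < t - z := hdm.trans_le ((min_le_right _ _).trans (min_le_right _ _))
    have hiso : ∀ w ∈ Z, |w - z| < ε → w = z := by
      intro w hw hwz
      by_contra hne
      exact hεZ (show w ∈ Metric.ball z ε by rwa [Metric.mem_ball, Real.dist_eq])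
        (by simp [hne, hw])
    have hl : z - d ∉ Z := fun h => by
      have := hiso _ h (by rw [abs_lt]; constructor <;> linarith)
      linarith
    have hr : z + d ∉ Z := fun h => by
      have := hiso _ h (by rw [abs_lt]; constructor <;> linarith)
      linarith
    have hlt : ∀ s' t' : ℝ, s ≤ s' → t' ≤ t → (t' < z ∨ z < s') →
        (Z.filter (fun z => s' < z ∧ z < t')).card < k := by
      intro s' t' h1 h2 h3
      rw [← hk]
      apply Finset.card_lt_card
      rw [Finset.ssubset_iff_of_subset]
      · refine ⟨z, hz, ?_⟩
        rw [Finset.mem_filter]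
        rintro ⟨_, h4, h5⟩
        rcases h3 with h3 | h3 <;> linarith
      · intro w hw
        rw [Finset.mem_filter] at hw ⊢
        exact ⟨hw.1, by linarith [hw.2.1], by linarith [hw.2.2]⟩
    have hP1 := ih _ (hlt s (z - d) le_rfl (by linarith) (Or.inl (by linarith))) s (z - d) rfl hs
      (by linarith) (by linarith) hsZ hl
    have hP3 := ih _ (hlt (z + d) t (by linarith) le_rfl (Or.inr (by linarith))) (z + d) t rfl
      (by linarith) (by linarith) ht hr htZ
    have hP2 := hδP d ⟨hd0, d1⟩
    have hsum : ∑ z ∈ Z.filter (fun z => s < z ∧ z < t), n z =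
        ∑ w ∈ Z.filter (fun w => s < w ∧ w < z - d), n w + n z
        + ∑ w ∈ Z.filter (fun w => z + d < w ∧ w < t), n w := by
      rw [← Finset.add_sum_erase _ _ hz]
      have : (Z.filter (fun z => s < z ∧ z < t)).erase z =
          Z.filter (fun w => s < w ∧ w < z - d) ∪ Z.filter (fun w => z + d < w ∧ w < t) := by
        ext w
        simp only [Finset.mem_erase, Finset.mem_filter, Finset.mem_union]
        constructor
        · rintro ⟨hne, hw, h1, h2⟩
          rcases lt_or_ge w (z - d) with h | h
          · exact Or.inl ⟨hw, h1, h⟩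
          · refine Or.inr ⟨hw, ?_, h2⟩
            by_contra h'
            exact hne (hiso w hw (by rw [abs_lt]; constructor <;> linarith))
        · rintro (⟨hw, h1, h2⟩ | ⟨hw, h1, h2⟩)
          · exact ⟨by intro h; linarith, hw, h1, by linarith⟩
          · exact ⟨by intro h; linarith, hw, by linarith, h2⟩
      rw [this, Finset.sum_union]
      · ring
      · rw [Finset.disjoint_left]
        intro w h1 h2
        rw [Finset.mem_filter] at h1 h2
        linarith [h1.2.2, h2.2.1]
    rw [hsum]
    filter_upwards [hself, hP1, hP2, hP3] with η hη h1 h2 h3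
    have hK : Continuous (K η) := continuous_iff_continuousAt.2 fun x => (hd η hη x).continuousAt
    exact wnP_add hK (hK' η hη) (by linarith) (by linarith)
      (wnP_add hK (hK' η hη) (by linarith) (by linarith) h1 h2) h3

end PartC1

section PartC2

/-- horizontal segment -/
noncomputable def wnpt (η x : ℝ) : ℂ := ((2 * x : ℝ) : ℂ) + (η : ℂ) * Complex.I

lemma wnpt_re (η x : ℝ) : (wnpt η x).re = 2 * x := by simp [wnpt]
lemma wnpt_im (η x : ℝ) : (wnpt η x).im = η := by simp [wnpt]

noncomputable def wnKb (U : ℝ → ℝ) (γ η x : ℝ) : ℂ := PhiInv U (wnpt η x) - (γ : ℂ)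
noncomputable def wnKb' (U : ℝ → ℝ) (η x : ℝ) : ℂ := deriv (PhiInv U) (wnpt η x) * 2

lemma wn_upper_open : IsOpen {z : ℂ | 0 < z.im} := isOpen_lt continuous_const Complex.continuous_im

lemma wn_Phi_diffOn {U : ℝ → ℝ} (hU : AdmissibleShearFlow U) :
    DifferentiableOn ℂ (PhiInv U) {z : ℂ | 0 < z.im} :=
  fun _ hz => (wn_Phi_diff hU hz).differentiableWithinAt

lemma wn_Phi_deriv_cont {U : ℝ → ℝ} (hU : AdmissibleShearFlow U) :
    ContinuousOn (deriv (PhiInv U)) {z : ℂ | 0 < z.im} :=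
  ((wn_Phi_diffOn hU).deriv wn_upper_open).continuousOn

lemma wnpt_deriv (η x : ℝ) : HasDerivAt (wnpt η) 2 x := by
  unfold wnpt
  have h := wn_ofReal ((hasDerivAt_id x).const_mul (2:ℝ))
  simpa using h.add_const ((η : ℂ) * Complex.I)

lemma wnKb_deriv {U : ℝ → ℝ} (hU : AdmissibleShearFlow U) (γ : ℝ) {η : ℝ} (hη : 0 < η) (x : ℝ) :
    HasDerivAt (wnKb U γ η) (wnKb' U η x) x := by
  unfold wnKb wnKb'
  have h1 := (wn_Phi_diff hU (μ := wnpt η x) (by rw [wnpt_im]; exact hη)).hasDerivAt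
  exact (h1.comp x (wnpt_deriv η x)).sub_const _

lemma wnKb'_cont {U : ℝ → ℝ} (hU : AdmissibleShearFlow U) {η : ℝ} (hη : 0 < η) :
    Continuous (wnKb' U η) := by
  unfold wnKb'
  have h : Continuous (wnpt η) := by unfold wnpt; fun_prop
  exact ((wn_Phi_deriv_cont hU).comp_continuous h (fun x => by
    change 0 < (wnpt η x).im; rw [wnpt_im]; exact hη)).mul continuous_const

lemma wnpt_tendsto (x : ℝ) :
    Tendsto (fun p : ℝ × ℝ => wnpt p.1 p.2) (nhds (0, x)) (nhds (((2 * x : ℝ)) : ℂ)) := by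
  have h : Continuous (fun p : ℝ × ℝ => wnpt p.1 p.2) := by unfold wnpt; fun_prop
  have := h.tendsto (0, x)
  simpa [wnpt] using this

lemma wn_g_zero_iff {U : ℝ → ℝ} (hU : AdmissibleShearFlow U) {y : ℝ} (hy : 0 ≤ y) :
    ∃ c > (0:ℝ), gfun U (U y) = c * iteratedDeriv 2 U y := by
  have h1 := hU.deriv_pos y hy
  have h2 := (hU.mem_Ico y hy).2
  refine ⟨(1 - U y) ^ 2 / (deriv U y) ^ 3, ?_, ?_⟩
  · have : 0 < 1 - U y := by linarith
    positivity
  · rw [wn_g_U hU hy]; ring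

lemma wn_chi (U : ℝ → ℝ) (y : ℝ) :
    chiAbscissa U y = 1 / (U y * deriv U 0) + pvIntegral (gfun U) (U y) := by
  unfold chiAbscissa Gfun
  simp

lemma wn_U_mem {U : ℝ → ℝ} (hU : AdmissibleShearFlow U) {y : ℝ} (hy : 0 < y) :
    U y ∈ Ioo (0:ℝ) 1 := by
  rw [← wn_image hU]; exact ⟨y, hy, rfl⟩

lemma wn_H1 {U : ℝ → ℝ} (hU : AdmissibleShearFlow U) {γ : ℝ}
    (hγ : ∀ y, 0 < y → iteratedDeriv 2 U y = 0 → chiAbscissa U y ≠ γ)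
    {x : ℝ} (hx : x ∈ Icc (0:ℝ) (1/2))
    (hxZ : ∀ y, 0 < y → iteratedDeriv 2 U y = 0 → chiAbscissa U y < γ → U y / 2 ≠ x) :
    ∀ᶠ p : ℝ × ℝ in nhds (0, x), 0 < p.1 →
      p.2 ∈ Icc (0:ℝ) (1/2) → wnKb U γ p.1 p.2 ∈ Complex.slitPlane := by
  unfold wnKb
  rcases eq_or_lt_of_le hx.1 with h0 | h0
  · subst h0
    obtain ⟨δ, hδ, h⟩ := wn_near_zero hU γ
    have ht := (wnpt_tendsto 0).norm.eventually_lt_const (u := δ) (by simpa using hδ)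
    filter_upwards [ht] with p hp h1 h2
    exact h _ (by rwa [wnpt_im]) (by rw [wnpt_re]; linarith [h2.1]) hp
  rcases eq_or_lt_of_le hx.2 with h1 | h1
  · subst h1
    obtain ⟨δ, hδ, h⟩ := wn_near_one hU
    have ht := ((wnpt_tendsto (1/2)).sub_const 1).norm.eventually_lt_const
      (u := δ) (by simpa using hδ)
    filter_upwards [ht] with p hp h1 h2
    have := h _ (by rwa [wnpt_im]) (by rw [wnpt_re]; linarith [h2.2]) hp
    rw [Complex.mem_slitPlane_iff]
    right
    simpa using this.ne
  · have ha : 2 * x ∈ Ioo (0:ℝ) 1 := ⟨by linarith, by linarith⟩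
    obtain ⟨y, hy, hyx⟩ := wn_exists hU ha
    obtain ⟨ℓ, hlim, hℓ⟩ := wn_interior hU ha
    have hsl : (ℓ : ℂ) + ((Real.pi * gfun U (2 * x) : ℝ) : ℂ) * Complex.I - (γ:ℂ) ∈ Complex.slitPlane := by
      rw [Complex.mem_slitPlane_iff]
      obtain ⟨c, hc, hgc⟩ := wn_g_zero_iff hU hy.le
      rw [hyx] at hgc
      by_cases hg : gfun U (2 * x) = 0
      · left
        have h2 : iteratedDeriv 2 U y = 0 := by
          rw [hgc] at hg
          exact (mul_eq_zero.1 hg).resolve_left hc.ne'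
        have h3 := hℓ hg
        rw [← hyx, ← wn_chi] at h3
        have h4 : ¬ chiAbscissa U y < γ := fun h4 => hxZ y hy h2 h4 (by linarith)
        have h5 := lt_of_le_of_ne (not_lt.1 h4) (hγ y hy h2).symm
        simp
        rw [h3]; exact h5
      · right
        simp [Real.pi_ne_zero, hg]
    have hev := (hlim.sub_const (γ:ℂ)).eventually (Complex.isOpen_slitPlane.mem_nhds hsl)
    rw [eventually_nhdsWithin_iff] at hev
    filter_upwards [(wnpt_tendsto x).eventually hev] with p hp h1 _
    exact hp (by change 0 < (wnpt p.1 p.2).im; rwa [wnpt_im])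

lemma wn_sign {f : ℝ → ℝ} (hf : Continuous f) {a b : ℝ} (h : ∀ x ∈ Ioo a b, f x ≠ 0) :
    (∀ x ∈ Ioo a b, 0 < f x) ∨ (∀ x ∈ Ioo a b, f x < 0) := by
  by_contra hcon
  push Not at hcon
  obtain ⟨⟨x, hx, hx0⟩, ⟨z, hz, hz0⟩⟩ := hcon
  obtain ⟨w, hw, hw0⟩ := isPreconnected_Ioo.intermediate_value hx hz hf.continuousOn ⟨hx0, hz0⟩
  exact h w hw hw0

open Classical in
/-- crossing index -/
noncomputable def wnν (U : ℝ → ℝ) (y : ℝ) : ℤ :=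
  (if ∃ δ > (0:ℝ), (∀ z ∈ Ioo (y - δ) y, 0 < iteratedDeriv 2 U z) ∧
      (∀ z ∈ Ioo y (y + δ), iteratedDeriv 2 U z < 0) then 1 else 0)
  - (if ∃ δ > (0:ℝ), (∀ z ∈ Ioo (y - δ) y, iteratedDeriv 2 U z < 0) ∧
      (∀ z ∈ Ioo y (y + δ), 0 < iteratedDeriv 2 U z) then 1 else 0)

lemma wn_contra {f : ℝ → ℝ} {y ρ δ : ℝ} (hρ : 0 < ρ) (hδ : 0 < δ)
    (h1 : (∀ z ∈ Ioo (y - ρ) y, 0 < f z) ∧ (∀ z ∈ Ioo (y - δ) y, f z < 0) ∨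
      (∀ z ∈ Ioo y (y + ρ), 0 < f z) ∧ (∀ z ∈ Ioo y (y + δ), f z < 0)) : False := by
  obtain ⟨e, he, hem⟩ := exists_between (lt_min hρ hδ)
  have e1 := hem.trans_le (min_le_left _ _)
  have e2 := hem.trans_le (min_le_right _ _)
  rcases h1 with ⟨h, h'⟩ | ⟨h, h'⟩
  · have a1 := h (y - e) ⟨by linarith, by linarith⟩
    have a2 := h' (y - e) ⟨by linarith, by linarith⟩
    linarith
  · have a1 := h (y + e) ⟨by linarith, by linarith⟩
    have a2 := h' (y + e) ⟨by linarith, by linarith⟩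
    linarith

/-- sign of the imaginary part just above the axis -/
lemma wn_im_ev {U : ℝ → ℝ} (hU : AdmissibleShearFlow U) (γ : ℝ) {y : ℝ} (hy : 0 < y)
    (h : iteratedDeriv 2 U y ≠ 0) : ∀ᶠ η in nhdsWithin (0:ℝ) (Ioi 0),
      (wnKb U γ η (U y / 2)).im ≠ 0 ∧
      wnσ (wnKb U γ η (U y / 2)) = if 0 < iteratedDeriv 2 U y then 1 else -1 := by
  obtain ⟨c, hc, hgc⟩ := wn_g_zero_iff hU hy.le
  obtain ⟨ℓ, hlim, -⟩ := wn_interior hU (wn_U_mem hU hy)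
  have hpt : Tendsto (fun η => wnpt η (U y / 2)) (nhdsWithin (0:ℝ) (Ioi 0))
      (nhdsWithin ((U y : ℝ) : ℂ) {z | 0 < z.im}) := by
    rw [tendsto_nhdsWithin_iff]
    refine ⟨?_, ?_⟩
    · have h : Continuous (fun η => wnpt η (U y / 2)) := by unfold wnpt; fun_prop
      have h2 := (h.tendsto 0).mono_left (nhdsWithin_le_nhds (s := Ioi (0:ℝ)))
      have e : wnpt 0 (U y / 2) = ((U y : ℝ) : ℂ) := by
        unfold wnpt; push_cast; ring
      rwa [e] at h2
    · filter_upwards [self_mem_nhdsWithin] with η hη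
      change 0 < (wnpt η (U y / 2)).im; rw [wnpt_im]; exact hη
  have hK := (Complex.continuous_im.tendsto _).comp ((hlim.comp hpt).sub_const (γ:ℂ))
  have e : ((ℓ : ℂ) + ((Real.pi * gfun U (U y) : ℝ) : ℂ) * Complex.I - (γ:ℂ)).im
      = Real.pi * (c * iteratedDeriv 2 U y) := by
    rw [hgc]; simp
  rw [e] at hK
  rcases lt_or_gt_of_ne h with h' | h'
  · have : Real.pi * (c * iteratedDeriv 2 U y) < 0 :=
      mul_neg_of_pos_of_neg Real.pi_pos (mul_neg_of_pos_of_neg hc h')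
    filter_upwards [hK.eventually (gt_mem_nhds this)] with η hη
    change (wnKb U γ η (U y / 2)).im < 0 at hη
    refine ⟨hη.ne, ?_⟩
    unfold wnσ
    rw [if_neg (not_lt.2 hη.le), if_neg (not_lt.2 h'.le)]
  · have : 0 < Real.pi * (c * iteratedDeriv 2 U y) := by positivity
    filter_upwards [hK.eventually (lt_mem_nhds this)] with η hη
    change 0 < (wnKb U γ η (U y / 2)).im at hη
    refine ⟨hη.ne', ?_⟩
    unfold wnσ
    rw [if_pos hη, if_pos h']

lemma wn_H2 {U : ℝ → ℝ} (hU : AdmissibleShearFlow U) {γ : ℝ} {y : ℝ} (hy : 0 < y)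
    (hy2 : iteratedDeriv 2 U y = 0) (hχ : chiAbscissa U y < γ) :
    ∃ δ > (0:ℝ), ∀ δ' ∈ Ioo 0 δ, ∀ᶠ η in nhdsWithin (0:ℝ) (Ioi 0),
      wnP (wnKb U γ η) (wnKb' U η) (U y / 2 - δ') (U y / 2 + δ') (wnν U y) := by
  have ha := wn_U_mem hU hy
  -- real part
  obtain ⟨ℓ, hlim, hℓ⟩ := wn_interior hU ha
  have hg : gfun U (U y) = 0 := by
    obtain ⟨c, hc, hgc⟩ := wn_g_zero_iff hU hy.le
    rw [hgc, hy2, mul_zero]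
  have hℓ' : ℓ < γ := by rw [hℓ hg, ← wn_chi]; exact hχ
  have hK := (Complex.continuous_re.tendsto _).comp (hlim.sub_const (γ:ℂ))
  have e : ((ℓ : ℂ) + ((Real.pi * gfun U (U y) : ℝ) : ℂ) * Complex.I - (γ:ℂ)).re = ℓ - γ := by
    simp
  rw [e] at hK
  have hev := hK.eventually (gt_mem_nhds (show ℓ - γ < 0 by linarith))
  rw [eventually_nhdsWithin_iff, Metric.eventually_nhds_iff] at hev
  obtain ⟨ε, hε, hεP⟩ := hev
  -- isolation
  have hcl : IsClosed ({w : ℝ | 0 < w ∧ iteratedDeriv 2 U w = 0} \ {y}) :=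
    (hU.finite_inflexions.subset sdiff_subset).isClosed
  obtain ⟨ρ0, hρ0, hρZ⟩ := Metric.mem_nhds_iff.1 (hcl.isOpen_compl.mem_nhds (by simp : y ∈ _))
  obtain ⟨ρ, hρ, hρm⟩ := exists_between (lt_min hρ0 hy)
  have r1 : ρ < ρ0 := hρm.trans_le (min_le_left _ _)
  have r2 : ρ < y := hρm.trans_le (min_le_right _ _)
  have hiso : ∀ w, |w - y| < ρ → w ≠ y → iteratedDeriv 2 U w ≠ 0 := by
    intro w hw hne h0
    have hw0 : 0 < w := by rw [abs_lt] at hw; linarith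
    exact hρZ (show w ∈ Metric.ball y ρ0 by
      rw [Metric.mem_ball, Real.dist_eq]; linarith) ⟨⟨hw0, h0⟩, hne⟩
  have hL := wn_sign (wn_cont_d2 hU) (a := y - ρ) (b := y) (fun w hw =>
    hiso w (by rw [abs_lt]; constructor <;> linarith [hw.1, hw.2]) hw.2.ne)
  have hR := wn_sign (wn_cont_d2 hU) (a := y) (b := y + ρ) (fun w hw =>
    hiso w (by rw [abs_lt]; constructor <;> linarith [hw.1, hw.2]) hw.1.ne')
  have m1 : U (y - ρ) < U y := wn_strictMono hU (show (0:ℝ) ≤ y - ρ by linarith) hy.le (by linarith)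
  have m2 : U y < U (y + ρ) := wn_strictMono hU hy.le (show (0:ℝ) ≤ y + ρ by linarith) (by linarith)
  have hlow0 := (hU.mem_Ico (y - ρ) (by linarith)).1
  have hup1 := (hU.mem_Ico (y + ρ) (by linarith)).2
  refine ⟨min (ε / 4) (min ((U y - U (y - ρ)) / 2) ((U (y + ρ) - U y) / 2)), ?_, ?_⟩
  · refine lt_min (by positivity) (lt_min ?_ ?_) <;> linarith
  rintro d ⟨hd0, hdm⟩
  have d1 : d < ε / 4 := hdm.trans_le (min_le_left _ _)
  have d2 : d < (U y - U (y - ρ)) / 2 := hdm.trans_le ((min_le_right _ _).trans (min_le_left _ _))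
  have d3 : d < (U (y + ρ) - U y) / 2 := hdm.trans_le ((min_le_right _ _).trans (min_le_right _ _))
  obtain ⟨yl, hyl, hyl'⟩ := wn_exists hU (u := U y - 2 * d) ⟨by linarith, by linarith⟩
  obtain ⟨yr, hyr, hyr'⟩ := wn_exists hU (u := U y + 2 * d) ⟨by linarith [ha.1], by linarith⟩
  have l1 : y - ρ < yl := ((wn_strictMono hU).lt_iff_lt (show (0:ℝ) ≤ y - ρ by linarith) hyl.le).1
    (by linarith)
  have l2 : yl < y := ((wn_strictMono hU).lt_iff_lt hyl.le hy.le).1 (by linarith)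
  have k1 : yr < y + ρ := ((wn_strictMono hU).lt_iff_lt hyr.le (show (0:ℝ) ≤ y + ρ by linarith)).1
    (by linarith)
  have k2 : y < yr := ((wn_strictMono hU).lt_iff_lt hy.le hyr.le).1 (by linarith)
  have el : U y / 2 - d = U yl / 2 := by linarith
  have er : U y / 2 + d = U yr / 2 := by linarith
  have hyl0 : iteratedDeriv 2 U yl ≠ 0 :=
    hiso yl (by rw [abs_lt]; constructor <;> linarith) l2.ne
  have hyr0 : iteratedDeriv 2 U yr ≠ 0 :=
    hiso yr (by rw [abs_lt]; constructor <;> linarith) k2.ne'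
  have hsmall : ∀ᶠ η in nhdsWithin (0:ℝ) (Ioi 0), η < ε / 2 :=
    nhdsWithin_le_nhds (gt_mem_nhds (by positivity))
  filter_upwards [self_mem_nhdsWithin, hsmall, wn_im_ev hU γ hyl hyl0, wn_im_ev hU γ hyr hyr0]
    with η hη hηε h1 h2
  have hη : 0 < η := hη
  refine wnP_neg (fun x => wnKb_deriv hU γ hη x) (wnKb'_cont hU hη) (by linarith) ?_ ?_ ?_ ?_
  · intro x hx
    refine hεP ?_ (by change 0 < (wnpt η x).im; rwa [wnpt_im])
    rw [dist_eq_norm]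
    refine (Complex.norm_le_abs_re_add_abs_im _).trans_lt ?_
    rw [Complex.sub_re, Complex.sub_im, wnpt_re, wnpt_im, Complex.ofReal_re, Complex.ofReal_im,
      sub_zero, abs_of_pos hη]
    have : |2 * x - U y| ≤ 2 * d := by
      rw [abs_le]; constructor <;> linarith [hx.1, hx.2]
    linarith
  · rw [el]; exact h1.1
  · rw [er]; exact h2.1
  · rw [el, er, h1.2, h2.2]
    unfold wnν
    rcases hL with hL | hL <;> rcases hR with hR | hR
    · rw [if_pos (hL yl ⟨l1, l2⟩), if_pos (hR yr ⟨k2, k1⟩), if_neg, if_neg]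
      · simp
      · rintro ⟨δ, hδ, h, -⟩; exact wn_contra hρ hδ (Or.inl ⟨hL, h⟩)
      · rintro ⟨δ, hδ, -, h⟩; exact wn_contra hρ hδ (Or.inr ⟨hR, h⟩)
    · rw [if_pos (hL yl ⟨l1, l2⟩), if_neg (not_lt.2 (hR yr ⟨k2, k1⟩).le), if_pos ⟨ρ, hρ, hL, hR⟩, if_neg]
      · simp
      · rintro ⟨δ, hδ, h, -⟩; exact wn_contra hρ hδ (Or.inl ⟨hL, h⟩)
    · rw [if_neg (not_lt.2 (hL yl ⟨l1, l2⟩).le), if_pos (hR yr ⟨k2, k1⟩), if_neg, if_pos ⟨ρ, hρ, hL, hR⟩]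
      · simp
      · rintro ⟨δ, hδ, h, -⟩; exact wn_contra hδ hρ (Or.inl ⟨h, hL⟩)
    · rw [if_neg (not_lt.2 (hL yl ⟨l1, l2⟩).le), if_neg (not_lt.2 (hR yr ⟨k2, k1⟩).le), if_neg, if_neg]
      · simp
      · rintro ⟨δ, hδ, -, h⟩; exact wn_contra hδ hρ (Or.inr ⟨h, hR⟩)
      · rintro ⟨δ, hδ, h, -⟩; exact wn_contra hδ hρ (Or.inl ⟨h, hL⟩)

/-- the bottom segment -/
lemma wn_bottom {U : ℝ → ℝ} (hU : AdmissibleShearFlow U) {γ : ℝ} (hξ : xiEq U γ = 0) :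
    ∀ᶠ η in nhdsWithin (0:ℝ) (Ioi 0), wnP (wnKb U γ η) (wnKb' U η) 0 (1/2)
      ((xiMinus U γ : ℤ) - (xiPlus U γ : ℤ)) := by
  classical
  have hγ : ∀ y, 0 < y → iteratedDeriv 2 U y = 0 → chiAbscissa U y ≠ γ := by
    intro y h1 h2 h3
    have hf : {y : ℝ | 0 < y ∧ iteratedDeriv 2 U y = 0 ∧ chiAbscissa U y = γ}.Finite :=
      hU.finite_inflexions.subset fun y hy => ⟨hy.1, hy.2.1⟩
    unfold xiEq at hξ
    rw [Set.ncard_eq_zero hf] at hξ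
    have : y ∈ {y : ℝ | 0 < y ∧ iteratedDeriv 2 U y = 0 ∧ chiAbscissa U y = γ} := ⟨h1, h2, h3⟩
    rw [hξ] at this
    exact this
  have hfin : {y : ℝ | 0 < y ∧ iteratedDeriv 2 U y = 0 ∧ chiAbscissa U y < γ}.Finite :=
    hU.finite_inflexions.subset fun y hy => ⟨hy.1, hy.2.1⟩
  set Y : Finset ℝ := hfin.toFinset with hY
  have hYm : ∀ y, y ∈ Y ↔ 0 < y ∧ iteratedDeriv 2 U y = 0 ∧ chiAbscissa U y < γ := by
    intro y; rw [hY, Set.Finite.mem_toFinset]; rfl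
  set Z : Finset ℝ := Y.image (fun y => U y / 2) with hZ
  have hZI : ∀ z ∈ Z, 0 < z ∧ z < 1/2 := by
    intro z hz
    obtain ⟨y, hy, rfl⟩ := Finset.mem_image.1 hz
    have := wn_U_mem hU ((hYm y).1 hy).1
    exact ⟨by linarith [this.1], by linarith [this.2]⟩
  have hmain := wnP_global (K := fun η => wnKb U γ η) (K' := fun η => wnKb' U η)
    (fun η hη x => wnKb_deriv hU γ hη x) (fun η hη => wnKb'_cont hU hη) Z
    (fun z => wnν U (shearInv U (2 * z)))
    (fun x hx hxZ => wn_H1 hU hγ hx (fun y h1 h2 h3 h4 =>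
      hxZ (Finset.mem_image.2 ⟨y, (hYm y).2 ⟨h1, h2, h3⟩, h4⟩)))
    (by
      intro z hz
      obtain ⟨y, hy, rfl⟩ := Finset.mem_image.1 hz
      have h := (hYm y).1 hy
      have e : shearInv U (2 * (U y / 2)) = y := by
        rw [mul_div_cancel₀ _ (two_ne_zero)]; exact wn_inv_U hU h.1.le
      simp only [e]
      exact wn_H2 hU h.1 h.2.1 h.2.2)
    _ 0 (1/2) rfl le_rfl (by norm_num) le_rfl (fun h => (hZI _ h).1.ne rfl)
    (fun h => (hZI _ h).2.ne rfl)
  have hfil : Z.filter (fun z => 0 < z ∧ z < 1/2) = Z := Finset.filter_true_of_mem hZI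
  rw [hfil] at hmain
  have hsum : ∑ z ∈ Z, wnν U (shearInv U (2 * z)) = (xiMinus U γ : ℤ) - (xiPlus U γ : ℤ) := by
    rw [hZ, Finset.sum_image]
    · have : ∀ y ∈ Y, wnν U (shearInv U (2 * (U y / 2))) = wnν U y := by
        intro y hy
        rw [mul_div_cancel₀ _ (two_ne_zero), wn_inv_U hU ((hYm y).1 hy).1.le]
      rw [Finset.sum_congr rfl this]
      unfold wnν
      rw [Finset.sum_sub_distrib, Finset.sum_boole, Finset.sum_boole]
      unfold xiMinus xiPlus
      congr 2
      · rw [← Set.ncard_coe_finset]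
        congr 1
        ext y
        simp only [Finset.coe_filter, hYm, mem_ofPred_eq, and_assoc]
      · rw [← Set.ncard_coe_finset]
        congr 1
        ext y
        simp only [Finset.coe_filter, hYm, mem_ofPred_eq, and_assoc]
    · intro y hy w hw hyw
      have h1 := (hYm y).1 hy
      have h2 := (hYm w).1 hw
      exact (wn_strictMono hU).injOn h1.1.le h2.1.le (by
        have : U y / 2 = U w / 2 := hyw
        linarith)
  rw [hsum] at hmain
  exact hmain

end PartC2

section PartC3

lemma wn_congr {f g : ℝ → ℂ} {a b : ℝ} (hab : a ≤ b) (h : EqOn f g (Ioo a b))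
    (hg : IntervalIntegrable g volume a b) :
    IntervalIntegrable f volume a b ∧ ∫ x in a..b, f x = ∫ x in a..b, g x := by
  constructor
  · rw [intervalIntegrable_iff_integrableOn_Ioo_of_le hab] at hg ⊢
    exact hg.congr_fun h.symm measurableSet_Ioo
  · rw [intervalIntegral.integral_of_le hab, intervalIntegral.integral_of_le hab,
      integral_Ioc_eq_integral_Ioo, integral_Ioc_eq_integral_Ioo]
    exact setIntegral_congr_fun measurableSet_Ioo h

/-- the arc -/
noncomputable def wnarc (η t : ℝ) : ℂ := (1/2 : ℂ) + (η : ℂ) * Complex.I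
    + (1/2 : ℂ) * Complex.exp (((Real.pi * (2*t - 1) : ℝ)) * Complex.I)

lemma wnarc_re (η t : ℝ) : (wnarc η t).re = 1/2 + 1/2 * Real.cos (Real.pi * (2*t - 1)) := by
  unfold wnarc
  have h1 : (1/2 : ℂ) = ((1/2 : ℝ) : ℂ) := by push_cast; ring
  rw [h1, Complex.add_re, Complex.add_re, Complex.re_ofReal_mul, Complex.re_ofReal_mul, Complex.exp_ofReal_mul_I_re]
  simp

lemma wnarc_im (η t : ℝ) : (wnarc η t).im = η + 1/2 * Real.sin (Real.pi * (2*t - 1)) := by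
  unfold wnarc
  have h1 : (1/2 : ℂ) = ((1/2 : ℝ) : ℂ) := by push_cast; ring
  rw [h1, Complex.add_im, Complex.add_im, Complex.im_ofReal_mul, Complex.im_ofReal_mul, Complex.exp_ofReal_mul_I_im]
  simp

lemma wnarc_sin {t : ℝ} (ht : t ∈ Icc (1/2:ℝ) 1) : 0 ≤ Real.sin (Real.pi * (2*t - 1)) := by
  have := Real.pi_pos
  apply Real.sin_nonneg_of_nonneg_of_le_pi
  · exact mul_nonneg this.le (by linarith [ht.1])
  · nlinarith [ht.2]

lemma wnarc_half (η : ℝ) : wnarc η (1/2) = wnpt η (1/2) := by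
  unfold wnarc wnpt; norm_num; ring

lemma wnarc_one (η : ℝ) : wnarc η 1 = wnpt η 0 := by
  unfold wnarc wnpt
  have : (2 * 1 - 1 : ℝ) = 1 := by norm_num
  rw [this, mul_one, Complex.exp_pi_mul_I]; norm_num

noncomputable def wnarc' (t : ℝ) : ℂ := (Real.pi : ℂ) * Complex.I *
  Complex.exp (((Real.pi * (2*t - 1) : ℝ)) * Complex.I)

lemma wnarc_deriv (η t : ℝ) : HasDerivAt (wnarc η) (wnarc' t) t := by
  unfold wnarc wnarc'
  have h0 : HasDerivAt (fun t : ℝ => Real.pi * (2 * t - 1)) (Real.pi * (2 * 1)) t :=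
    (((hasDerivAt_id t).const_mul 2).sub_const 1).const_mul Real.pi
  have h1 := (wn_ofReal h0).mul_const Complex.I
  have h2 := ((h1.cexp).const_mul (1/2:ℂ)).const_add ((1/2 : ℂ) + (η : ℂ) * Complex.I)
  refine h2.congr_deriv ?_
  push_cast; ring

lemma wnarc_cont (η : ℝ) : Continuous (wnarc η) :=
  continuous_iff_continuousAt.2 fun t => (wnarc_deriv η t).continuousAt

lemma wnarc'_cont : Continuous wnarc' := by unfold wnarc'; fun_prop

lemma wnarc_pos {η : ℝ} (hη : 0 < η) {t : ℝ} (ht : t ∈ Icc (1/2:ℝ) 1) : 0 < (wnarc η t).im := by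
  rw [wnarc_im]; have := wnarc_sin ht; linarith

noncomputable def wnKa (U : ℝ → ℝ) (γ η x : ℝ) : ℂ := PhiInv U (wnarc η x) - (γ : ℂ)
noncomputable def wnKa' (U : ℝ → ℝ) (η x : ℝ) : ℂ := deriv (PhiInv U) (wnarc η x) * wnarc' x

lemma wnKa_deriv {U : ℝ → ℝ} (hU : AdmissibleShearFlow U) (γ : ℝ) {η : ℝ} (hη : 0 < η) {x : ℝ}
    (hx : x ∈ Icc (1/2:ℝ) 1) : HasDerivAt (wnKa U γ η) (wnKa' U η x) x := by
  unfold wnKa wnKa'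
  have h1 := (wn_Phi_diff hU (wnarc_pos hη hx)).hasDerivAt
  exact (h1.comp x (wnarc_deriv η x)).sub_const _

lemma wnKa'_cont {U : ℝ → ℝ} (hU : AdmissibleShearFlow U) {η : ℝ} (hη : 0 < η) :
    ContinuousOn (wnKa' U η) (Icc (1/2:ℝ) 1) := by
  unfold wnKa'
  exact ((wn_Phi_deriv_cont hU).comp (wnarc_cont η).continuousOn
    (fun x hx => wnarc_pos hη hx)).mul wnarc'_cont.continuousOn

lemma wnKa_im {U : ℝ → ℝ} (hU : AdmissibleShearFlow U) (γ : ℝ) {η : ℝ} (hη : 0 < η) {x : ℝ}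
    (hx : x ∈ Icc (1/2:ℝ) 1) : (wnKa U γ η x).im < 0 := by
  unfold wnKa
  rw [Complex.sub_im, Complex.ofReal_im, sub_zero]
  apply wn_im_neg hU (wnarc_pos hη hx)
  · rw [wnarc_re]; linarith [Real.cos_le_one (Real.pi * (2*x - 1))]
  · rw [wnarc_re, wnarc_im]
    have := wnarc_sin hx
    have h2 := Real.sin_sq_add_cos_sq (Real.pi * (2*x - 1))
    nlinarith [mul_nonneg hη.le this, sq_pos_of_pos hη]

lemma wnKa_int {U : ℝ → ℝ} (hU : AdmissibleShearFlow U) (γ : ℝ) {η : ℝ} (hη : 0 < η) :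
    IntervalIntegrable (fun x => wnKa' U η x / wnKa U γ η x) volume (1/2) 1 := by
  apply ContinuousOn.intervalIntegrable
  rw [uIcc_of_le (by norm_num)]
  refine (wnKa'_cont hU hη).div (fun x hx => (wnKa_deriv hU γ hη hx).continuousAt.continuousWithinAt)
    fun x hx h => ?_
  have := wnKa_im hU γ hη hx
  rw [h] at this; simp at this

lemma wn_wind_eq {U : ℝ → ℝ} (hU : AdmissibleShearFlow U) (γ : ℝ) {η : ℝ} (hη : 0 < η)
    (hb : ∀ x ∈ Icc (0:ℝ) (1/2), wnKb U γ η x ≠ 0) :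
    windingNumber (fun t => PhiInv U (Ceta η t)) (γ : ℂ) =
      (((2 * Real.pi : ℝ) : ℂ) * Complex.I)⁻¹ *
      ((∫ x in (0:ℝ)..(1/2), wnKb' U η x / wnKb U γ η x)
        + ∫ x in (1/2:ℝ)..1, wnKa' U η x / wnKa U γ η x) := by
  have hKbc : Continuous (wnKb U γ η) :=
    continuous_iff_continuousAt.2 fun x => (wnKb_deriv hU γ hη x).continuousAt
  have h1 := wn_congr (f := fun t => deriv (fun t => PhiInv U (Ceta η t)) t / (PhiInv U (Ceta η t) - γ))
    (a := 0) (b := 1/2) (by norm_num) (fun t ht => by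
      have e : (fun t => PhiInv U (Ceta η t)) =ᶠ[nhds t] fun t => wnKb U γ η t + γ := by
        filter_upwards [gt_mem_nhds ht.2] with s hs
        unfold wnKb Ceta wnpt
        rw [if_pos hs.le]; ring
      have e2 := e.eq_of_nhds
      simp only at e2 ⊢
      rw [e.deriv_eq, e2, ((wnKb_deriv hU γ hη t).add_const (γ:ℂ)).deriv]
      rw [add_sub_cancel_right])
    (wnP_int hKbc (wnKb'_cont hU hη) (by norm_num) hb)
  have h2 := wn_congr (f := fun t => deriv (fun t => PhiInv U (Ceta η t)) t / (PhiInv U (Ceta η t) - γ))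
    (a := 1/2) (b := 1) (by norm_num) (fun t ht => by
      have e : (fun t => PhiInv U (Ceta η t)) =ᶠ[nhds t] fun t => wnKa U γ η t + γ := by
        filter_upwards [lt_mem_nhds ht.1] with s hs
        unfold wnKa Ceta wnarc
        rw [if_neg (not_le.2 hs)]; ring
      have e2 := e.eq_of_nhds
      simp only at e2 ⊢
      rw [e.deriv_eq, e2, ((wnKa_deriv hU γ hη (Ioo_subset_Icc_self ht)).add_const (γ:ℂ)).deriv]
      rw [add_sub_cancel_right])
    (wnKa_int hU γ hη)
  unfold windingNumber
  rw [← intervalIntegral.integral_add_adjacent_intervals h1.1 h2.1, h1.2, h2.2]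

lemma wn_wind {U : ℝ → ℝ} (hU : AdmissibleShearFlow U) (γ : ℝ) {η : ℝ} (hη : 0 < η) {n : ℤ}
    (hb : wnP (wnKb U γ η) (wnKb' U η) 0 (1/2) n) :
    windingNumber (fun t => PhiInv U (Ceta η t)) (γ : ℂ) = (n : ℂ) := by
  rw [wn_wind_eq hU γ hη hb.1, hb.2]
  rw [intervalIntegral.integral_eq_sub_of_hasDerivAt (f := fun x => Complex.log (wnKa U γ η x))
    (fun x hx => ?_) (wnKa_int hU γ hη)]
  · have e1 : wnKa U γ η 1 = wnKb U γ η 0 := by unfold wnKa wnKb; rw [wnarc_one]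
    have e2 : wnKa U γ η (1/2) = wnKb U γ η (1/2) := by unfold wnKa wnKb; rw [wnarc_half]
    rw [e1, e2]
    have : (Real.pi : ℂ) ≠ 0 := by exact_mod_cast Real.pi_ne_zero
    have hI := Complex.I_ne_zero
    push_cast
    field_simp
    ring
  · rw [uIcc_of_le (by norm_num)] at hx
    refine (wnKa_deriv hU γ hη hx).clog_real ?_
    rw [Complex.mem_slitPlane_iff]
    exact Or.inr (wnKa_im hU γ hη hx).ne

lemma wn_root {U : ℝ → ℝ} (hU : AdmissibleShearFlow U) (γ : ℝ) {η η₁ : ℝ} (hη : 0 < η)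
    (hlt : η < η₁) {n : ℤ} (hn : n ≠ 0)
    (hb : wnP (wnKb U γ η₁) (wnKb' U η₁) 0 (1/2) n) :
    ∃ μ : ℂ, η < μ.im ∧ PhiInv U μ = (γ : ℂ) := by
  by_contra hcon
  push Not at hcon
  have hη₁ : 0 < η₁ := hη.trans hlt
  set δ : ℝ := η₁ - η with hδ
  have hδ0 : 0 < δ := by rw [hδ]; linarith
  set R : ℝ := 1 / δ + δ + 1 with hR
  have hR1 : δ + 1 < R := by
    have : 0 < 1 / δ := by positivity
    rw [hR]; linarith
  have hR2 : 1 < R * δ := by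
    have : R * δ = 1 + δ * δ + δ := by rw [hR]; field_simp
    rw [this]; nlinarith
  set c : ℂ := ((1/2 : ℝ) : ℂ) + ((η + R : ℝ) : ℂ) * Complex.I with hc
  have hcre : c.re = 1/2 := by simp [hc]
  have hcim : c.im = η + R := by simp [hc]
  have hball : ∀ z ∈ Metric.ball c R, η < z.im := by
    intro z hz
    rw [Metric.mem_ball, dist_eq_norm] at hz
    have := (Complex.abs_im_le_norm (z - c)).trans_lt hz
    rw [Complex.sub_im, hcim, abs_lt] at this
    linarith [this.1]
  have hmem : ∀ z : ℂ, |z.re - 1/2| ≤ 1/2 → η₁ ≤ z.im → z.im ≤ η₁ + 1/2 → z ∈ Metric.ball c R := by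
    intro z h1 h2 h3
    rw [Metric.mem_ball, dist_eq_norm, ← sq_lt_sq₀ (norm_nonneg _) (by linarith),
      ← Complex.normSq_eq_norm_sq, Complex.normSq_apply, Complex.sub_re, Complex.sub_im, hcre, hcim]
    have h4 : (z.re - 1/2) * (z.re - 1/2) ≤ 1/4 := by
      have := abs_le.1 h1
      nlinarith
    set v := z.im - η with hv
    have e : z.im - (η + R) = v - R := by rw [hv]; ring
    have v1 : δ ≤ v := by rw [hv, hδ]; linarith
    have v2 : v ≤ δ + 1/2 := by rw [hv, hδ]; linarith
    rw [e]
    nlinarith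
  have hdiff : DifferentiableOn ℂ (fun z => deriv (PhiInv U) z / (PhiInv U z - γ)) (Metric.ball c R) := by
    have hsub : Metric.ball c R ⊆ {z : ℂ | 0 < z.im} := fun z hz => hη.trans (hball z hz)
    refine DifferentiableOn.div (((wn_Phi_diffOn hU).deriv wn_upper_open).mono hsub)
      (((wn_Phi_diffOn hU).mono hsub).sub_const _) ?_
    intro z hz
    rw [sub_ne_zero]
    exact hcon z (hball z hz)
  obtain ⟨F, hF⟩ := hdiff.isExactOn_ball
  have hw := wn_wind hU γ hη₁ hb
  rw [wn_wind_eq hU γ hη₁ hb.1] at hw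
  have hKbc : Continuous (wnKb U γ η₁) :=
    continuous_iff_continuousAt.2 fun x => (wnKb_deriv hU γ hη₁ x).continuousAt
  rw [intervalIntegral.integral_eq_sub_of_hasDerivAt (f := fun x => F (wnpt η₁ x))
    (fun x hx => ?_) (wnP_int hKbc (wnKb'_cont hU hη₁) (by norm_num) hb.1),
    intervalIntegral.integral_eq_sub_of_hasDerivAt (f := fun x => F (wnarc η₁ x))
    (fun x hx => ?_) (wnKa_int hU γ hη₁), wnarc_half, wnarc_one] at hw
  · apply hn
    have : (n:ℂ) = 0 := by rw [← hw]; ring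
    exact_mod_cast this
  · rw [uIcc_of_le (by norm_num)] at hx
    have h1 := hF (wnarc η₁ x) (hmem _ ?_ ?_ ?_)
    · refine (h1.comp x (wnarc_deriv η₁ x)).congr_deriv ?_
      unfold wnKa' wnKa; ring
    · rw [wnarc_re, abs_le]
      constructor <;> linarith [Real.cos_le_one (Real.pi * (2*x - 1)),
        Real.neg_one_le_cos (Real.pi * (2*x - 1))]
    · rw [wnarc_im]; linarith [wnarc_sin hx]
    · rw [wnarc_im]; linarith [Real.sin_le_one (Real.pi * (2*x - 1))]
  · rw [uIcc_of_le (by norm_num)] at hx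
    have h1 := hF (wnpt η₁ x) (hmem _ ?_ ?_ ?_)
    · refine (h1.comp x (wnpt_deriv η₁ x)).congr_deriv ?_
      unfold wnKb' wnKb; ring
    · rw [wnpt_re, abs_le]
      constructor <;> linarith [hx.1, hx.2]
    · rw [wnpt_im]
    · rw [wnpt_im]; linarith

end PartC3

/-- Proposition (winding number of `Φ_inv(C_η)` around `γ` and existence of roots). -/
theorem winding_number_roots (U : ℝ → ℝ) (hU : AdmissibleShearFlow U)
    (γ : ℝ) (hγ : 0 ≤ γ) (hξ : xiEq U γ = 0) :
    ∃ η₀ : ℝ, 0 < η₀ ∧ ∀ η : ℝ, 0 < η → η ≤ η₀ →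
      windingNumber (fun t => PhiInv U (Ceta η t)) (γ : ℂ)
          = (((xiMinus U γ : ℤ) - (xiPlus U γ : ℤ) : ℤ) : ℂ) ∧
      (xiPlus U γ < xiMinus U γ →
        ∃ μ : ℂ, η < μ.im ∧ PhiInv U μ = (γ : ℂ)) := by
  obtain ⟨η₁, hη₁, h⟩ := mem_nhdsGT_iff_exists_Ioc_subset.1 (wn_bottom hU hξ)
  have hη₁ : 0 < η₁ := hη₁
  refine ⟨η₁ / 2, by positivity, fun η hη hle => ⟨?_, fun hlt => ?_⟩⟩
  · exact wn_wind hU γ hη (h ⟨hη, by linarith⟩)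
  · refine wn_root hU γ hη (by linarith : η < η₁) ?_ (h ⟨hη₁, le_rfl⟩)
    omega

end
end

section
/- Let U_s be an admissible shear flow with U_s''(0) > 0 and decay exponent κ ∈ (0, 1/2). There exist d > 0 and γ₋ > 0 such that for every γ ≥ γ₋ there exists η(γ) ≥ d γ⁻² such that the winding number of the closed curve Φ_inv ∘ C_{η(γ)} around γ equals 1, and the distance from γ to the image of Φ_inv ∘ C_{η(γ)} is at least d γ^{−2κ}. -/
open MeasureTheory Filter Set

noncomputable section

namespace WPR

/-- weighted curvature of the profile, first normalisation -/
def gt (U : ℝ → ℝ) (y : ℝ) : ℝ := (1 - U y) ^ 2 * iteratedDeriv 2 U y / (deriv U y) ^ 2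

/-- weighted curvature of the profile, second normalisation -/
def gh (U : ℝ → ℝ) (y : ℝ) : ℝ := (1 - U y) ^ 2 * iteratedDeriv 2 U y / (deriv U y) ^ 3

/-- Cauchy-type integral -/
def Psi (U : ℝ → ℝ) (μ : ℂ) : ℂ := ∫ y in Ioi (0:ℝ), (gt U y : ℂ) * ((U y : ℂ) - μ)⁻¹

variable {U : ℝ → ℝ}

lemma hd1 (hU : AdmissibleShearFlow U) (y : ℝ) : HasDerivAt U (deriv U y) y :=
  ((hU.smooth.differentiable (by simp)) y).hasDerivAt

lemma hd2 (hU : AdmissibleShearFlow U) (y : ℝ) :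
    HasDerivAt (deriv U) (iteratedDeriv 2 U y) y := by
  have h := hU.smooth.differentiable_iteratedDeriv 1 (by exact_mod_cast ENat.natCast_lt_top 1)
  rw [iteratedDeriv_succ]
  rw [iteratedDeriv_one] at *
  exact (h y).hasDerivAt

lemma cU (hU : AdmissibleShearFlow U) : Continuous U := hU.smooth.continuous

lemma cV (hU : AdmissibleShearFlow U) : Continuous (deriv U) :=
  continuous_iff_continuousAt.2 fun y => (hd2 hU y).continuousAt

lemma cW (hU : AdmissibleShearFlow U) : Continuous (iteratedDeriv 2 U) :=
  hU.smooth.continuous_iteratedDeriv 2 (WithTop.coe_le_coe.2 (le_top : ((2:ℕ):ℕ∞) ≤ ⊤))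

lemma mono (hU : AdmissibleShearFlow U) : StrictMonoOn U (Ici 0) := by
  apply strictMonoOn_of_deriv_pos (convex_Ici 0) (cU hU).continuousOn
  intro x hx
  rw [interior_Ici] at hx
  exact hU.deriv_pos x (le_of_lt hx)

lemma gt_eq (hU : AdmissibleShearFlow U) {y : ℝ} (hy : 0 ≤ y) : gt U y = gh U y * deriv U y := by
  have := (hU.deriv_pos y hy).ne'
  unfold gt gh
  field_simp

lemma cgh (hU : AdmissibleShearFlow U) : ContinuousOn (gh U) (Ici 0) := by
  unfold gh
  apply ContinuousOn.div
  · exact (((continuous_const.sub (cU hU)).pow 2).mul (cW hU)).continuousOn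
  · exact ((cV hU).pow 3).continuousOn
  · intro y hy
    exact pow_ne_zero _ (hU.deriv_pos y hy).ne'

lemma int_gt (hU : AdmissibleShearFlow U) : IntegrableOn (gt U) (Ioi 0) := hU.decay_ratio₃

lemma sub_ne {μ : ℂ} (hμ : 0 < μ.im) (x : ℝ) : (x : ℂ) - μ ≠ 0 := by
  intro h
  have := congrArg Complex.im h
  simp at this
  exact hμ.ne' this

lemma norm_sub_ge {μ : ℂ} (x : ℝ) : μ.im ≤ ‖(x : ℂ) - μ‖ := by
  have := Complex.abs_im_le_norm ((x : ℂ) - μ)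
  simp at this
  exact (le_abs_self _).trans this

lemma norm_inv_le {μ : ℂ} (hμ : 0 < μ.im) (x : ℝ) : ‖((x : ℂ) - μ)⁻¹‖ ≤ (μ.im)⁻¹ := by
  rw [norm_inv]
  exact inv_anti₀ hμ (norm_sub_ge x)

lemma c_inv (hU : AdmissibleShearFlow U) {μ : ℂ} (hμ : 0 < μ.im) :
    Continuous (fun y => ((U y : ℂ) - μ)⁻¹) := by
  apply Continuous.inv₀
  · exact (Complex.continuous_ofReal.comp (cU hU)).sub continuous_const
  · intro y; exact sub_ne hμ _

lemma int_psi (hU : AdmissibleShearFlow U) {μ : ℂ} (hμ : 0 < μ.im) :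
    IntegrableOn (fun y => (gt U y : ℂ) * ((U y : ℂ) - μ)⁻¹) (Ioi 0) := by
  apply Integrable.mul_bdd (c := (μ.im)⁻¹)
  · exact (int_gt hU).ofReal
  · exact (c_inv hU hμ).aestronglyMeasurable
  · exact Eventually.of_forall fun y => norm_inv_le hμ _

lemma int_srcF (hU : AdmissibleShearFlow U) : IntegrableOn (srcF U) (Ioi 0) := by
  have h1 := hU.integrable_defect
  have h2 : IntegrableOn (fun y => y * deriv U y) (Ioi 0) := by
    apply integrableOn_Ioi_deriv_of_nonneg (g := fun y => (∫ x in (0:ℝ)..y, (1 - U x)) - y * (1 - U y))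
      (l := (∫ y in Ioi (0:ℝ), (1 - U y)) - 0)
    · apply Continuous.continuousWithinAt
      apply Continuous.sub
      · exact intervalIntegral.continuous_primitive
          (fun a b => (continuous_const.sub (cU hU)).intervalIntegrable a b) 0
      · exact continuous_id.mul (continuous_const.sub (cU hU))
    · intro x _
      have c : Continuous (fun x => 1 - U x) := continuous_const.sub (cU hU)
      have e1 : HasDerivAt (fun y => ∫ x in (0:ℝ)..y, (1 - U x)) (1 - U x) x :=
        c.integral_hasStrictDerivAt 0 x |>.hasDerivAt
      have e2 : HasDerivAt (fun y => y * (1 - U y)) (1 * (1 - U x) + x * (0 - deriv U x)) x :=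
        (hasDerivAt_id x).mul ((hasDerivAt_const x 1).sub (hd1 hU x))
      refine (e1.sub e2).congr_deriv ?_
      ring
    · intro x hx
      exact mul_nonneg (le_of_lt hx) (hU.deriv_pos x (le_of_lt hx)).le
    · exact (intervalIntegral_tendsto_integral_Ioi 0 h1 tendsto_id).sub hU.decay_ratio₂
  exact h1.add h2

lemma phi_repr (hU : AdmissibleShearFlow U) {μ : ℂ} (hμ : 0 < μ.im) :
    PhiInv U μ = (μ * ((deriv U 0 : ℝ) : ℂ))⁻¹ + Psi U μ := by
  have hne : ∀ y, μ - (U y : ℂ) ≠ 0 := fun y h => sub_ne hμ (U y) (by linear_combination -h)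
  have hinv : ∀ y, (μ - (U y : ℂ))⁻¹ = - ((U y : ℂ) - μ)⁻¹ := by
    intro y; rw [← neg_sub, inv_neg]
  have i1 : IntegrableOn (fun y => (srcF U y : ℂ) / (μ - (U y : ℂ)) ^ 2) (Ioi 0) := by
    have : IntegrableOn (fun y => (srcF U y : ℂ) * (((U y : ℂ) - μ)⁻¹)^2) (Ioi 0) := by
      apply Integrable.mul_bdd (c := ((μ.im)⁻¹)^2)
      · exact (int_srcF hU).ofReal
      · exact ((c_inv hU hμ).pow 2).aestronglyMeasurable
      · refine Eventually.of_forall fun y => ?_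
        rw [norm_pow]
        exact pow_le_pow_left₀ (norm_nonneg _) (norm_inv_le hμ _) 2
    refine this.congr_fun (fun y _ => ?_) measurableSet_Ioi
    simp only [div_eq_mul_inv, ← inv_pow, hinv]; ring
  have i2 := int_psi hU hμ
  have i3 : IntegrableOn (fun y => (μ - 1) * ((srcF U y : ℂ) / (μ - (U y : ℂ)) ^ 2)
      - (gt U y : ℂ) * ((U y : ℂ) - μ)⁻¹) (Ioi 0) := by
    exact Integrable.sub (i1.const_mul (μ - 1)) i2
  have key := integral_Ioi_of_hasDerivAt_of_tendsto (a := 0) (m := 0)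
    (f := fun y => ((y * (1 - U y) + (1 - U y)^2 / deriv U y : ℝ) : ℂ) * ((U y : ℂ) - μ)⁻¹)
    (f' := fun y => (μ - 1) * ((srcF U y : ℂ) / (μ - (U y : ℂ)) ^ 2)
      - (gt U y : ℂ) * ((U y : ℂ) - μ)⁻¹) ?_ ?_ i3 ?_
  · rw [integral_sub (i1.const_mul (μ - 1)) i2, integral_const_mul] at key
    unfold PhiInv Psi
    rw [sub_eq_iff_eq_add] at key
    rw [key, hU.zero_val]
    simp only [mul_inv]
    push_cast
    have : deriv U 0 ≠ 0 := (hU.deriv_pos 0 le_rfl).ne'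
    simp
    ring
  · apply ContinuousAt.continuousWithinAt
    apply ContinuousAt.mul _ (c_inv hU hμ).continuousAt
    apply Complex.continuous_ofReal.continuousAt.comp
    have c : Continuous (fun x => 1 - U x) := continuous_const.sub (cU hU)
    exact ((continuous_id.mul c).continuousAt).add
      ((c.pow 2).continuousAt.div (cV hU).continuousAt (hU.deriv_pos 0 le_rfl).ne')
  · intro y hy
    have hV := (hU.deriv_pos y (le_of_lt hy)).ne'
    have e0 := (hasDerivAt_const y (1:ℝ)).sub (hd1 hU y)
    have e1 := ((hasDerivAt_id y).mul e0).add ((e0.pow 2).div (hd2 hU y) hV)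
    have e2 := ((hd1 hU y).ofReal_comp.sub_const μ).inv (sub_ne hμ _)
    have e3 := e1.ofReal_comp.mul e2
    refine e3.congr_deriv ?_
    simp [srcF, gt]
    have h1 := hne y
    have h2 := sub_ne hμ (U y)
    have hV' : ((deriv U y : ℝ) : ℂ) ≠ 0 := by exact_mod_cast hV
    have h3 : μ - (U y : ℂ) = -((U y : ℂ) - μ) := by ring
    rw [h3]
    field_simp
    ring
  · apply tendsto_zero_iff_norm_tendsto_zero.2
    have h0 := (hU.decay_ratio₂.add hU.decay_ratio₁).norm.mul_const (μ.im)⁻¹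
    simp only [add_zero, norm_zero, zero_mul] at h0
    refine squeeze_zero (fun _ => norm_nonneg _) (fun y => ?_) h0
    rw [norm_mul, Complex.norm_real]
    exact mul_le_mul_of_nonneg_left (norm_inv_le hμ _) (norm_nonneg _)

lemma psi_diff (hU : AdmissibleShearFlow U) {μ : ℂ} (hμ : 0 < μ.im) :
    DifferentiableAt ℂ (Psi U) μ := by
  have hs : {z : ℂ | μ.im / 2 < z.im} ∈ nhds μ :=
    (isOpen_lt continuous_const Complex.continuous_im).mem_nhds (by simp; linarith)
  have := hasDerivAt_integral_of_dominated_loc_of_deriv_le (μ := volume.restrict (Ioi (0:ℝ)))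
    (F := fun μ y => (gt U y : ℂ) * ((U y : ℂ) - μ)⁻¹) (x₀ := μ)
    (F' := fun μ y => (gt U y : ℂ) * (((U y : ℂ) - μ)⁻¹)^2)
    (bound := fun y => |gt U y| * ((μ.im/2)⁻¹)^2) hs ?_ (int_psi hU hμ) ?_ ?_ ?_ ?_
  · exact this.2.differentiableAt
  · filter_upwards [hs] with z hz
    exact (int_psi hU (lt_trans (by positivity) hz)).aestronglyMeasurable
  · exact (int_gt hU).ofReal.aestronglyMeasurable.mul ((c_inv hU hμ).pow 2).aestronglyMeasurable
  · refine Eventually.of_forall fun y z hz => ?_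
    rw [norm_mul, norm_pow, Complex.norm_real, Real.norm_eq_abs]
    have hz' : μ.im/2 < z.im := hz
    gcongr
    exact (norm_inv_le (lt_trans (by positivity) hz') _).trans (inv_anti₀ (by positivity) hz'.le)
  · exact (int_gt hU).abs.mul_const _
  · refine Eventually.of_forall fun y z hz => ?_
    have hz' : 0 < z.im := lt_trans (by positivity) hz
    have h2 := sub_ne hz' (U y)
    have e := (((hasDerivAt_id z).const_sub (U y : ℂ)).inv h2).const_mul (gt U y : ℂ)
    refine e.congr_deriv ?_
    simp

lemma phi_diff (hU : AdmissibleShearFlow U) :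
    DifferentiableOn ℂ (PhiInv U) {z : ℂ | 0 < z.im} := by
  intro z hz
  have hz' : 0 < z.im := hz
  have hne : z ≠ 0 := by rintro rfl; simp at hz'
  have hl : ((deriv U 0 : ℝ) : ℂ) ≠ 0 := by exact_mod_cast (hU.deriv_pos 0 le_rfl).ne'
  have : DifferentiableWithinAt ℂ (fun μ => (μ * ((deriv U 0 : ℝ) : ℂ))⁻¹ + Psi U μ)
      {z : ℂ | 0 < z.im} z := by
    apply DifferentiableAt.differentiableWithinAt
    exact ((differentiableAt_id.mul_const _).inv (mul_ne_zero hne hl)).add (psi_diff hU hz')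
  exact this.congr (fun w hw => phi_repr hU hw) (phi_repr hU hz')

/-- Poisson-type kernel -/
def kP (U : ℝ → ℝ) (μ : ℂ) (y : ℝ) : ℝ := (((U y : ℂ) - μ)⁻¹).im

/-- norm kernel -/
def kN (U : ℝ → ℝ) (μ : ℂ) (y : ℝ) : ℝ := ‖((U y : ℂ) - μ)⁻¹‖

lemma kP_eq (U : ℝ → ℝ) (μ : ℂ) (y : ℝ) :
    kP U μ y = μ.im / ((U y - μ.re)^2 + μ.im^2) := by
  simp [kP, Complex.inv_im, Complex.normSq_apply, pow_two]

lemma kN_eq {μ : ℂ} (hμ : 0 < μ.im) (y : ℝ) :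
    kN U μ y = (√(1 + ((U y - μ.re)/μ.im)^2))⁻¹ * μ.im⁻¹ := by
  have h1 : ‖(U y : ℂ) - μ‖ = √(1 + ((U y - μ.re)/μ.im)^2) * μ.im := by
    rw [Complex.norm_eq_sqrt_sq_add_sq]
    have : 1 + ((U y - μ.re)/μ.im)^2 = ((U y - μ.re)^2 + μ.im^2) / μ.im^2 := by
      field_simp; ring
    rw [this, Real.sqrt_div (by positivity), Real.sqrt_sq hμ.le]
    simp
    field_simp
  rw [kN, norm_inv, h1, mul_inv]

lemma kP_nonneg {μ : ℂ} (hμ : 0 < μ.im) (y : ℝ) : 0 ≤ kP U μ y := by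
  rw [kP_eq]; positivity

lemma kP_le_kN {μ : ℂ} (y : ℝ) : kP U μ y ≤ kN U μ y :=
  (le_abs_self _).trans (Complex.abs_im_le_norm _)

lemma ckP (hU : AdmissibleShearFlow U) {μ : ℂ} (hμ : 0 < μ.im) : Continuous (kP U μ) :=
  Complex.continuous_im.comp (c_inv hU hμ)

lemma ckN (hU : AdmissibleShearFlow U) {μ : ℂ} (hμ : 0 < μ.im) : Continuous (kN U μ) :=
  continuous_norm.comp (c_inv hU hμ)

lemma int_kP (hU : AdmissibleShearFlow U) {μ : ℂ} (hμ : 0 < μ.im) :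
    IntegrableOn (fun y => gt U y * kP U μ y) (Ioi 0) := by
  apply Integrable.mul_bdd (c := (μ.im)⁻¹) (int_gt hU) (ckP hU hμ).aestronglyMeasurable
  exact Eventually.of_forall fun y => (Complex.abs_im_le_norm _).trans (norm_inv_le hμ _)

lemma int_kN (hU : AdmissibleShearFlow U) {μ : ℂ} (hμ : 0 < μ.im) :
    IntegrableOn (fun y => |gt U y| * kN U μ y) (Ioi 0) := by
  apply Integrable.mul_bdd (c := (μ.im)⁻¹) (int_gt hU).abs (ckN hU hμ).aestronglyMeasurable
  refine Eventually.of_forall fun y => ?_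
  rw [kN, norm_norm]
  exact norm_inv_le hμ _

lemma int_kP' (hU : AdmissibleShearFlow U) {μ : ℂ} (hμ : 0 < μ.im) :
    IntegrableOn (fun y => |gt U y| * kP U μ y) (Ioi 0) := by
  have h : IntegrableOn (fun y => |gt U y * kP U μ y|) (Ioi 0) := (int_kP hU hμ).abs
  refine h.congr_fun (fun y _ => ?_) measurableSet_Ioi
  simp only [abs_mul, abs_of_nonneg (kP_nonneg hμ y)]

lemma psi_im (hU : AdmissibleShearFlow U) {μ : ℂ} (hμ : 0 < μ.im) :
    (Psi U μ).im = ∫ y in Ioi (0:ℝ), gt U y * kP U μ y := by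
  have := Complex.imCLM.integral_comp_comm (int_psi hU hμ)
  simp only [Complex.imCLM_apply, Complex.im_ofReal_mul] at this
  exact this.symm

lemma psi_norm {μ : ℂ} : ‖Psi U μ‖ ≤ ∫ y in Ioi (0:ℝ), |gt U y| * kN U μ y := by
  refine (norm_integral_le_integral_norm _).trans (le_of_eq ?_)
  simp [kN]

lemma psi_im_abs (hU : AdmissibleShearFlow U) {μ : ℂ} (hμ : 0 < μ.im) :
    |(Psi U μ).im| ≤ ∫ y in Ioi (0:ℝ), |gt U y| * kP U μ y := by
  rw [psi_im hU hμ, ← Real.norm_eq_abs]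
  refine (norm_integral_le_integral_norm _).trans (le_of_eq ?_)
  congr 1; ext y
  rw [norm_mul, Real.norm_eq_abs, Real.norm_eq_abs, abs_of_nonneg (kP_nonneg hμ y)]

lemma split {f : ℝ → ℝ} (hf : IntegrableOn f (Ioi 0)) {Y : ℝ} (hY : 0 ≤ Y) :
    ∫ y in Ioi (0:ℝ), f y = (∫ y in (0:ℝ)..Y, f y) + ∫ y in Ioi Y, f y := by
  rw [intervalIntegral.integral_of_le hY, ← setIntegral_union (Ioc_disjoint_Ioi le_rfl)
    measurableSet_Ioi (hf.mono_set Ioc_subset_Ioi_self)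
    (hf.mono_set (Ioi_subset_Ioi hY)), Ioc_union_Ioi_eq_Ioi hY]

lemma ii {f : ℝ → ℝ} (hf : IntegrableOn f (Ioi 0)) {Y : ℝ} (hY : 0 ≤ Y) :
    IntervalIntegrable f volume 0 Y := by
  rw [intervalIntegrable_iff_integrableOn_Ioc_of_le hY]
  exact hf.mono_set Ioc_subset_Ioi_self

lemma int_VkP (hU : AdmissibleShearFlow U) {μ : ℂ} (hμ : 0 < μ.im) (x Y : ℝ) :
    ∫ y in x..Y, deriv U y * kP U μ y =
      Real.arctan ((U Y - μ.re)/μ.im) - Real.arctan ((U x - μ.re)/μ.im) := by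
  apply intervalIntegral.integral_eq_sub_of_hasDerivAt
    (f := fun y => Real.arctan ((U y - μ.re)/μ.im))
  · intro y _
    refine (((hd1 hU y).sub_const μ.re).div_const μ.im).arctan.congr_deriv ?_
    rw [kP_eq]
    have : 0 < (U y - μ.re)^2 + μ.im^2 := by positivity
    have h2 : 0 < μ.im ^ 2 + (U y - μ.re)^2 := by positivity
    field_simp
    ring
  · exact ((cV hU).mul (ckP hU hμ)).intervalIntegrable _ _

lemma int_VkN (hU : AdmissibleShearFlow U) {μ : ℂ} (hμ : 0 < μ.im) (x Y : ℝ) :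
    ∫ y in x..Y, deriv U y * kN U μ y =
      Real.arsinh ((U Y - μ.re)/μ.im) - Real.arsinh ((U x - μ.re)/μ.im) := by
  apply intervalIntegral.integral_eq_sub_of_hasDerivAt
    (f := fun y => Real.arsinh ((U y - μ.re)/μ.im))
  · intro y _
    refine (((hd1 hU y).sub_const μ.re).div_const μ.im).arsinh.congr_deriv ?_
    rw [kN_eq hμ, smul_eq_mul]
    ring
  · exact ((cV hU).mul (ckN hU hμ)).intervalIntegrable _ _

lemma gh_bdd (hU : AdmissibleShearFlow U) (Y : ℝ) :
    ∃ M : ℝ, 0 < M ∧ ∀ y ∈ Icc 0 Y, |gh U y| ≤ M := by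
  obtain ⟨M, hM⟩ := isCompact_Icc.exists_bound_of_continuousOn
    ((cgh hU).mono (Icc_subset_Ici_self : Icc 0 Y ⊆ Ici 0))
  exact ⟨max M 1, by positivity, fun y hy => (hM y hy).trans (le_max_left _ _)⟩

lemma split_bound (hU : AdmissibleShearFlow U) {k : ℝ → ℝ} (ck : Continuous k)
    (k0 : ∀ y, 0 ≤ k y) (ik : IntegrableOn (fun y => |gt U y| * k y) (Ioi 0))
    {Y M K B : ℝ} (hY : 0 ≤ Y) (hM0 : 0 ≤ M) (hM : ∀ y ∈ Icc 0 Y, |gh U y| ≤ M)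
    (hK0 : 0 ≤ K) (hK : ∀ y, Y < y → k y ≤ K)
    (hB : ∫ y in (0:ℝ)..Y, deriv U y * k y ≤ B) :
    ∫ y in Ioi (0:ℝ), |gt U y| * k y ≤ M * B + K * ∫ y in Ioi (0:ℝ), |gt U y| := by
  rw [split ik hY]
  have ia : IntegrableOn (fun y => |gt U y|) (Ioi 0) := (int_gt hU).abs
  have hY' : Ioi Y ⊆ Ioi (0:ℝ) := Ioi_subset_Ioi hY
  apply add_le_add
  · calc ∫ y in (0:ℝ)..Y, |gt U y| * k y ≤ ∫ y in (0:ℝ)..Y, M * (deriv U y * k y) := by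
          apply intervalIntegral.integral_mono_on hY (ii ik hY)
          · exact (continuous_const.mul ((cV hU).mul ck)).intervalIntegrable _ _
          · intro y hy
            have hv := (hU.deriv_pos y hy.1).le
            rw [gt_eq hU hy.1, abs_mul, abs_of_nonneg hv, mul_assoc]
            exact mul_le_mul_of_nonneg_right (hM y hy) (mul_nonneg hv (k0 y))
      _ = M * ∫ y in (0:ℝ)..Y, deriv U y * k y := intervalIntegral.integral_const_mul _ _
      _ ≤ M * B := mul_le_mul_of_nonneg_left hB hM0
  · calc ∫ y in Ioi Y, |gt U y| * k y ≤ ∫ y in Ioi Y, K * |gt U y| := by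
          apply setIntegral_mono_on (ik.mono_set hY') ((ia.mono_set hY').const_mul K)
            measurableSet_Ioi
          intro y hy
          rw [mul_comm K]
          exact mul_le_mul_of_nonneg_left (hK y hy) (abs_nonneg _)
      _ = K * ∫ y in Ioi Y, |gt U y| := integral_const_mul _ _
      _ ≤ K * ∫ y in Ioi (0:ℝ), |gt U y| := by
          apply mul_le_mul_of_nonneg_left _ hK0
          exact setIntegral_mono_set ia (Eventually.of_forall fun y => abs_nonneg _)
            hY'.eventuallyLE

lemma surj (hU : AdmissibleShearFlow U) {v : ℝ} (h0 : 0 ≤ v) (h1 : v < 1) :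
    ∃ y, 0 ≤ y ∧ U y = v := by
  obtain ⟨N, hN⟩ := ((hU.tendsto_one.eventually (lt_mem_nhds h1)).and (eventually_ge_atTop 0)).exists
  have := intermediate_value_Icc hN.2 (cU hU).continuousOn
  obtain ⟨y, hy, hy'⟩ := this ⟨by rw [hU.zero_val]; exact h0, hN.1.le⟩
  exact ⟨y, hy.1, hy'⟩

lemma arctan_abs (x : ℝ) : |Real.arctan x| ≤ Real.pi / 2 :=
  abs_le.2 ⟨(Real.neg_pi_div_two_lt_arctan x).le, (Real.arctan_lt_pi_div_two x).le⟩

lemma region_bound (hU : AdmissibleShearFlow U) {r h0 : ℝ} (hr : 0 < r) (hr1 : r < 1)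
    (hh0 : 0 < h0) :
    ∃ C : ℝ, 0 < C ∧ ∀ μ : ℂ, 0 ≤ μ.re → μ.re ≤ 1 → 0 < μ.im → (μ.re ≤ 1 - r ∨ h0 ≤ μ.im) →
      ‖Psi U μ‖ ≤ C * (1 + Real.arsinh (1 / μ.im)) ∧ |(Psi U μ).im| ≤ C := by
  obtain ⟨Y, hY, hUY⟩ := surj hU (v := 1 - r/2) (by linarith) (by linarith)
  obtain ⟨M, hM0, hM⟩ := gh_bdd hU Y
  set m := min (r/2) h0 with hm
  have hm0 : 0 < m := lt_min (by linarith) hh0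
  set I := ∫ y in Ioi (0:ℝ), |gt U y| with hI
  have hI0 : 0 ≤ I := integral_nonneg fun y => abs_nonneg _
  refine ⟨M * Real.pi + M * 2 + m⁻¹ * I, by positivity, fun μ ha0 ha1 hμ hreg => ?_⟩
  have hkN : ∀ y, Y < y → kN U μ y ≤ m⁻¹ := by
    intro y hy
    rw [kN, norm_inv]
    apply inv_anti₀ hm0
    rcases hreg with h | h
    · have h1 : U Y < U y := mono hU hY (hY.trans hy.le) hy
      have h2 := Complex.abs_re_le_norm ((U y : ℂ) - μ)
      simp at h2
      have h3 := (le_abs_self _).trans h2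
      have := min_le_left (r/2) h0
      linarith
    · have := min_le_right (r/2) h0
      have := norm_sub_ge (μ := μ) (U y)
      linarith
  have hkP : ∀ y, Y < y → kP U μ y ≤ m⁻¹ := fun y hy => (kP_le_kN y).trans (hkN y hy)
  have hIm : 0 ≤ m⁻¹ * I := by positivity
  have hars : 0 ≤ Real.arsinh (1 / μ.im) := by
    rw [Real.arsinh_nonneg_iff]; positivity
  constructor
  · have h1 := split_bound hU (ckN hU hμ) (fun y => norm_nonneg _) (int_kN hU hμ) hY hM0.le hM
      (inv_nonneg.2 hm0.le) hkN (B := 2 * Real.arsinh (1 / μ.im)) (by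
        rw [int_VkN hU hμ, hU.zero_val]
        have e1 : Real.arsinh ((U Y - μ.re)/μ.im) ≤ Real.arsinh (1/μ.im) := by
          rw [Real.arsinh_le_arsinh]; gcongr; linarith
        have e2 : Real.arsinh (-(1/μ.im)) ≤ Real.arsinh ((0 - μ.re)/μ.im) := by
          rw [Real.arsinh_le_arsinh, ← neg_div]; gcongr; linarith
        rw [Real.arsinh_neg] at e2
        linarith)
    refine psi_norm.trans (h1.trans ?_)
    have := Real.pi_pos
    have e3 : 0 ≤ M * Real.pi * (1 + Real.arsinh (1 / μ.im)) := by positivity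
    have e4 : 0 ≤ m⁻¹ * I * Real.arsinh (1 / μ.im) := by positivity
    nlinarith
  · have h1 := split_bound hU (ckP hU hμ) (kP_nonneg hμ) (int_kP' hU hμ) hY hM0.le hM
      (inv_nonneg.2 hm0.le) hkP (B := Real.pi) (by
        rw [int_VkP hU hμ]
        have e1 := abs_le.1 (arctan_abs ((U Y - μ.re)/μ.im))
        have e2 := abs_le.1 (arctan_abs ((U 0 - μ.re)/μ.im))
        linarith [e1.2, e2.1])
    refine (psi_im_abs hU hμ).trans (h1.trans ?_)
    linarith

lemma near_zero (hU : AdmissibleShearFlow U) (hU2 : 0 < iteratedDeriv 2 U 0) :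
    ∃ δ > (0:ℝ), ∃ c > (0:ℝ), ∃ hs > (0:ℝ), ∀ μ : ℂ, 0 < μ.im → μ.im ≤ hs → μ.im ≤ μ.re →
      μ.re ≤ δ → c ≤ (Psi U μ).im := by
  have hg0 : 0 < gh U 0 := by
    unfold gh
    have := hU.deriv_pos 0 le_rfl
    rw [hU.zero_val]
    positivity
  obtain ⟨Y, hY, hgY⟩ : ∃ Y > 0, ∀ y ∈ Icc 0 Y, gh U 0 / 2 ≤ gh U y := by
    have h1 : ContinuousWithinAt (gh U) (Ici 0) 0 := cgh hU 0 self_mem_Ici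
    have h2 := h1.eventually (lt_mem_nhds (half_lt_self hg0))
    obtain ⟨Y, hY, h3⟩ := mem_nhdsGE_iff_exists_Icc_subset.1 h2
    exact ⟨Y, hY, fun y hy => le_of_lt (h3 hy)⟩
  set g := gh U 0 / 2 with hg
  have hgp : 0 < g := by positivity
  set δ := U Y / 2 with hδ
  have hUY : 0 < U Y := by
    have := mono hU (self_mem_Ici) (hY.le : (0:ℝ) ≤ Y) hY
    rwa [hU.zero_val] at this
  have hδp : 0 < δ := by positivity
  set I := ∫ y in Ioi (0:ℝ), |gt U y| with hI
  have hI0 : 0 ≤ I := integral_nonneg fun y => abs_nonneg _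
  have hpi := Real.pi_pos
  refine ⟨δ, hδp, g * (Real.pi/8), by positivity, (g * (Real.pi/8)) * δ^2 / (I + 1), by positivity,
    fun μ hμ hhs ha hb => ?_⟩
  rw [psi_im hU hμ, split (int_kP hU hμ) hY.le]
  have p1 : g * (Real.pi/4) ≤ ∫ y in (0:ℝ)..Y, gt U y * kP U μ y := by
    calc g * (Real.pi/4) ≤ g * ∫ y in (0:ℝ)..Y, deriv U y * kP U μ y := by
          apply mul_le_mul_of_nonneg_left _ hgp.le
          rw [int_VkP hU hμ, hU.zero_val]
          have e1 : 0 ≤ Real.arctan ((U Y - μ.re)/μ.im) := by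
            rw [Real.arctan_nonneg]
            apply div_nonneg _ hμ.le
            linarith
          have e2 : Real.arctan ((0 - μ.re)/μ.im) ≤ Real.arctan (-1) := by
            apply Real.arctan_mono
            rw [div_le_iff₀ hμ]; linarith
          rw [Real.arctan_neg, Real.arctan_one] at e2
          linarith
      _ = ∫ y in (0:ℝ)..Y, g * (deriv U y * kP U μ y) :=
          (intervalIntegral.integral_const_mul _ _).symm
      _ ≤ _ := by
          apply intervalIntegral.integral_mono_on hY.le _ (ii (int_kP hU hμ) hY.le)
          · intro y hy
            have hv := (hU.deriv_pos y hy.1).le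
            rw [gt_eq hU hy.1, mul_assoc]
            exact mul_le_mul_of_nonneg_right (hgY y hy) (mul_nonneg hv (kP_nonneg hμ y))
          · exact (continuous_const.mul ((cV hU).mul (ckP hU hμ))).intervalIntegrable _ _
  have hY' : Ioi Y ⊆ Ioi (0:ℝ) := Ioi_subset_Ioi hY.le
  have p2 : - (g * (Real.pi/8)) ≤ ∫ y in Ioi Y, gt U y * kP U μ y := by
    have ia : IntegrableOn (fun y => |gt U y|) (Ioi 0) := (int_gt hU).abs
    have q1 : μ.im / δ^2 * I ≤ g * (Real.pi/8) := by
      rw [le_div_iff₀ (by positivity)] at hhs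
      rw [div_mul_eq_mul_div, div_le_iff₀ (by positivity)]
      nlinarith
    have q2 : ∫ y in Ioi Y, |gt U y| ≤ I :=
      setIntegral_mono_set ia (Eventually.of_forall fun y => abs_nonneg _) hY'.eventuallyLE
    have q3 : ∫ y in Ioi Y, (-(μ.im/δ^2)) * |gt U y| ≤ ∫ y in Ioi Y, gt U y * kP U μ y := by
      apply setIntegral_mono_on ((ia.mono_set hY').const_mul _) ((int_kP hU hμ).mono_set hY')
        measurableSet_Ioi
      intro y hy
      have k1 : kP U μ y ≤ μ.im/δ^2 := by
        rw [kP_eq]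
        have h1 : U Y < U y := mono hU hY.le (hY.le.trans (le_of_lt hy)) hy
        apply div_le_div_of_nonneg_left hμ.le (by positivity)
        have : δ ≤ U y - μ.re := by linarith
        nlinarith [sq_nonneg μ.im]
      have k2 := kP_nonneg (U := U) hμ y
      have k3 := neg_abs_le (gt U y)
      have k4 := abs_nonneg (gt U y)
      nlinarith
    rw [integral_const_mul] at q3
    have q4 : μ.im / δ^2 * ∫ y in Ioi Y, |gt U y| ≤ μ.im / δ^2 * I :=
      mul_le_mul_of_nonneg_left q2 (by positivity)
    linarith
  linarith

set_option maxHeartbeats 800000 in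
lemma near_one (hU : AdmissibleShearFlow U)
    {κ yκ cκ : ℝ} (hκ0 : 0 < κ) (hκ12 : κ < 1/2) (hyκ : 0 < yκ) (hcκ : 0 < cκ)
    (hdec : ∀ y, yκ ≤ y →
      (1 - U y) ^ ((2:ℝ) - κ) * iteratedDeriv 2 U y ≤ -cκ * (deriv U y) ^ 3) :
    ∃ r > (0:ℝ), r < 1/2 ∧ ∃ h0 > (0:ℝ), ∃ c > (0:ℝ), ∀ μ : ℂ, 1 - r ≤ μ.re → μ.re ≤ 1 →
      0 < μ.im → μ.im ≤ h0 → (Psi U μ).im ≤ - c * μ.im ^ κ := by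
  have hgh : ∀ y, yκ ≤ y → gh U y ≤ -cκ * (1 - U y) ^ κ := by
    intro y hy
    have hy0 : 0 ≤ y := hyκ.le.trans hy
    have h1 : 0 < 1 - U y := by linarith [(hU.mem_Ico y hy0).2]
    have h2 := hdec y hy
    have hv := hU.deriv_pos y hy0
    have h3 : (1 - U y)^2 = (1 - U y) ^ ((2:ℝ) - κ) * (1 - U y) ^ κ := by
      rw [← Real.rpow_add h1]; simp
    have h4 : 0 < (1 - U y) ^ κ := Real.rpow_pos_of_pos h1 _
    rw [gh, div_le_iff₀ (by positivity), h3]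
    nlinarith
  obtain ⟨M, hM0, hM⟩ := gh_bdd hU yκ
  have hUY0 : 0 < U yκ := by
    have := mono hU (self_mem_Ici) (hyκ.le : (0:ℝ) ≤ yκ) hyκ
    rwa [hU.zero_val] at this
  have hUY1 := (hU.mem_Ico yκ hyκ.le).2
  set r := (1 - U yκ)/3 with hr
  have hrp : 0 < r := by linarith
  set q := (cκ/10) / (M/(4*r^2)) with hq
  have hqp : 0 < q := by positivity
  refine ⟨r, hrp, by linarith, min r (min 1 (q^2)), by positivity, cκ/10, by positivity,
    fun μ ha hb hμ hh => ?_⟩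
  have hhr : μ.im ≤ r := hh.trans (min_le_left _ _)
  have hh1 : μ.im ≤ 1 := hh.trans ((min_le_right _ _).trans (min_le_left _ _))
  have hhq : μ.im ≤ q^2 := hh.trans ((min_le_right _ _).trans (min_le_right _ _))
  set h := μ.im with hhdef
  have hpow : h ≤ h^κ * q := by
    have e1 : h = h^κ * h^(1-κ) := by rw [← Real.rpow_add hμ]; simp
    have e2 : h^(1-κ) ≤ h^(1/2:ℝ) := Real.rpow_le_rpow_of_exponent_ge hμ hh1 (by linarith)
    have e3 : h^(1/2:ℝ) ≤ q := by
      rw [← Real.sqrt_eq_rpow]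
      exact Real.sqrt_le_iff.2 ⟨hqp.le, hhq⟩
    have e4 : 0 < h^κ := Real.rpow_pos_of_pos hμ _
    calc h = h^κ * h^(1-κ) := e1
      _ ≤ h^κ * q := mul_le_mul_of_nonneg_left (e2.trans e3) e4.le
  have hhκ : 0 < h^κ := Real.rpow_pos_of_pos hμ _
  rw [psi_im hU hμ, split (int_kP hU hμ) hyκ.le]
  have p1 : ∫ y in (0:ℝ)..yκ, gt U y * kP U μ y ≤ (cκ/10) * h^κ := by
    calc ∫ y in (0:ℝ)..yκ, gt U y * kP U μ y ≤ ∫ y in (0:ℝ)..yκ, (M * (h/(4*r^2))) * deriv U y := by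
          apply intervalIntegral.integral_mono_on hyκ.le (ii (int_kP hU hμ) hyκ.le)
          · exact (continuous_const.mul (cV hU)).intervalIntegrable _ _
          · intro y hy
            have hv := (hU.deriv_pos y hy.1).le
            have h1 : U y ≤ U yκ := (mono hU).monotoneOn hy.1 hyκ.le hy.2
            have k1 : kP U μ y ≤ h/(4*r^2) := by
              rw [kP_eq]
              apply div_le_div_of_nonneg_left hμ.le (by positivity)
              have : 2*r ≤ μ.re - U y := by linarith
              have h3 : (2*r)^2 ≤ (μ.re - U y)^2 := by
                apply sq_le_sq' <;> linarith
              linarith [sq_nonneg μ.im]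
            have k2 := kP_nonneg (U := U) hμ y
            have k3 := (le_abs_self _).trans (hM y hy)
            rw [gt_eq hU hy.1]
            have k4 : gh U y * kP U μ y ≤ M * (h/(4*r^2)) := by
              calc gh U y * kP U μ y ≤ M * kP U μ y := mul_le_mul_of_nonneg_right k3 k2
                _ ≤ _ := mul_le_mul_of_nonneg_left k1 hM0.le
            calc gh U y * deriv U y * kP U μ y = gh U y * kP U μ y * deriv U y := by ring
              _ ≤ _ := mul_le_mul_of_nonneg_right k4 hv
      _ = (M * (h/(4*r^2))) * (U yκ - U 0) := by
          rw [intervalIntegral.integral_const_mul]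
          congr 1
          exact intervalIntegral.integral_eq_sub_of_hasDerivAt (fun y _ => hd1 hU y)
            ((cV hU).intervalIntegrable _ _)
      _ ≤ (M * (h/(4*r^2))) * 1 := by
          apply mul_le_mul_of_nonneg_left _ (by positivity)
          rw [hU.zero_val]; linarith
      _ = M/(4*r^2) * h := by ring
      _ ≤ M/(4*r^2) * (h^κ * q) := mul_le_mul_of_nonneg_left hpow (by positivity)
      _ = (cκ/10) * h^κ := by rw [hq]; field_simp
  have hY' : Ioi yκ ⊆ Ioi (0:ℝ) := Ioi_subset_Ioi hyκ.le
  have p2 : ∫ y in Ioi yκ, gt U y * kP U μ y ≤ - (cκ/5) * h^κ := by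
    obtain ⟨y1, hy1, hUy1⟩ := surj hU (v := μ.re - 2*h) (by linarith) (by linarith)
    obtain ⟨y2, hy2, hUy2⟩ := surj hU (v := μ.re - h) (by linarith) (by linarith)
    have o1 : yκ ≤ y1 := ((mono hU).le_iff_le hyκ.le hy1).1 (by linarith)
    have o2 : y1 ≤ y2 := ((mono hU).le_iff_le hy1 hy2).1 (by linarith)
    have hsub : Ioc y1 y2 ⊆ Ioi yκ := fun y hy => lt_of_le_of_lt o1 hy.1
    have hneg : ∀ y ∈ Ioi yκ, gt U y * kP U μ y ≤ 0 := by
      intro y hy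
      have hy0 : 0 ≤ y := hyκ.le.trans (le_of_lt hy)
      have h1 : 0 < 1 - U y := by linarith [(hU.mem_Ico y hy0).2]
      apply mul_nonpos_of_nonpos_of_nonneg _ (kP_nonneg hμ y)
      rw [gt_eq hU hy0]
      apply mul_nonpos_of_nonpos_of_nonneg _ (hU.deriv_pos y hy0).le
      have := Real.rpow_pos_of_pos h1 κ
      nlinarith [hgh y (le_of_lt hy)]
    have s1 : ∫ y in Ioc y1 y2, -(gt U y * kP U μ y) ≤ ∫ y in Ioi yκ, -(gt U y * kP U μ y) := by
      apply setIntegral_mono_set ((int_kP hU hμ).mono_set hY').neg _ hsub.eventuallyLE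
      filter_upwards [ae_restrict_mem measurableSet_Ioi] with y hy
      simpa using hneg y hy
    rw [integral_neg, integral_neg, ← intervalIntegral.integral_of_le o2] at s1
    have s2 : ∫ y in y1..y2, gt U y * kP U μ y ≤ ∫ y in y1..y2, (-cκ * h^κ / (5*h)) * deriv U y := by
      apply intervalIntegral.integral_mono_on o2
      · rw [intervalIntegrable_iff_integrableOn_Ioc_of_le o2]
        exact (int_kP hU hμ).mono_set (hsub.trans hY')
      · exact (continuous_const.mul (cV hU)).intervalIntegrable _ _
      · intro y hy
        have hyk : yκ ≤ y := o1.trans hy.1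
        have hy0 : 0 ≤ y := hyκ.le.trans hyk
        have hv := (hU.deriv_pos y hy0).le
        have u1 : U y1 ≤ U y := (mono hU).monotoneOn hy1 hy0 hy.1
        have u2 : U y ≤ U y2 := (mono hU).monotoneOn hy0 hy2 hy.2
        have g1 : gh U y ≤ -cκ * h^κ := by
          have : h^κ ≤ (1 - U y)^κ := Real.rpow_le_rpow hμ.le (by linarith) hκ0.le
          have := mul_le_mul_of_nonneg_left this hcκ.le
          linarith [hgh y hyk]
        have k1 : 1/(5*h) ≤ kP U μ y := by
          rw [kP_eq, div_le_div_iff₀ (by positivity) (by positivity)]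
          have : (U y - μ.re)^2 ≤ (2*h)^2 := by
            apply sq_le_sq' <;> linarith
          nlinarith
        rw [gt_eq hU hy0]
        have k4 : gh U y * kP U μ y ≤ -cκ * h^κ / (5*h) := by
          calc gh U y * kP U μ y ≤ (-cκ * h^κ) * kP U μ y :=
                mul_le_mul_of_nonneg_right g1 (kP_nonneg hμ y)
            _ ≤ (-cκ * h^κ) * (1/(5*h)) := by
                apply mul_le_mul_of_nonpos_left k1
                have := mul_pos hcκ hhκ
                linarith
            _ = _ := by ring
        calc gh U y * deriv U y * kP U μ y = gh U y * kP U μ y * deriv U y := by ring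
          _ ≤ _ := mul_le_mul_of_nonneg_right k4 hv
    have s3 : ∫ y in y1..y2, (-cκ * h^κ / (5*h)) * deriv U y = - (cκ/5) * h^κ := by
      rw [intervalIntegral.integral_const_mul,
        intervalIntegral.integral_eq_sub_of_hasDerivAt (fun y _ => hd1 hU y)
            ((cV hU).intervalIntegrable _ _), hUy1, hUy2]
      field_simp
      ring
    linarith
  linarith

lemma piece {Φ : ℂ → ℂ} (hΦ : DifferentiableOn ℂ Φ {z : ℂ | 0 < z.im}) {p ε : ℂ} (hε : ε ≠ 0)
    {z z' : ℝ → ℂ} (hz : ∀ t, HasDerivAt z (z' t) t) (cz' : Continuous z')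
    {c : ℝ → ℂ} {x y : ℝ} (hxy : x ≤ y) (hc : ∀ t ∈ Ioo x y, c t = Φ (z t))
    (hH : ∀ t ∈ Icc x y, 0 < (z t).im)
    (hs : ∀ t ∈ Icc x y, ε * (Φ (z t) - p) ∈ Complex.slitPlane) :
    IntervalIntegrable (fun t => deriv c t / (c t - p)) volume x y ∧
    ∫ t in x..y, deriv c t / (c t - p)
      = Complex.log (ε * (Φ (z y) - p)) - Complex.log (ε * (Φ (z x) - p)) := by
  have hopen : IsOpen {z : ℂ | 0 < z.im} := isOpen_lt continuous_const Complex.continuous_im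
  have hne : ∀ t ∈ Icc x y, Φ (z t) - p ≠ 0 := by
    intro t ht h
    have := hs t ht
    rw [h, mul_zero] at this
    exact Complex.zero_notMem_slitPlane this
  have hd : ∀ t ∈ Icc x y, HasDerivAt (fun t => Φ (z t)) (deriv Φ (z t) * z' t) t := by
    intro t ht
    exact ((hΦ.differentiableAt (hopen.mem_nhds (hH t ht))).hasDerivAt).comp_of_eq t (hz t) rfl
  have hcont : ContinuousOn (fun t => (deriv Φ (z t) * z' t) / (Φ (z t) - p)) (Icc x y) := by
    have hzc : Continuous z := continuous_iff_continuousAt.2 fun t => (hz t).continuousAt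
    apply ContinuousOn.div
    · apply ContinuousOn.mul _ cz'.continuousOn
      exact ((hΦ.deriv hopen).continuousOn).comp hzc.continuousOn hH
    · intro t ht
      exact ((hd t ht).continuousAt.sub continuousAt_const).continuousWithinAt
    · exact hne
  have hii : IntervalIntegrable (fun t => (deriv Φ (z t) * z' t) / (Φ (z t) - p)) volume x y := by
    apply ContinuousOn.intervalIntegrable
    rwa [uIcc_of_le hxy]
  have heq : EqOn (fun t => (deriv Φ (z t) * z' t) / (Φ (z t) - p))
      (fun t => deriv c t / (c t - p)) (uIoo x y) := by
    intro t ht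
    rw [uIoo_of_le hxy] at ht
    have e : c =ᶠ[nhds t] fun t => Φ (z t) := by
      filter_upwards [isOpen_Ioo.mem_nhds ht] with u hu using hc u hu
    simp only [e.deriv_eq, hc t ht, (hd t (Ioo_subset_Icc_self ht)).deriv]
  refine ⟨hii.congr_uIoo heq, ?_⟩
  rw [← intervalIntegral.integral_congr_uIoo heq]
  apply intervalIntegral.integral_eq_sub_of_hasDerivAt
    (f := fun t => Complex.log (ε * (Φ (z t) - p))) _ hii
  intro t ht
  rw [uIcc_of_le hxy] at ht
  refine (((hd t ht).sub_const p).const_mul ε).clog_real (hs t ht) |>.congr_deriv ?_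
  have := hne t ht
  field_simp

lemma log_diff_pos {w : ℂ} (hw : 0 < w.im) :
    Complex.log (1 * w) - Complex.log (-1 * w) = Real.pi * Complex.I := by
  rw [one_mul, neg_one_mul, Complex.log, Complex.log, Complex.arg_neg_eq_arg_sub_pi_of_im_pos hw,
    norm_neg]
  push_cast; ring

lemma log_diff_neg {w : ℂ} (hw : w.im < 0) :
    Complex.log (1 * w) - Complex.log (-1 * w) = - (Real.pi * Complex.I) := by
  rw [one_mul, neg_one_mul, Complex.log, Complex.log, Complex.arg_neg_eq_arg_add_pi_of_im_neg hw,
    norm_neg]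
  push_cast; ring

lemma ceta_seg {η t : ℝ} (ht : t ≤ 1/2) : Ceta η t = ((2*t : ℝ) : ℂ) + (η : ℂ) * Complex.I := by
  rw [Ceta, if_pos ht]

lemma ceta_arc {η t : ℝ} (ht : 1/2 ≤ t) : Ceta η t = (1/2 : ℂ) + (η : ℂ) * Complex.I
    + (1/2 : ℂ) * Complex.exp (((Real.pi * (2*t - 1) : ℝ)) * Complex.I) := by
  rcases ht.eq_or_lt with h | h
  · subst h
    rw [ceta_seg le_rfl]
    norm_num
    ring
  · rw [Ceta, if_neg (not_le.2 h)]

lemma seg_re {η t : ℝ} (ht : t ≤ 1/2) : (Ceta η t).re = 2*t := by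
  rw [ceta_seg ht]; simp

lemma seg_im {η t : ℝ} (ht : t ≤ 1/2) : (Ceta η t).im = η := by
  rw [ceta_seg ht]; simp

lemma arc_re {η t : ℝ} (ht : 1/2 ≤ t) :
    (Ceta η t).re = 1/2 + 1/2 * Real.cos (Real.pi * (2*t-1)) := by
  rw [ceta_arc ht]
  generalize Real.pi * (2*t-1) = θ
  rw [Complex.exp_mul_I, ← Complex.ofReal_cos, ← Complex.ofReal_sin]
  simp [-Complex.ofReal_cos, -Complex.ofReal_sin]

lemma arc_im {η t : ℝ} (ht : 1/2 ≤ t) :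
    (Ceta η t).im = η + 1/2 * Real.sin (Real.pi * (2*t-1)) := by
  rw [ceta_arc ht]
  generalize Real.pi * (2*t-1) = θ
  rw [Complex.exp_mul_I, ← Complex.ofReal_cos, ← Complex.ofReal_sin]
  simp [-Complex.ofReal_cos, -Complex.ofReal_sin]

lemma ceta_one {η : ℝ} : Ceta η 1 = Ceta η 0 := by
  apply Complex.ext
  · rw [arc_re (by norm_num), seg_re (by norm_num)]; norm_num
  · rw [arc_im (by norm_num), seg_im (by norm_num)]; norm_num

lemma arc_sin {t : ℝ} (ht : 1/2 ≤ t) (ht1 : t ≤ 1) : 0 ≤ Real.sin (Real.pi * (2*t-1)) := by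
  apply Real.sin_nonneg_of_nonneg_of_le_pi
  · exact mul_nonneg Real.pi_pos.le (by linarith)
  · nlinarith [Real.pi_pos]

lemma ceta_im {η t : ℝ} (ht1 : t ≤ 1) : η ≤ (Ceta η t).im := by
  rcases le_total t (1/2) with h | h
  · rw [seg_im h]
  · rw [arc_im h]; linarith [arc_sin h ht1]

lemma winding_one {Φ : ℂ → ℂ} (hΦ : DifferentiableOn ℂ Φ {z : ℂ | 0 < z.im}) {p : ℂ} {η : ℝ}
    (hη : 0 < η) {t0 t1 : ℝ} (h0 : 0 ≤ t0) (h01 : t0 ≤ t1) (h1 : t1 ≤ 1/2)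
    (hA : ∀ t ∈ Icc 0 t0, (Φ (Ceta η t) - p).re < 0 ∨ (Φ (Ceta η t) - p).im ≠ 0)
    (hB : ∀ t ∈ Icc t0 t1, 0 < (Φ (Ceta η t) - p).re ∨ (Φ (Ceta η t) - p).im ≠ 0)
    (hC : ∀ t ∈ Icc t1 1, (Φ (Ceta η t) - p).re < 0 ∨ (Φ (Ceta η t) - p).im ≠ 0)
    (hi0 : (Φ (Ceta η t0) - p).im < 0) (hi1 : 0 < (Φ (Ceta η t1) - p).im) :
    windingNumber (fun t => Φ (Ceta η t)) p = 1 := by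
  set z1 : ℝ → ℂ := fun t => ((2*t : ℝ) : ℂ) + (η : ℂ) * Complex.I with hz1
  set z2 : ℝ → ℂ := fun t => (1/2 : ℂ) + (η : ℂ) * Complex.I
    + (1/2 : ℂ) * Complex.exp (((Real.pi * (2*t - 1) : ℝ)) * Complex.I) with hz2
  have e1 : ∀ t, t ≤ 1/2 → z1 t = Ceta η t := fun t ht => (ceta_seg ht).symm
  have e2 : ∀ t, 1/2 ≤ t → z2 t = Ceta η t := fun t ht => (ceta_arc ht).symm
  have d1 : ∀ t, HasDerivAt z1 (2:ℂ) t := by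
    intro t
    have := (((hasDerivAt_id t).const_mul (2:ℝ)).ofReal_comp).add_const ((η : ℂ) * Complex.I)
    exact this.congr_deriv (by simp)
  have d2 : ∀ t, HasDerivAt z2 ((1/2 : ℂ) *
      (Complex.exp (((Real.pi * (2*t - 1) : ℝ)) * Complex.I) * (((Real.pi * 2 : ℝ) : ℂ) * Complex.I))) t := by
    intro t
    have a1 : HasDerivAt (fun t : ℝ => Real.pi * (2*t - 1)) (Real.pi * 2) t := by
      simpa using (((hasDerivAt_id t).const_mul (2:ℝ)).sub_const 1).const_mul Real.pi
    exact (((a1.ofReal_comp.mul_const Complex.I).cexp).const_mul (1/2 : ℂ)).const_add _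
  have c2 : Continuous (fun t : ℝ => (1/2 : ℂ) *
      (Complex.exp (((Real.pi * (2*t - 1) : ℝ)) * Complex.I) * (((Real.pi * 2 : ℝ) : ℂ) * Complex.I))) := by
    fun_prop
  have neg_slit : ∀ w : ℂ, (w.re < 0 ∨ w.im ≠ 0) → -1 * w ∈ Complex.slitPlane := by
    intro w hw
    rw [Complex.mem_slitPlane_iff]
    simpa using hw
  have pos_slit : ∀ w : ℂ, (0 < w.re ∨ w.im ≠ 0) → 1 * w ∈ Complex.slitPlane := by
    intro w hw
    rw [Complex.mem_slitPlane_iff]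
    simpa using hw
  have m1 : (-1 : ℂ) ≠ 0 := by norm_num
  have him : ∀ t, t ≤ 1 → 0 < (Ceta η t).im := fun t ht => hη.trans_le (ceta_im ht)
  obtain ⟨i1, s1⟩ := piece hΦ (p := p) m1 d1 continuous_const (c := fun t => Φ (Ceta η t)) h0
    (fun t ht => by rw [e1 t (by linarith [ht.2])])
    (fun t ht => by rw [e1 t (by linarith [ht.2])]; exact him t (by linarith [ht.2]))
    (fun t ht => by rw [e1 t (by linarith [ht.2])]; exact neg_slit _ (hA t ht))
  obtain ⟨i2, s2⟩ := piece hΦ (p := p) one_ne_zero d1 continuous_const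
    (c := fun t => Φ (Ceta η t)) h01
    (fun t ht => by rw [e1 t (by linarith [ht.2])])
    (fun t ht => by rw [e1 t (by linarith [ht.2])]; exact him t (by linarith [ht.2]))
    (fun t ht => by rw [e1 t (by linarith [ht.2])]; exact pos_slit _ (hB t ht))
  obtain ⟨i3, s3⟩ := piece hΦ (p := p) m1 d1 continuous_const (c := fun t => Φ (Ceta η t)) h1
    (fun t ht => by rw [e1 t (by linarith [ht.2])])
    (fun t ht => by rw [e1 t (by linarith [ht.2])]; exact him t (by linarith [ht.2]))
    (fun t ht => by
      rw [e1 t (by linarith [ht.2])]; exact neg_slit _ (hC t ⟨ht.1, by linarith [ht.2]⟩))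
  obtain ⟨i4, s4⟩ := piece hΦ (p := p) m1 d2 c2 (c := fun t => Φ (Ceta η t))
    (by norm_num : (1/2:ℝ) ≤ 1)
    (fun t ht => by rw [e2 t (by linarith [ht.1])])
    (fun t ht => by rw [e2 t (by linarith [ht.1])]; exact him t (by linarith [ht.2]))
    (fun t ht => by
      rw [e2 t (by linarith [ht.1])]; exact neg_slit _ (hC t ⟨by linarith [ht.1], ht.2⟩))
  rw [e1 _ (by linarith), e1 _ (by linarith)] at s1 s2 s3
  rw [e2 _ (by linarith), e2 _ (by linarith), ceta_one] at s4
  have k1 := log_diff_pos hi1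
  have k0 := log_diff_neg hi0
  have tot : ∫ t in (0:ℝ)..1, deriv (fun t => Φ (Ceta η t)) t / ((fun t => Φ (Ceta η t)) t - p)
      = 2 * Real.pi * Complex.I := by
    rw [← intervalIntegral.integral_add_adjacent_intervals ((i1.trans i2).trans i3) i4,
      ← intervalIntegral.integral_add_adjacent_intervals (i1.trans i2) i3,
      ← intervalIntegral.integral_add_adjacent_intervals i1 i2, s1, s2, s3, s4]
    linear_combination k1 - k0
  rw [windingNumber, tot]
  push_cast
  apply inv_mul_cancel₀
  simp [Real.pi_ne_zero]

lemma inv_re' {ℓ : ℝ} (μ : ℂ) : ((μ * (ℓ : ℂ))⁻¹).re = μ.re / (μ.re^2 + μ.im^2) * ℓ⁻¹ := by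
  rw [mul_inv, ← Complex.ofReal_inv, Complex.re_mul_ofReal, Complex.inv_re, Complex.normSq_apply]
  ring_nf

lemma inv_im' {ℓ : ℝ} (μ : ℂ) : ((μ * (ℓ : ℂ))⁻¹).im = - (μ.im / (μ.re^2 + μ.im^2) * ℓ⁻¹) := by
  rw [mul_inv, ← Complex.ofReal_inv, Complex.im_mul_ofReal, Complex.inv_im, Complex.normSq_apply]
  ring_nf

lemma arsinh_small {C D : ℝ} (hC : 0 < C) (hD : 0 < D) :
    ∀ᶠ γ : ℝ in atTop, C * (1 + Real.arsinh (1 / (D / γ^2))) ≤ γ / 4 := by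
  have h1 := (Real.isLittleO_log_id_atTop).def (c := 1/(16*C)) (by positivity)
  filter_upwards [h1, eventually_ge_atTop 1,
    eventually_ge_atTop (8 * C * (1 + Real.log (1 + 2/D)))] with γ hγ hγ1 hγ2
  have hγ0 : 0 < γ := by linarith
  have e0 : 1 / (D/γ^2) = γ^2/D := by field_simp
  rw [e0, Real.arsinh]
  have e1 : √(1 + (γ^2/D)^2) ≤ 1 + γ^2/D := by
    rw [Real.sqrt_le_iff]
    have : 0 < γ^2/D := by positivity
    constructor
    · positivity
    · nlinarith
  have e2 : γ^2/D + √(1 + (γ^2/D)^2) ≤ (1 + 2/D) * γ^2 := by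
    have : (1 + 2/D) * γ^2 = γ^2 + 2 * (γ^2/D) := by ring
    rw [this]
    nlinarith
  have e3 : Real.log (γ^2/D + √(1 + (γ^2/D)^2)) ≤ Real.log (1 + 2/D) + 2 * Real.log γ := by
    calc _ ≤ Real.log ((1 + 2/D) * γ^2) := Real.log_le_log (by positivity) e2
      _ = _ := by
        rw [Real.log_mul (by positivity) (by positivity), Real.log_pow]; norm_num
  have e4 : Real.log γ ≤ 1/(16*C) * γ := by
    have := (le_abs_self _).trans hγ
    simpa [abs_of_pos hγ0] using this
  have e5 : C * (2 * Real.log γ) ≤ γ/8 := by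
    calc C * (2 * Real.log γ) ≤ C * (2 * (1/(16*C) * γ)) := by gcongr
      _ = γ/8 := by field_simp; norm_num
  have e6 := mul_le_mul_of_nonneg_left e3 hC.le
  linarith

end WPR

set_option maxHeartbeats 4000000 in
open WPR in
/-- Lemma (winding number in the physical regime, for `U_s''(0) > 0`). -/
theorem winding_physical_regime (U : ℝ → ℝ) (hU : AdmissibleShearFlow U)
    (hU2 : 0 < iteratedDeriv 2 U 0)
    (κ yκ cκ : ℝ) (hκ0 : 0 < κ) (hκ12 : κ < 1/2) (hyκ : 0 < yκ) (hcκ : 0 < cκ)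
    (hdec : ∀ y, yκ ≤ y →
      (1 - U y) ^ ((2:ℝ) - κ) * iteratedDeriv 2 U y ≤ -cκ * (deriv U y) ^ 3) :
    ∃ d : ℝ, 0 < d ∧ ∃ γm : ℝ, 0 < γm ∧
      ∀ γ : ℝ, γm ≤ γ → ∃ ηγ : ℝ,
        d * γ ^ (-(2:ℝ)) ≤ ηγ ∧
        windingNumber (fun t => PhiInv U (Ceta ηγ t)) (γ : ℂ) = 1 ∧
        ∀ t ∈ Icc (0:ℝ) 1,
          d * γ ^ (-(2 * κ)) ≤ ‖PhiInv U (Ceta ηγ t) - (γ : ℂ)‖ := by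
  obtain ⟨r, hr, hr2, h0, hh0, c1, hc1, hone⟩ := near_one hU hκ0 hκ12 hyκ hcκ hdec
  obtain ⟨δ, hδ, c3, hc3, hs, hhs, hzero⟩ := near_zero hU hU2
  obtain ⟨C, hC, hreg⟩ := region_bound hU hr (by linarith) hh0
  have hℓ := hU.deriv_pos 0 le_rfl
  have hrepr := fun μ hμ => phi_repr hU (μ := μ) hμ
  have hdiff := phi_diff hU
  set ℓ := deriv U 0 with hℓdef
  -- real and imaginary parts
  have hre : ∀ (μ : ℂ) (γ : ℝ), 0 < μ.im → (PhiInv U μ - (γ : ℂ)).re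
      = μ.re / (μ.re^2 + μ.im^2) * ℓ⁻¹ + (Psi U μ).re - γ := by
    intro μ γ hμ
    rw [hrepr μ hμ, Complex.sub_re, Complex.add_re, inv_re', Complex.ofReal_re]
  have him : ∀ (μ : ℂ) (γ : ℝ), 0 < μ.im → (PhiInv U μ - (γ : ℂ)).im
      = - (μ.im / (μ.re^2 + μ.im^2) * ℓ⁻¹) + (Psi U μ).im := by
    intro μ γ hμ
    rw [hrepr μ hμ, Complex.sub_im, Complex.add_im, inv_im', Complex.ofReal_im, sub_zero]
  clear hrepr
  -- constants
  set s2 := 1 / (2 * ℓ * (C + 1)) with hs2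
  have hs2p : 0 < s2 := by positivity
  set D := min 1 (min (c3/(8*ℓ)) (1/(4*ℓ^2*s2))) with hD
  have hDp : 0 < D := by positivity
  have hD1 : D ≤ c3/(8*ℓ) := (min_le_right _ _).trans (min_le_left _ _)
  have hD2 : D ≤ 1/(4*ℓ^2*s2) := (min_le_right _ _).trans (min_le_right _ _)
  have hηlim : Tendsto (fun γ : ℝ => D / γ^2) atTop (nhds 0) :=
    tendsto_const_nhds.div_atTop (tendsto_pow_atTop (by norm_num))
  have halim : Tendsto (fun γ : ℝ => 2 / (ℓ*γ)) atTop (nhds 0) :=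
    tendsto_const_nhds.div_atTop (tendsto_id.const_mul_atTop hℓ)
  have hev : ∀ᶠ γ : ℝ in atTop, 4 ≤ γ ∧ 4/ℓ ≤ γ ∧ 2*ℓ*D ≤ γ ∧ D/γ^2 ≤ s2/3 ∧ D/γ^2 ≤ h0 ∧
      D/γ^2 ≤ hs ∧ 2/(ℓ*γ) ≤ δ ∧ 2/(ℓ*γ) ≤ 1 - r ∧
      C * (1 + Real.arsinh (1 / (D / γ^2))) ≤ γ / 4 := by
    filter_upwards [eventually_ge_atTop 4, eventually_ge_atTop (4/ℓ), eventually_ge_atTop (2*ℓ*D),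
      hηlim.eventually (ge_mem_nhds (by positivity : 0 < s2/3)),
      hηlim.eventually (ge_mem_nhds hh0), hηlim.eventually (ge_mem_nhds hhs),
      halim.eventually (ge_mem_nhds hδ), halim.eventually (ge_mem_nhds (by linarith : 0 < 1 - r)),
      arsinh_small hC hDp] with γ a1 a2 a3 a4 a5 a6 a7 a8 a9
    exact ⟨a1, a2, a3, a4, a5, a6, a7, a8, a9⟩
  obtain ⟨γm, hγm⟩ := eventually_atTop.1 hev
  have hDκ : 0 < D^κ := Real.rpow_pos_of_pos hDp _
  set d := min 1 (min D (min (c3/2) (c1 * D^κ))) with hd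
  have hd1 : d ≤ 1 := min_le_left _ _
  have hdD : d ≤ D := (min_le_right _ _).trans (min_le_left _ _)
  have hd3 : d ≤ c3/2 := (min_le_right _ _).trans ((min_le_right _ _).trans (min_le_left _ _))
  have hdκ : d ≤ c1 * D^κ := (min_le_right _ _).trans ((min_le_right _ _).trans (min_le_right _ _))
  refine ⟨d, by positivity, max γm 1, by positivity, fun γ hγ => ?_⟩
  obtain ⟨g4, gℓ, gD, gs, gh0, ghs, gδ, gr, gars⟩ := hγm γ ((le_max_left _ _).trans hγ)
  have hγ0 : 0 < γ := by linarith
  set η := D/γ^2 with hη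
  have hηp : 0 < η := by positivity
  set a0 := √(s2 * η) with ha0
  have ha0sq : a0^2 = s2 * η := Real.sq_sqrt (by positivity)
  have hηη : η^2 ≤ s2/3 * η := by
    rw [pow_two]; exact mul_le_mul_of_nonneg_right gs hηp.le
  have hs2η : 0 < s2 * η := by positivity
  have ha0p : 0 < a0 := Real.sqrt_pos.2 (by positivity)
  set a1 := 1/(2*ℓ*γ) with ha1
  have ha1p : 0 < a1 := by positivity
  have ha12 : 2/(ℓ*γ) = 4 * a1 := by rw [ha1]; field_simp; norm_num
  rw [ha12] at gδ gr
  have h01 : a0 ≤ a1 := by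
    rw [ha0, Real.sqrt_le_iff]
    refine ⟨ha1p.le, ?_⟩
    have : a1^2 = (1/(4*ℓ^2*s2)) * s2 / γ^2 := by rw [ha1]; field_simp; norm_num
    rw [this, hη]
    calc s2 * (D/γ^2) = D * s2 / γ^2 := by ring
      _ ≤ _ := by gcongr
  have hηa1 : η ≤ a1 := by
    rw [hη, ha1, div_le_div_iff₀ (by positivity) (by positivity)]
    nlinarith
  have hηκ : η^κ = D^κ * γ^(-(2*κ)) := by
    rw [hη, Real.div_rpow hDp.le (by positivity), Real.rpow_neg hγ0.le, Real.rpow_mul hγ0.le,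
      div_eq_mul_inv]
    norm_num
  have hηκp : 0 < η^κ := Real.rpow_pos_of_pos hηp _
  -- bound on Psi in the region
  have hpsi : ∀ μ : ℂ, 0 ≤ μ.re → μ.re ≤ 1 → η ≤ μ.im → (μ.re ≤ 1 - r ∨ h0 ≤ μ.im) →
      |(Psi U μ).re| ≤ γ/4 ∧ |(Psi U μ).im| ≤ C := by
    intro μ x1 x2 x3 x4
    obtain ⟨y1, y2⟩ := hreg μ x1 x2 (hηp.trans_le x3) x4
    refine ⟨(Complex.abs_re_le_norm _).trans (y1.trans (le_trans ?_ gars)), y2⟩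
    have : Real.arsinh (1/μ.im) ≤ Real.arsinh (1/η) := by
      rw [Real.arsinh_le_arsinh]
      exact one_div_le_one_div_of_le hηp x3
    gcongr
  have hN : ∀ μ : ℂ, 1 - r ≤ μ.re → μ.re ≤ 1 → η ≤ μ.im → μ.im ≤ h0 →
      (PhiInv U μ - (γ : ℂ)).im ≤ - (c1 * η^κ) := by
    intro μ x1 x2 x3 x4
    have hμ := hηp.trans_le x3
    rw [him μ γ hμ]
    have y1 := hone μ x1 x2 hμ x4
    have y2 : η^κ ≤ μ.im^κ := Real.rpow_le_rpow hηp.le x3 hκ0.le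
    have y3 := mul_le_mul_of_nonneg_left y2 hc1.le
    have y4 : 0 ≤ μ.im / (μ.re^2 + μ.im^2) * ℓ⁻¹ := by positivity
    linarith
  -- pieces
  have hA : ∀ t ∈ Icc 0 (a0/2), (PhiInv U (Ceta η t) - (γ : ℂ)).im ≤ -1 := by
    intro t ht
    have ht2 : t ≤ 1/2 := by linarith [ht.2]
    have zr := seg_re (η := η) ht2
    have zi := seg_im (η := η) ht2
    rw [him _ γ (by rw [zi]; exact hηp)]
    obtain ⟨-, y2⟩ := hpsi (Ceta η t) (by rw [zr]; linarith [ht.1]) (by rw [zr]; linarith)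
      zi.ge (Or.inl (by rw [zr]; linarith [ht.2]))
    have y3 := (le_abs_self _).trans y2
    rw [zr, zi]
    have y4 : C + 1 ≤ η / ((2*t)^2 + η^2) * ℓ⁻¹ := by
      have : (2*t)^2 + η^2 ≤ 2 * s2 * η := by
        have k1 : (2*t)^2 ≤ a0^2 := by
          apply pow_le_pow_left₀ <;> linarith [ht.1, ht.2]
        linarith
      calc C + 1 = η / (2 * s2 * η) * ℓ⁻¹ := by rw [hs2]; field_simp
        _ ≤ _ := by gcongr
    linarith
  have hB : ∀ t ∈ Icc (a0/2) (a1/2), 1 ≤ (PhiInv U (Ceta η t) - (γ : ℂ)).re := by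
    intro t ht
    have ht2 : t ≤ 1/2 := by linarith [ht.2]
    have ht0 : 0 < t := by linarith [ht.1]
    have zr := seg_re (η := η) ht2
    have zi := seg_im (η := η) ht2
    rw [hre _ γ (by rw [zi]; exact hηp)]
    obtain ⟨y2, -⟩ := hpsi (Ceta η t) (by rw [zr]; linarith [ht.1]) (by rw [zr]; linarith)
      zi.ge (Or.inl (by rw [zr]; linarith [ht.2]))
    have y3 := (abs_le.1 y2).1
    rw [zr, zi]
    have y4 : 3/2 * γ ≤ (2*t) / ((2*t)^2 + η^2) * ℓ⁻¹ := by
      have k1 : a0^2 ≤ (2*t)^2 := by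
        apply pow_le_pow_left₀ <;> linarith [ht.1, ht.2]
      have k2 : (2*t)^2 + η^2 ≤ 4/3 * (2*t)^2 := by linarith
      have k3 : (2*t)^2 + η^2 ≤ 4/3 * (2*t) * a1 := by
        refine k2.trans ?_
        have : (2*t) * (2*t) ≤ (2*t) * a1 :=
          mul_le_mul_of_nonneg_left (by linarith [ht.2]) (by linarith)
        linarith
      calc 3/2 * γ = (2*t) / (4/3 * (2*t) * a1) * ℓ⁻¹ := by rw [ha1]; field_simp; norm_num
        _ ≤ _ := by gcongr
    linarith
  have hS3 : ∀ t, a1 ≤ 2*t → 2*t ≤ 4*a1 → c3/2 ≤ (PhiInv U (Ceta η t) - (γ : ℂ)).im := by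
    intro t k1 k2
    have ht2 : t ≤ 1/2 := by linarith
    have zr := seg_re (η := η) ht2
    have zi := seg_im (η := η) ht2
    rw [him _ γ (by rw [zi]; exact hηp)]
    have y1 := hzero (Ceta η t) (by rw [zi]; exact hηp) (by rw [zi]; exact ghs)
      (by rw [zr, zi]; linarith) (by rw [zr]; linarith)
    rw [zr, zi]
    have y2 : η / ((2*t)^2 + η^2) * ℓ⁻¹ ≤ c3/2 := by
      calc η / ((2*t)^2 + η^2) * ℓ⁻¹ ≤ η / (a1^2) * ℓ⁻¹ := by
            have : a1^2 ≤ (2*t)^2 := pow_le_pow_left₀ ha1p.le k1 2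
            have : a1^2 ≤ (2*t)^2 + η^2 := by linarith [sq_nonneg η]
            gcongr
        _ = 4 * ℓ * D := by rw [ha1, hη]; field_simp; norm_num
        _ ≤ 4 * ℓ * (c3/(8*ℓ)) := by gcongr
        _ = c3/2 := by field_simp; norm_num
    linarith
  have hCc : ∀ t ∈ Icc (a1/2) 1, (PhiInv U (Ceta η t) - (γ : ℂ)).re ≤ -1 ∨
      c3/2 ≤ (PhiInv U (Ceta η t) - (γ : ℂ)).im ∨
      (PhiInv U (Ceta η t) - (γ : ℂ)).im ≤ - (c1 * η^κ) := by
    intro t ht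
    rcases le_total t (1/2) with ht2 | ht2
    · have zr := seg_re (η := η) ht2
      have zi := seg_im (η := η) ht2
      rcases le_total (2*t) (4*a1) with k1 | k1
      · exact Or.inr (Or.inl (hS3 t (by linarith [ht.1]) k1))
      rcases le_total (1-r) (2*t) with k2 | k2
      · exact Or.inr (Or.inr (hN _ (by rw [zr]; exact k2) (by rw [zr]; linarith) zi.ge
          (by rw [zi]; exact gh0)))
      · left
        rw [hre _ γ (by rw [zi]; exact hηp)]
        obtain ⟨y2, -⟩ := hpsi (Ceta η t) (by rw [zr]; linarith [ht.1]) (by rw [zr]; linarith)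
          zi.ge (Or.inl (by rw [zr]; linarith))
        have y3 := (abs_le.1 y2).2
        rw [zr, zi]
        have ht0 : 0 < t := by linarith
        have y4 : (2*t) / ((2*t)^2 + η^2) * ℓ⁻¹ ≤ γ/2 := by
          calc (2*t) / ((2*t)^2 + η^2) * ℓ⁻¹ ≤ (2*t) / ((2*t) * (4*a1)) * ℓ⁻¹ := by
                have : (2*t) * (4*a1) ≤ (2*t) * (2*t) :=
                  mul_le_mul_of_nonneg_left k1 (by linarith)
                have : (2*t) * (4*a1) ≤ (2*t)^2 + η^2 := by linarith [sq_nonneg η]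
                gcongr
            _ = γ/2 := by rw [ha1]; field_simp; norm_num
        linarith
    · have zr := arc_re (η := η) ht2
      have zi := arc_im (η := η) ht2
      have hi := ceta_im (η := η) ht.2
      have hsn := arc_sin ht2 ht.2
      have hcs1 := Real.neg_one_le_cos (Real.pi * (2*t-1))
      have hcs2 := Real.cos_le_one (Real.pi * (2*t-1))
      have hre0 : 0 ≤ (Ceta η t).re := by rw [zr]; linarith
      have hre1 : (Ceta η t).re ≤ 1 := by rw [zr]; linarith
      have hμ := hηp.trans_le hi
      by_cases hin : 1 - r ≤ (Ceta η t).re ∧ (Ceta η t).im ≤ h0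
      · exact Or.inr (Or.inr (hN _ hin.1 hre1 hi hin.2))
      · left
        rw [hre _ γ hμ]
        have hor : (Ceta η t).re ≤ 1 - r ∨ h0 ≤ (Ceta η t).im := by
          by_contra hcon
          push Not at hcon
          exact hin ⟨hcon.1.le, hcon.2.le⟩
        obtain ⟨y2, -⟩ := hpsi (Ceta η t) hre0 hre1 hi hor
        have y3 := (abs_le.1 y2).2
        have y4 : (Ceta η t).re / ((Ceta η t).re^2 + (Ceta η t).im^2) ≤ 1 := by
          rw [div_le_one (by positivity), zr, zi]
          have := Real.sin_sq_add_cos_sq (Real.pi * (2*t-1))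
          have hp := mul_nonneg hηp.le hsn
          linarith [sq_nonneg η]
        have y5 : (Ceta η t).re / ((Ceta η t).re^2 + (Ceta η t).im^2) * ℓ⁻¹ ≤ 1 * ℓ⁻¹ := by
          gcongr
        have y6 : ℓ⁻¹ ≤ γ/4 := by
          rw [div_le_iff₀ hℓ] at gℓ
          rw [inv_le_iff_one_le_mul₀ hℓ]
          linarith
        linarith
  have hc1p : 0 < c1 * η^κ := by positivity
  refine ⟨η, ?_, ?_, ?_⟩
  · rw [Real.rpow_neg hγ0.le, hη, div_eq_mul_inv]
    norm_num
    gcongr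
  · apply winding_one hdiff hηp (t0 := a0/2) (t1 := a1/2) (by positivity) (by linarith)
      (by linarith)
    · intro t ht
      right
      linarith [hA t ht]
    · intro t ht
      left
      linarith [hB t ht]
    · intro t ht
      rcases hCc t ht with h | h | h
      · left; linarith
      · right; linarith
      · right; linarith
    · linarith [hA (a0/2) ⟨by positivity, le_rfl⟩]
    · linarith [hS3 (a1/2) (by linarith) (by linarith)]
  · have hγκ : 0 < γ^(-(2*κ)) := Real.rpow_pos_of_pos hγ0 _
    have hγκ1 : γ^(-(2*κ)) ≤ 1 := Real.rpow_le_one_of_one_le_of_nonpos (by linarith) (by linarith)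
    have hdp : 0 < d := by positivity
    have b1 : d * γ^(-(2*κ)) ≤ d := mul_le_of_le_one_right hdp.le hγκ1
    have b2 : d * γ^(-(2*κ)) ≤ c1 * η^κ := by
      rw [hηκ, ← mul_assoc]
      gcongr
    intro t ht
    have n1 := abs_le.1 (Complex.abs_re_le_norm (PhiInv U (Ceta η t) - (γ : ℂ)))
    have n2 := abs_le.1 (Complex.abs_im_le_norm (PhiInv U (Ceta η t) - (γ : ℂ)))
    rcases le_total t (a0/2) with k | k
    · linarith [hA t ⟨ht.1, k⟩]
    rcases le_total t (a1/2) with k' | k'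
    · linarith [hB t ⟨k, k'⟩]
    rcases hCc t ⟨k', ht.2⟩ with h | h | h
    · linarith
    · linarith
    · linarith

end
end
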